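/- Let p be an odd prime, n a positive integer with p^n ≤ 2^30, and k a positive integer such that the monomial X^k is planar over the finite field F with p^n elements. Then there exists an integer a with 0 ≤ a < n such that either (i) there exists an integer i with 0 ≤ i < n, n/gcd(i,n) odd, and k ≡ p^a·(p^i + 1) (mod p^n − 1), or (ii) p = 3 and there exists an integer i with 0 ≤ i < n, gcd(i, 2n) = 1, and k ≡ 3^a·(3^i + 1)/2 (mod 3^n − 1). -/

import Mathlib

namespace PM

/-- An abstract copy of the ring of integers of the `p`-th cyclotomic field. -/
theorem exists_ring_aux (p : ℕ) (hp : p.Prime) (K : Type) [Field K] [NumberField K] [IsCyclotomicExtension {p} ℚ K] :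
    ∃ (R : Type) (_ : CommRing R) (_ : IsDomain R) (z : R) (f : R →+* R),
      Prime (z - 1) ∧ z ^ p = 1 ∧ z * f z = 1 ∧ (z - 1) ^ (p - 1) ∣ (p : R) := by
  have : Fact p.Prime := ⟨hp⟩
  have : NeZero p := ⟨hp.ne_zero⟩
  have hz : IsPrimitiveRoot (IsCyclotomicExtension.zeta p ℚ K) p :=
    IsCyclotomicExtension.zeta_spec p ℚ K
  have hirr : Irreducible (Polynomial.cyclotomic p ℚ) :=
    Polynomial.cyclotomic.irreducible_rat hp.pos
  let g := (IsCyclotomicExtension.autEquivPow K hirr).symm (-1)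
  have hzi : IsPrimitiveRoot hz.toInteger p := hz.toInteger_isPrimitiveRoot
  refine ⟨NumberField.RingOfIntegers K, inferInstance, inferInstance, hz.toInteger,
    (NumberField.RingOfIntegers.mapRingEquiv g.toRingEquiv).toRingHom, ?_, hzi.pow_eq_one, ?_, ?_⟩
  · exact hz.zeta_sub_one_prime'
  · have h1 : g (IsCyclotomicExtension.zeta p ℚ K) = (IsCyclotomicExtension.zeta p ℚ K) ^ ((-1 : (ZMod p)ˣ) : ZMod p).val := by
      have := IsPrimitiveRoot.autToPow_spec ℚ hz g
      rw [← this]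
      congr 2
      have h2 := (IsCyclotomicExtension.autEquivPow K hirr).apply_symm_apply (-1)
      exact congrArg _ h2
    apply NumberField.RingOfIntegers.ext
    have h3 : algebraMap (NumberField.RingOfIntegers K) K ((NumberField.RingOfIntegers.mapRingEquiv g.toRingEquiv).toRingHom hz.toInteger) = g (IsCyclotomicExtension.zeta p ℚ K) := rfl
    have h4 : algebraMap (NumberField.RingOfIntegers K) K hz.toInteger = IsCyclotomicExtension.zeta p ℚ K := rfl
    simp only [map_mul, map_one]; rw [h3, h4, h1, ← pow_succ', hz.pow_eq_one_iff_dvd]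
    rw [← ZMod.natCast_eq_zero_iff]
    push_cast
    rw [ZMod.natCast_val]
    simp
  · obtain ⟨y, _, hy⟩ := hzi.self_sub_one_pow_dvd_order (k := p - 1) (by have := hp.pos; omega)
    exact ⟨y, by rw [hy, mul_comm]⟩

theorem exists_ring (p : ℕ) (hp : p.Prime) :
    ∃ (R : Type) (_ : CommRing R) (_ : IsDomain R) (z : R) (f : R →+* R),
      Prime (z - 1) ∧ z ^ p = 1 ∧ z * f z = 1 ∧ (z - 1) ^ (p - 1) ∣ (p : R) := by
  have : NeZero p := ⟨hp.ne_zero⟩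
  have h : @IsCyclotomicExtension {p} ℚ (CyclotomicField p ℚ) _ _ DivisionRing.toRatAlgebra := by
    have h0 := CyclotomicField.isCyclotomicExtension p ℚ
    convert! h0
  exact exists_ring_aux p hp (CyclotomicField p ℚ)

end PM

namespace PM

section charsum
variable {p : ℕ} [Fact p.Prime] {R : Type} [CommRing R] [IsDomain R] {z : R} {f : R →+* R}

/-- The additive character of `ZMod p` attached to a `p`-th root of unity. -/
def ec (z : R) (c : ZMod p) : R := z ^ c.val

theorem ec_zero : ec z (0 : ZMod p) = 1 := by simp [ec]

theorem ec_add (hz : z ^ p = 1) (c d : ZMod p) : ec z (c + d) = ec z c * ec z d := by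
  rw [ec, ec, ec, ← pow_add, ZMod.val_add]
  conv_rhs => rw [← Nat.mod_add_div (c.val + d.val) p, pow_add, pow_mul, hz, one_pow, mul_one]

theorem ec_ne_one (hz : z ^ p = 1) (hl : Prime (z - 1)) {c : ZMod p} (hc : c ≠ 0) : ec z c ≠ 1 := by
  intro h
  have hcop : Nat.Coprime c.val p := by
    have h1 : c.val < p := ZMod.val_lt c
    have h2 : c.val ≠ 0 := by rwa [Ne, ZMod.val_eq_zero]
    exact ((Nat.Prime.coprime_iff_not_dvd Fact.out).2 (fun h => absurd (Nat.le_of_dvd (Nat.pos_of_ne_zero h2) h) (by omega))).symm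
  have h1 : orderOf z ∣ Nat.gcd c.val p := Nat.dvd_gcd (orderOf_dvd_of_pow_eq_one h) (orderOf_dvd_of_pow_eq_one hz)
  rw [hcop, Nat.dvd_one, orderOf_eq_one_iff] at h1
  exact hl.ne_zero (by rw [h1, sub_self])

theorem f_ec (hz : z ^ p = 1) (hf : z * f z = 1) (c : ZMod p) : f (ec z c) = ec z (-c) := by
  have h1 : ec z c * f (ec z c) = 1 := by
    rw [ec, map_pow, ← mul_pow, hf, one_pow]
  have h2 : ec z c * ec z (-c) = 1 := by
    rw [← ec_add hz, add_neg_cancel, ec_zero]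
  calc f (ec z c) = f (ec z c) * (ec z c * ec z (-c)) := by rw [h2, mul_one]
    _ = (ec z c * f (ec z c)) * ec z (-c) := by ring
    _ = _ := by rw [h1, one_mul]

theorem ec_sub_one (c : ZMod p) : ∃ u : R, ec z c - 1 = (z - 1) * u ∧ (z - 1) ∣ u - (c.val : R) := by
  refine ⟨∑ i ∈ Finset.range c.val, z ^ i, ?_, ?_⟩
  · rw [ec, mul_geom_sum]
  · have : ∑ i ∈ Finset.range c.val, z ^ i - (c.val : R) = ∑ i ∈ Finset.range c.val, (z ^ i - 1) := by
      simp
    rw [this]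
    apply Finset.dvd_sum
    intro i _
    simpa using sub_dvd_pow_sub_pow z 1 i

theorem f_pow_dvd (hf : z * f z = 1) {i : ℕ} {x : R} (h : (z - 1) ^ i ∣ x) : (z - 1) ^ i ∣ f x := by
  obtain ⟨y, rfl⟩ := h
  have h1 : f (z - 1) = (z - 1) * (- f z) := by
    rw [map_sub, map_one]; linear_combination hf
  rw [map_mul, map_pow, h1, mul_pow, mul_assoc]
  exact dvd_mul_right _ _

variable {F : Type*} [Field F] [Fintype F]

/-- Walsh sum. -/
def Wsum (z : R) (k : ℕ) (α β : F →+ ZMod p) : R := ∑ x : F, ec z (α x + β (x ^ k))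

theorem sum_ec_zero (hz : z ^ p = 1) (hl : Prime (z - 1)) {β : F →+ ZMod p} (hβ : β ≠ 0) :
    ∑ x : F, ec z (β x) = 0 := by
  obtain ⟨x0, hx0⟩ := DFunLike.ne_iff.1 hβ
  have h1 : ∑ x : F, ec z (β x) = ec z (β x0) * ∑ x : F, ec z (β x) := by
    rw [Finset.mul_sum, ← Equiv.sum_comp (Equiv.addLeft x0)]
    apply Finset.sum_congr rfl
    intro x _
    rw [Equiv.coe_addLeft, map_add, ec_add hz]
  have h2 : (ec z (β x0) - 1) * ∑ x : F, ec z (β x) = 0 := by linear_combination -h1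
  rcases mul_eq_zero.1 h2 with h | h
  · exact absurd (sub_eq_zero.1 h) (ec_ne_one hz hl (by simpa using hx0))
  · exact h

theorem W_mul (hz : z ^ p = 1) (hl : Prime (z - 1)) (k : ℕ)
    (hpl : ∀ a : F, a ≠ 0 → Function.Bijective (fun x : F => (x + a) ^ k - x ^ k))
    (α : F →+ ZMod p) {β : F →+ ZMod p} (hβ : β ≠ 0) :
    Wsum z k α β * Wsum z k (-α) (-β) = (Fintype.card F : R) := by
  have h1 : Wsum z k α β * Wsum z k (-α) (-β)
      = ∑ y : F, ∑ a : F, ec z (α a) * ec z (β ((y + a) ^ k - y ^ k)) := by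
    rw [Wsum, Wsum, Finset.sum_mul_sum, Finset.sum_comm]
    apply Finset.sum_congr rfl
    intro y _
    rw [← Equiv.sum_comp (Equiv.addLeft y)]
    apply Finset.sum_congr rfl
    intro a _
    rw [← ec_add hz, ← ec_add hz]
    congr 1
    simp only [Equiv.coe_addLeft, map_add, map_sub, AddMonoidHom.neg_apply]
    ring
  classical
  rw [h1, Finset.sum_comm, ← Finset.sum_erase_add _ _ (Finset.mem_univ (0 : F))]
  rw [Finset.sum_eq_zero]
  · simp [ec_zero]
  · intro a ha
    rw [← Finset.mul_sum]
    have := Function.Bijective.sum_comp (hpl a (Finset.ne_of_mem_erase ha)) (fun t => ec z (β t))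
    rw [this, sum_ec_zero hz hl hβ, mul_zero]

theorem W_dvd (hz : z ^ p = 1) (hl : Prime (z - 1)) (hf : z * f z = 1)
    (hpp : (z - 1) ^ (p - 1) ∣ (p : R)) (n : ℕ) (hF : Fintype.card F = p ^ n) (e : ℕ)
    (he : 2 * e = n * (p - 1)) (k : ℕ)
    (hpl : ∀ a : F, a ≠ 0 → Function.Bijective (fun x : F => (x + a) ^ k - x ^ k))
    (α β : F →+ ZMod p) : (z - 1) ^ e ∣ Wsum z k α β := by
  have hq : (z - 1) ^ (2 * e) ∣ (Fintype.card F : R) := by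
    rw [hF, he, mul_comm n, pow_mul, Nat.cast_pow]
    exact pow_dvd_pow_of_dvd hpp n
  by_cases hβ : β = 0
  · subst hβ
    by_cases hα : α = 0
    · subst hα
      have : Wsum z k (0 : F →+ ZMod p) 0 = (Fintype.card F : R) := by
        simp [Wsum, ec_zero]
      rw [this]
      exact dvd_trans (pow_dvd_pow _ (by omega)) hq
    · have : Wsum z k α 0 = 0 := by
        simpa [Wsum] using sum_ec_zero hz hl hα
      rw [this]; exact dvd_zero _
  · have hm := W_mul hz hl k hpl α hβ
    have hfW : ∀ α β : F →+ ZMod p, f (Wsum z k α β) = Wsum z k (-α) (-β) := by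
      intro α β
      rw [Wsum, map_sum, Wsum]
      apply Finset.sum_congr rfl
      intro x _
      rw [f_ec hz hf]
      congr 1
      simp only [AddMonoidHom.neg_apply]; ring
    have hi : ∀ i ≤ e, (z - 1) ^ i ∣ Wsum z k α β := by
      intro i
      induction i with
      | zero => simp
      | succ i ih =>
        intro hie
        have h1 := ih (by omega)
        have h2 := f_pow_dvd hf h1
        rw [hfW] at h2
        obtain ⟨V, hV⟩ := h1
        obtain ⟨V', hV'⟩ := h2
        rw [← hm, hV, hV'] at hq
        have h3 : (z - 1) ^ (2 * i) * (z - 1) ∣ (z - 1) ^ (2 * i) * (V * V') := by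
          rw [← pow_succ]
          refine dvd_trans (pow_dvd_pow _ (by omega : 2 * i + 1 ≤ 2 * e)) ?_
          convert hq using 1
          ring
        have h4 := (mul_dvd_mul_iff_left (pow_ne_zero _ hl.ne_zero)).1 h3
        rcases hl.dvd_or_dvd h4 with h | h
        · rw [hV, pow_succ]; exact mul_dvd_mul_left _ h
        · have h5 : (z - 1) ^ (i + 1) ∣ Wsum z k (-α) (-β) := by
            rw [hV', pow_succ]; exact mul_dvd_mul_left _ h
          have h6 := f_pow_dvd hf h5
          rwa [hfW, neg_neg, neg_neg] at h6
    exact hi e le_rfl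

theorem prod_dvd (hz : z ^ p = 1) (k e : ℕ)
    (hW : ∀ α β : F →+ ZMod p, (z - 1) ^ e ∣ Wsum z k α β)
    (αs βs : List (F →+ ZMod p)) : ∀ α β : F →+ ZMod p,
    (z - 1) ^ e ∣ ∑ x : F, ec z (α x + β (x ^ k)) * (αs.map (fun a => ec z (a x) - 1)).prod *
      (βs.map (fun b => ec z (b (x ^ k)) - 1)).prod := by
  induction αs with
  | nil =>
    induction βs with
    | nil => intro α β; simpa [Wsum] using hW α β
    | cons b bs ih =>
      intro α β
      have h := dvd_sub (ih α (β + b)) (ih α β)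
      rw [← Finset.sum_sub_distrib] at h
      convert h using 2 with x
      simp only [List.map_nil, List.prod_nil, List.map_cons, List.prod_cons, AddMonoidHom.add_apply]
      rw [← add_assoc, ec_add hz (α x + β (x ^ k))]
      ring
  | cons a as ih =>
    intro α β
    have h := dvd_sub (ih (α + a) β) (ih α β)
    rw [← Finset.sum_sub_distrib] at h
    convert h using 2 with x
    simp only [List.map_cons, List.prod_cons, AddMonoidHom.add_apply]
    rw [show α x + a x + β (x ^ k) = (α x + β (x ^ k)) + a x by ring, ec_add hz (α x + β (x ^ k))]
    ring

theorem list_prod_aux (l : List (ZMod p)) : ∃ u : R,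
    (l.map (fun c => ec z c - 1)).prod = (z - 1) ^ l.length * u ∧
      (z - 1) ∣ u - ((l.map ZMod.val).prod : ℕ) := by
  induction l with
  | nil => exact ⟨1, by simp, by simp⟩
  | cons c l ih =>
    obtain ⟨u, h1, h2⟩ := ih
    obtain ⟨v, h3, h4⟩ := ec_sub_one (z := z) c
    refine ⟨v * u, ?_, ?_⟩
    · simp only [List.map_cons, List.prod_cons, List.length_cons, h1, h3]; ring
    · simp only [List.map_cons, List.prod_cons]
      push_cast at h2 ⊢
      have : v * u - (c.val : R) * ((l.map ZMod.val).map (Nat.cast : ℕ → R)).prod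
        = (v - c.val) * u + c.val * (u - ((l.map ZMod.val).map (Nat.cast : ℕ → R)).prod) := by ring
      rw [this]
      exact dvd_add (dvd_mul_of_dvd_left h4 _) (dvd_mul_of_dvd_right h2 _)

theorem nat_dvd (hl : Prime (z - 1)) (hpp : (z - 1) ∣ (p : R)) (N : ℕ)
    (h : (z - 1) ∣ (N : R)) : p ∣ N := by
  by_contra hN
  have hc : Nat.Coprime p N := (Nat.Prime.coprime_iff_not_dvd Fact.out).2 hN
  have h1 : IsCoprime (p : ℤ) (N : ℤ) := Nat.isCoprime_iff_coprime.2 hc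
  obtain ⟨a, b, hab⟩ := h1
  have h2 : (a : R) * p + b * N = 1 := by exact_mod_cast congrArg (Int.cast : ℤ → R) hab
  apply hl.not_isUnit
  have h3 := dvd_add (dvd_mul_of_dvd_right hpp (a : R)) (dvd_mul_of_dvd_right h (b : R))
  rw [h2] at h3
  exact isUnit_iff_dvd_one.2 h3

end charsum

/-- Vanishing of low degree mixed moments, over the prime field. -/
theorem moment_zmod (p n k : ℕ) [Fact p.Prime] (hp2 : p ≠ 2) (F : Type*) [Field F] [Fintype F]
    (hF : Fintype.card F = p ^ n)
    (hpl : ∀ a : F, a ≠ 0 → Function.Bijective (fun x : F => (x + a) ^ k - x ^ k))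
    (αs βs : List (F →+ ZMod p)) (hlen : 2 * (αs.length + βs.length) < n * (p - 1)) :
    ∑ x : F, (αs.map (fun a => a x)).prod * (βs.map (fun b => b (x ^ k))).prod = 0 := by
  obtain ⟨R, _, _, z, f, hl, hz, hf, hpp⟩ := exists_ring p Fact.out
  have hpodd : Odd p := Nat.Prime.odd_of_ne_two Fact.out hp2
  obtain ⟨r, hr⟩ := hpodd
  obtain ⟨e, he⟩ : ∃ e, 2 * e = n * (p - 1) := ⟨n * r, by rw [hr, Nat.add_sub_cancel]; ring⟩
  have h1 := prod_dvd hz k e (W_dvd hz hl hf hpp n hF e he k hpl) αs βs 0 0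
  have hp1 : (z - 1) ∣ (p : R) := dvd_trans (dvd_pow_self _ (by
    have : p.Prime := Fact.out
    have := this.two_le; omega)) hpp
  choose u hu1 hu2 using fun l : List (ZMod p) => list_prod_aux (R := R) (z := z) l
  have h2 : ∑ x : F, ec z ((0 : F →+ ZMod p) x + (0 : F →+ ZMod p) (x ^ k)) *
      (αs.map (fun a => ec z (a x) - 1)).prod * (βs.map (fun b => ec z (b (x ^ k)) - 1)).prod
      = (z - 1) ^ (αs.length + βs.length) *
        ∑ x : F, u (αs.map fun a => a x) * u (βs.map fun b => b (x ^ k)) := by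
    rw [Finset.mul_sum]
    apply Finset.sum_congr rfl
    intro x _
    have e1 := hu1 (αs.map fun a => a x)
    have e2 := hu1 (βs.map fun b => b (x ^ k))
    rw [List.map_map, List.length_map] at e1 e2
    simp only [Function.comp_def] at e1 e2
    rw [e1, e2]
    simp only [AddMonoidHom.zero_apply, add_zero, ec_zero]
    ring
  rw [h2] at h1
  have h3 : (z - 1) ∣ ∑ x : F, u (αs.map fun a => a x) * u (βs.map fun b => b (x ^ k)) := by
    have h4 : (z - 1) ^ (αs.length + βs.length) * (z - 1) ∣ (z - 1) ^ (αs.length + βs.length) *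
        ∑ x : F, u (αs.map fun a => a x) * u (βs.map fun b => b (x ^ k)) := by
      rw [← pow_succ]
      exact dvd_trans (pow_dvd_pow _ (by omega)) h1
    exact (mul_dvd_mul_iff_left (pow_ne_zero _ hl.ne_zero)).1 h4
  set N : ℕ := ∑ x : F, ((αs.map fun a => a x).map ZMod.val).prod *
    ((βs.map fun b => b (x ^ k)).map ZMod.val).prod with hN
  have h5 : (z - 1) ∣ (N : R) := by
    have h6 : (z - 1) ∣ ∑ x : F, (u (αs.map fun a => a x) * u (βs.map fun b => b (x ^ k)) -
        (((αs.map fun a => a x).map ZMod.val).prod : ℕ) *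
        (((βs.map fun b => b (x ^ k)).map ZMod.val).prod : ℕ)) := by
      apply Finset.dvd_sum
      intro x _
      have e1 := hu2 (αs.map fun a => a x)
      have e2 := hu2 (βs.map fun b => b (x ^ k))
      generalize u (αs.map fun a => a x) = A at *
      generalize u (βs.map fun b => b (x ^ k)) = B at *
      generalize ((((αs.map fun a => a x).map ZMod.val).prod : ℕ) : R) = C at *
      generalize ((((βs.map fun b => b (x ^ k)).map ZMod.val).prod : ℕ) : R) = D at *
      have : A * B - C * D = (A - C) * B + C * (B - D) := by ring
      rw [this]
      exact dvd_add (dvd_mul_of_dvd_left e1 _) (dvd_mul_of_dvd_right e2 _)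
    rw [Finset.sum_sub_distrib] at h6
    have h7 := dvd_sub h3 h6
    rw [sub_sub_cancel] at h7
    rw [hN]; push_cast at h7 ⊢; exact h7
  have h8 := nat_dvd hl hp1 N h5
  rw [← ZMod.natCast_eq_zero_iff, hN] at h8
  push_cast at h8
  rw [← h8]
  apply Finset.sum_congr rfl
  intro x _
  simp [List.map_map, Function.comp_def]

end PM

namespace PM

section moment
variable {F : Type*} [Field F] [Fintype F]

/-- planarity of `X^k` -/
def Planar (F : Type*) [Field F] (k : ℕ) : Prop :=
  ∀ a : F, a ≠ 0 → Function.Bijective (fun x : F => (x + a) ^ k - x ^ k)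

theorem charP_of_card {p n : ℕ} [Fact p.Prime] (hn : n ≠ 0) (hF : Fintype.card F = p ^ n) : CharP F p := by
  obtain ⟨q, hc⟩ := CharP.exists F
  obtain ⟨m, hq, hm⟩ := FiniteField.card F q
  have h : q = p := by
    have h1 : q ∣ p ^ n := by rw [← hF, hm]; exact dvd_pow_self _ m.pos.ne'
    exact (Nat.prime_dvd_prime_iff_eq hq Fact.out).1 (hq.dvd_of_dvd_pow h1)
  rw [← h]; exact hc

theorem moment_F (p n k : ℕ) [Fact p.Prime] (hp2 : p ≠ 2) (hn : n ≠ 0)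
    (hF : Fintype.card F = p ^ n) (hpl : Planar F k)
    (as bs : List ℕ) (hlen : 2 * (as.length + bs.length) < n * (p - 1)) :
    ∑ x : F, (as.map (fun a => x ^ p ^ a)).prod * (bs.map (fun b => (x ^ k) ^ p ^ b)).prod = 0 := by
  haveI := charP_of_card hn hF
  letI : Algebra (ZMod p) F := ZMod.algebra F p
  let B := Module.finBasis (ZMod p) F
  have hex : ∀ (x : F) (a : ℕ), x ^ p ^ a = ∑ t, algebraMap (ZMod p) F ((B.coord t).toAddMonoidHom x) * (B t) ^ p ^ a := by
    intro x a
    conv_lhs => rw [← B.sum_repr x, sum_pow_char_pow]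
    apply Finset.sum_congr rfl
    intro t _
    rw [Algebra.smul_def, mul_pow, ← map_pow, ZMod.pow_card_pow]
    rfl
  have key : ∀ (as bs : List ℕ) (αs βs : List (F →+ ZMod p)),
      2 * (as.length + bs.length + αs.length + βs.length) < n * (p - 1) →
      ∑ x : F, (as.map (fun a => x ^ p ^ a)).prod * (bs.map (fun b => (x ^ k) ^ p ^ b)).prod *
        algebraMap (ZMod p) F ((αs.map (fun a => a x)).prod * (βs.map (fun b => b (x ^ k))).prod) = 0 := by
    intro as
    induction as with
    | nil =>
      intro bs
      induction bs with
      | nil =>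
        intro αs βs h
        have := moment_zmod p n k hp2 F hF hpl αs βs (by simpa using h)
        simp only [List.map_nil, List.prod_nil, one_mul, ← map_sum, this, map_zero]
      | cons b bs ih =>
        intro αs βs h
        simp only [List.length_cons, List.length_nil] at h ih
        have h2 : ∀ x : F, ((([] : List ℕ).map (fun a => x ^ p ^ a)).prod * ((b :: bs).map (fun b => (x ^ k) ^ p ^ b)).prod *
          algebraMap (ZMod p) F ((αs.map (fun a => a x)).prod * (βs.map (fun b => b (x ^ k))).prod))
          = ∑ t, (B t) ^ p ^ b * ((([] : List ℕ).map (fun a => x ^ p ^ a)).prod * (bs.map (fun b => (x ^ k) ^ p ^ b)).prod *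
          algebraMap (ZMod p) F ((αs.map (fun a => a x)).prod * (((B.coord t).toAddMonoidHom :: βs).map (fun b => b (x ^ k))).prod)) := by
          intro x
          rw [List.map_cons, List.prod_cons, hex, Finset.sum_mul, Finset.mul_sum, Finset.sum_mul]
          apply Finset.sum_congr rfl
          intro t _
          rw [List.map_cons, List.prod_cons]
          simp only [map_mul]
          ring
        rw [Finset.sum_congr rfl (fun x _ => h2 x), Finset.sum_comm]
        apply Finset.sum_eq_zero
        intro t _
        rw [← Finset.mul_sum, ih _ _ (by simp only [List.length_cons]; omega), mul_zero]
    | cons a as ih =>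
        intro bs αs βs h
        simp only [List.length_cons] at h
        have h2 : ∀ x : F, (((a :: as).map (fun a => x ^ p ^ a)).prod * (bs.map (fun b => (x ^ k) ^ p ^ b)).prod *
          algebraMap (ZMod p) F ((αs.map (fun a => a x)).prod * (βs.map (fun b => b (x ^ k))).prod))
          = ∑ t, (B t) ^ p ^ a * ((as.map (fun a => x ^ p ^ a)).prod * (bs.map (fun b => (x ^ k) ^ p ^ b)).prod *
          algebraMap (ZMod p) F ((((B.coord t).toAddMonoidHom :: αs).map (fun a => a x)).prod * (βs.map (fun b => b (x ^ k))).prod)) := by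
          intro x
          rw [List.map_cons, List.prod_cons, hex, Finset.sum_mul, Finset.sum_mul, Finset.sum_mul]
          apply Finset.sum_congr rfl
          intro t _
          rw [List.map_cons, List.prod_cons]
          simp only [map_mul]
          ring
        rw [Finset.sum_congr rfl (fun x _ => h2 x), Finset.sum_comm]
        apply Finset.sum_eq_zero
        intro t _
        rw [← Finset.mul_sum, ih _ _ _ (by simp only [List.length_cons]; omega), mul_zero]
  have := key as bs [] [] (by simpa using hlen)
  simpa using this

theorem sum_pow_F [DecidableEq F] (i : ℕ) :
    ∑ x : F, x ^ i = if i ≠ 0 ∧ (Fintype.card F - 1) ∣ i then -1 else 0 := by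
  by_cases h0 : i = 0
  · subst h0; simp
  · rw [← Finset.sum_erase_add _ _ (Finset.mem_univ (0 : F)), zero_pow h0, add_zero]
    have h1 := FiniteField.sum_pow_units F i
    have h2 : ∑ x ∈ Finset.univ.erase (0 : F), x ^ i = ∑ x : Fˣ, (x ^ i : F) := by
      symm
      refine Finset.sum_bij (fun u _ => (u : F)) (fun u _ => by simp) (fun u _ v _ h => Units.ext h)
        (fun y hy => ⟨Units.mk0 y (Finset.ne_of_mem_erase hy), Finset.mem_univ _, rfl⟩) (fun _ _ => rfl)
    rw [h2, h1]
    simp [h0]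

theorem list_prod_pow {ι : Type*} (x : F) (l : List ι) (g : ι → ℕ) : (l.map (fun a => x ^ g a)).prod = x ^ (l.map g).sum := by
  induction l with
  | nil => simp
  | cons a l ih => rw [List.map_cons, List.prod_cons, ih, List.map_cons, List.sum_cons, pow_add]

/-- digit expansion from rotations -/
theorem digits_rot (p n A : ℕ) (hp : 2 ≤ p) (hA : A < p ^ n - 1) :
    ∃ as : List ℕ, (as.map (fun a => p ^ a)).sum = A ∧
      (p - 1) * ∑ i ∈ Finset.range n, (p ^ i * A) % (p ^ n - 1) = (p ^ n - 1) * as.length := by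
  set Q := p ^ n - 1 with hQ
  have hQ1 : p ^ n = Q + 1 := by have := Nat.one_le_pow n p (by omega); omega
  let m : ℕ → ℕ := fun i => (p ^ i * A) % Q
  let d : ℕ → ℕ := fun i => (p * m i) / Q
  have hm : ∀ i, p * m i = Q * d i + m (i + 1) := by
    intro i
    have h1 : m (i + 1) = (p * m i) % Q := by
      show (p ^ (i + 1) * A) % Q = (p * ((p ^ i * A) % Q)) % Q
      rw [pow_succ', mul_assoc, Nat.mul_mod_mod]
    rw [h1]; exact (Nat.div_add_mod _ _).symm
  have hm0 : m 0 = A := by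
    show (p ^ 0 * A) % Q = A
    rw [pow_zero, one_mul, Nat.mod_eq_of_lt hA]
  have hmn : m n = A := by
    show (p ^ n * A) % Q = A
    rw [hQ1, Nat.add_mul, one_mul, Nat.mul_add_mod, Nat.mod_eq_of_lt hA]
  have hex : ∀ i, ∃ as : List ℕ, as.length = ∑ j ∈ Finset.range i, d j ∧ p ^ i * A = Q * (as.map (fun a => p ^ a)).sum + m i := by
    intro i
    induction i with
    | zero => exact ⟨[], by simp, by simp [hm0]⟩
    | succ i ih =>
      obtain ⟨as, h1, h2⟩ := ih
      refine ⟨as.map (· + 1) ++ List.replicate (d i) 0, ?_, ?_⟩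
      · rw [List.length_append, List.length_map, List.length_replicate, h1, Finset.sum_range_succ]
      · have h3 : ((as.map (· + 1)).map (fun a => p ^ a)).sum = p * (as.map (fun a => p ^ a)).sum := by
          rw [List.map_map, ← List.sum_map_mul_left]
          congr 1
          apply List.map_congr_left
          intro a _
          simp [pow_succ']
        rw [List.map_append, List.sum_append, h3, List.map_replicate, List.sum_replicate, pow_zero, smul_eq_mul, mul_one,
          pow_succ', mul_assoc, h2, mul_add, hm]
        ring
  obtain ⟨as, h1, h2⟩ := hex n
  refine ⟨as, ?_, ?_⟩
  · rw [hmn, hQ1, Nat.add_mul, one_mul] at h2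
    exact (Nat.eq_of_mul_eq_mul_left (by omega) (Nat.add_right_cancel h2)).symm
  · rw [h1, Finset.mul_sum]
    have h3 : ∑ i ∈ Finset.range n, p * m i = ∑ i ∈ Finset.range n, (Q * d i + m (i + 1)) :=
      Finset.sum_congr rfl (fun i _ => hm i)
    have h4 : ∑ i ∈ Finset.range n, m (i + 1) = ∑ i ∈ Finset.range n, m i := by
      have e1 := Finset.sum_range_succ m n
      have e2 := Finset.sum_range_succ' m n
      omega
    rw [Finset.sum_add_distrib, h4] at h3
    rw [Finset.mul_sum]
    have h5 : ∑ i ∈ Finset.range n, p * m i = ∑ i ∈ Finset.range n, (p - 1) * m i + ∑ i ∈ Finset.range n, m i := by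
      rw [← Finset.sum_add_distrib]
      apply Finset.sum_congr rfl
      intro i _
      obtain ⟨r, rfl⟩ : ∃ r, p = r + 1 := ⟨p - 1, by omega⟩
      simp [Nat.add_mul]
    have : ∑ i ∈ Finset.range n, (p - 1) * m i = ∑ i ∈ Finset.range n, Q * d i := by omega
    exact this

theorem J_bound (p n k : ℕ) [Fact p.Prime] (hp2 : p ≠ 2) (hn : n ≠ 0)
    (hF : Fintype.card F = p ^ n) (hpl : Planar F k) (bs : List ℕ) :
    2 * (p - 1) * ∑ i ∈ Finset.range n, (p ^ i * ((bs.map (fun b => p ^ b)).sum * k)) % (p ^ n - 1)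
      ≤ (2 * bs.length + n * (p - 1)) * (p ^ n - 1) := by
  classical
  have hp : 2 ≤ p := (Fact.out : p.Prime).two_le
  have hQ0 : 0 < p ^ n - 1 := by
    have := Nat.one_lt_pow hn hp; omega
  set Q := p ^ n - 1 with hQ
  set j := (bs.map (fun b => p ^ b)).sum with hj
  have hmm : ∀ i, (p ^ i * (j * k)) % Q = (p ^ i * ((j * k) % Q)) % Q := fun i => by rw [Nat.mul_mod_mod]
  simp only [hmm]
  have hmlt : (j * k) % Q < Q := Nat.mod_lt _ hQ0
  set m := (j * k) % Q with hm
  by_contra hcon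
  push Not at hcon
  have hm0 : m ≠ 0 := by
    intro h; rw [h] at hcon; simp at hcon
  obtain ⟨as, h1, h2⟩ := digits_rot p n (Q - m) hp (by omega)
  rw [← hQ] at h2
  have h3 : ∑ i ∈ Finset.range n, (p ^ i * (Q - m)) % Q + ∑ i ∈ Finset.range n, (p ^ i * m) % Q ≤ n * Q := by
    rw [← Finset.sum_add_distrib]
    calc _ ≤ ∑ i ∈ Finset.range n, Q := by
          apply Finset.sum_le_sum
          intro i _
          have e1 : ((p ^ i * (Q - m)) % Q + (p ^ i * m) % Q) % Q = 0 := by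
            rw [← Nat.add_mod, ← Nat.mul_add, Nat.sub_add_cancel hmlt.le, Nat.mul_mod_left]
          have e2 := Nat.mod_lt (p ^ i * (Q - m)) hQ0
          have e3 := Nat.mod_lt (p ^ i * m) hQ0
          by_contra h
          push Not at h
          rw [Nat.mod_eq_sub_mod h.le, Nat.mod_eq_of_lt (by omega)] at e1
          omega
      _ = n * Q := by simp
  have h4 : 2 * (as.length + bs.length) < n * (p - 1) := by
    set SA := ∑ i ∈ Finset.range n, (p ^ i * (Q - m)) % Q
    set SM := ∑ i ∈ Finset.range n, (p ^ i * m) % Q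
    have e : 2 * (p - 1) * (SA + SM) ≤ 2 * (p - 1) * (n * Q) := Nat.mul_le_mul_left _ h3
    have e2 : (2 * (as.length + bs.length)) * Q < (n * (p - 1)) * Q := by nlinarith
    exact Nat.lt_of_mul_lt_mul_right e2
  have h5 := moment_F p n k hp2 hn hF hpl as bs h4
  have h6 : ∀ x : F, (as.map (fun a => x ^ p ^ a)).prod * (bs.map (fun b => (x ^ k) ^ p ^ b)).prod = x ^ (Q - m + k * j) := by
    intro x
    rw [list_prod_pow, list_prod_pow, h1, ← pow_mul, ← pow_add]
  rw [Finset.sum_congr rfl (fun x _ => h6 x), sum_pow_F, hF, if_pos] at h5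
  · exact absurd h5 (by simp)
  · refine ⟨by omega, ?_⟩
    rw [mul_comm k j]
    have := Nat.div_add_mod (j * k) Q
    rw [← hm] at this
    rw [← this]
    refine ⟨(j * k) / Q + 1, ?_⟩
    rw [mul_add, mul_one, ← hQ]; omega

end moment
end PM

namespace PM

section basic
variable {F : Type*} [Field F] [Fintype F]

theorem Planar.k_pos {k : ℕ} (h : Planar F k) : 0 < k := by
  rcases Nat.eq_zero_or_pos k with rfl | h0
  · have := (h 1 one_ne_zero).1 (a₁ := 0) (a₂ := 1) (by simp)
    exact absurd this zero_ne_one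
  · exact h0

theorem gcd_two {k : ℕ} (h : Planar F k) : Nat.gcd k (Fintype.card F - 1) = 2 := by
  classical
  have hk := h.k_pos
  have h1 := h 1 one_ne_zero
  obtain ⟨ζ, hζ⟩ := IsCyclic.exists_generator (α := Fˣ)
  have ho : orderOf ζ = Fintype.card F - 1 := by
    rw [orderOf_eq_card_of_forall_mem_zpowers hζ, Nat.card_eq_fintype_card, Fintype.card_units]
  have hQ : 0 < Fintype.card F - 1 := by
    have := Fintype.one_lt_card (α := F); omega
  set Q := Fintype.card F - 1 with hQd
  set g := Nat.gcd k Q with hg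
  have hgpos : 0 < g := Nat.gcd_pos_of_pos_right _ hQ
  have hne1 : g ≠ 1 := by
    intro hg1
    obtain ⟨x, hx⟩ := h1.2 0
    simp only at hx
    rw [sub_eq_zero] at hx
    have hx0 : x ≠ 0 := by
      rintro rfl
      rw [zero_add, one_pow, zero_pow hk.ne'] at hx
      exact one_ne_zero hx
    have hx1 : x + 1 ≠ 0 := by
      intro h0
      rw [h0, zero_pow hk.ne'] at hx
      exact hx0 (pow_eq_zero_iff hk.ne' |>.1 hx.symm)
    have e1 : ((x + 1) / x) ^ k = 1 := by rw [div_pow, hx, div_self (pow_ne_zero _ hx0)]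
    have e2 : ((x + 1) / x) ^ Q = 1 := FiniteField.pow_card_sub_one_eq_one _ (div_ne_zero hx1 hx0)
    have e3 : orderOf ((x + 1) / x) ∣ Nat.gcd k Q := Nat.dvd_gcd (orderOf_dvd_of_pow_eq_one e1) (orderOf_dvd_of_pow_eq_one e2)
    rw [← hg, hg1, Nat.dvd_one, orderOf_eq_one_iff, div_eq_one_iff_eq hx0] at e3
    exact one_ne_zero (by linear_combination e3 : (1 : F) = 0)
  by_contra hne2
  have hg3 : 3 ≤ g := by omega
  have hgQ : g ∣ Q := Nat.gcd_dvd_right _ _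
  have hgk : g ∣ k := Nat.gcd_dvd_left _ _
  set η := ζ ^ (Q / g) with hη
  have hoη : orderOf η = g := by
    rw [hη, orderOf_pow_of_dvd (Nat.div_pos (Nat.le_of_dvd hQ hgQ) hgpos).ne' (by rw [ho]; exact Nat.div_dvd_of_dvd hgQ), ho,
      Nat.div_div_self hgQ hQ.ne']
  have hk1 : (η : F) ^ k = 1 := by
    have : η ^ k = 1 := orderOf_dvd_iff_pow_eq_one.1 (by rw [hoη]; exact hgk)
    rw [← Units.val_pow_eq_pow_val, this, Units.val_one]
  have n1 : (η : F) ≠ 1 := by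
    intro h0
    have : η = 1 := Units.ext h0
    rw [this, orderOf_one] at hoη; omega
  have n2 : (η : F) ^ 2 ≠ 1 := by
    intro h0
    have : η ^ 2 = 1 := Units.ext (by simpa using h0)
    have := orderOf_dvd_of_pow_eq_one this
    rw [hoη] at this
    have := Nat.le_of_dvd (by omega) this; omega
  have key : ∀ u : F, u ≠ 1 → u ^ k = 1 → (1 / (u - 1) + 1) ^ k - (1 / (u - 1)) ^ k = 0 := by
    intro u hu huk
    have hu' : u - 1 ≠ 0 := sub_ne_zero.2 hu
    have : 1 / (u - 1) + 1 = u * (1 / (u - 1)) := by field_simp; ring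
    rw [this, mul_pow, huk, one_mul, sub_self]
  have e1 := key η n1 hk1
  have e2 := key ((η : F) ^ 2) n2 (by rw [← pow_mul, mul_comm, pow_mul, hk1, one_pow])
  have e3 := h1.1 (e1.trans e2.symm)
  have hu1 : (η : F) - 1 ≠ 0 := sub_ne_zero.2 n1
  have hu2 : (η : F) ^ 2 - 1 ≠ 0 := sub_ne_zero.2 n2
  rw [div_eq_div_iff hu1 hu2] at e3
  have e4 : (η : F) * (η - 1) = 0 := by linear_combination e3
  rcases mul_eq_zero.1 e4 with h | h
  · exact η.ne_zero h
  · exact hu1 h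

theorem pow_congr {k l : ℕ} (hk : 0 < k) (hl : 0 < l) (h : k ≡ l [MOD Fintype.card F - 1]) (x : F) : x ^ k = x ^ l := by
  by_cases hx : x = 0
  · rw [hx, zero_pow hk.ne', zero_pow hl.ne']
  · exact pow_eq_pow_of_modEq h (FiniteField.pow_card_sub_one_eq_one x hx)

theorem Planar.congr {k l : ℕ} (hl : 0 < l) (h : k ≡ l [MOD Fintype.card F - 1]) (hpl : Planar F k) : Planar F l := by
  have hk := hpl.k_pos
  intro a ha
  have := hpl a ha
  simp only [pow_congr hk hl h] at this
  exact this

theorem Planar.frob {p k : ℕ} [Fact p.Prime] [CharP F p] (hpl : Planar F k) (a : ℕ) : Planar F (p ^ a * k) := by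
  intro b hb
  have h1 := hpl b hb
  have h2 : (fun x : F => (x + b) ^ (p ^ a * k) - x ^ (p ^ a * k)) = (fun y => y ^ p ^ a) ∘ (fun x : F => (x + b) ^ k - x ^ k) := by
    funext x
    simp only [Function.comp]
    rw [mul_comm, pow_mul, pow_mul, sub_pow_char_pow]
  rw [h2]
  refine Function.Bijective.comp ?_ h1
  rw [← Finite.injective_iff_bijective]
  intro x y hxy
  have : iterateFrobenius F p a x = iterateFrobenius F p a y := by simpa [iterateFrobenius_def] using hxy
  exact iterateFrobenius_inj F p a this

theorem Planar.sub {E : Type*} [Field E] [Fintype E] (φ : E →+* F) {k : ℕ} (hpl : Planar F k) : Planar E k := by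
  intro a ha
  rw [← Finite.injective_iff_bijective]
  intro x y hxy
  have h1 := (hpl (φ a) ((map_ne_zero φ).2 ha)).1
  apply φ.injective
  apply h1
  have := congrArg φ hxy
  simpa using this

theorem half_ne (h3 : (3 : F) ≠ 0) (h2 : (2 : F) ≠ 0) {k : ℕ} (hpl : Planar F k) : ¬ (2 * k ≡ 2 [MOD Fintype.card F - 1]) := by
  intro h
  have hk := hpl.k_pos
  have h1 := (hpl 1 one_ne_zero).1 (a₁ := 0) (a₂ := (3 / 4) ^ 2)
  have e : ∀ y : F, (y ^ 2) ^ k = y ^ 2 := by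
    intro y; rw [← pow_mul]; exact pow_congr (by omega) (by omega) h y
  have h4 : (4 : F) ≠ 0 := by
    have : (4 : F) = 2 * 2 := by norm_num
    rw [this]; exact mul_ne_zero h2 h2
  have h5 : ((3 / 4 : F) ^ 2 + 1) = (5 / 4) ^ 2 := by field_simp; norm_num
  have h6 := h1 (by
    simp only
    rw [h5, e, e, zero_add, one_pow, zero_pow hk.ne']
    field_simp; norm_num)
  have := pow_eq_zero_iff (two_ne_zero) |>.1 h6.symm
  exact div_ne_zero h3 h4 this

end basic

/-! Hermite criterion -/

def red (Q A : ℕ) : ℕ := if A = 0 then 0 else (A - 1) % Q + 1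

def luc (p : ℕ) : ℕ → ℕ → ℕ → ℕ
  | 0, _, _ => 1
  | n + 1, a, b => Nat.choose (a % p) (b % p) * luc p n (a / p) (b / p)

def leaf (p n A B : ℕ) : ℕ :=
  (p - 1) * (luc p n (red (p ^ n - 1) A) (p ^ n - 1 - red (p ^ n - 1) B) +
    (if red (p ^ n - 1) A = p ^ n - 1 ∧ red (p ^ n - 1) B = p ^ n - 1 then 1 else 0))

def HT (p n k : ℕ) : List ℕ → ℕ → ℕ → ℕ
  | [], A, B => leaf p n A B
  | b :: bs, A, B => HT p n k bs (A + k * p ^ b) B + (p - 1) * HT p n k bs A (B + k * p ^ b)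

theorem luc_spec (p : ℕ) [Fact p.Prime] : ∀ n a b, a < p ^ n → b < p ^ n → Nat.choose a b ≡ luc p n a b [MOD p] := by
  intro n
  induction n with
  | zero =>
    intro a b ha hb
    have h1 : a = 0 := by simpa using ha
    have h2 : b = 0 := by simpa using hb
    subst h1 h2
    exact rfl
  | succ n ih =>
    intro a b ha hb
    have hp : 0 < p := (Fact.out : p.Prime).pos
    refine (Choose.choose_modEq_choose_mod_mul_choose_div_nat (p := p) (n := a) (k := b)).trans ?_
    exact Nat.ModEq.mul_left _ (ih _ _ (Nat.div_lt_of_lt_mul (by rwa [pow_succ'] at ha)) (Nat.div_lt_of_lt_mul (by rwa [pow_succ'] at hb)))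

section herm
variable {F : Type*} [Field F] [Fintype F]

theorem pow_red (A : ℕ) (x : F) : x ^ red (Fintype.card F - 1) A = x ^ A := by
  by_cases h : A = 0
  · simp [red, h]
  · rw [red, if_neg h]
    apply pow_congr (by omega) (by omega)
    have : (A - 1) % (Fintype.card F - 1) + 1 ≡ (A - 1) + 1 [MOD Fintype.card F - 1] := Nat.ModEq.add_right _ (Nat.mod_modEq _ _)
    rwa [Nat.sub_add_cancel (by omega)] at this

theorem red_le (Q A : ℕ) (hQ : 0 < Q) : red Q A ≤ Q := by
  unfold red; split_ifs
  · omega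
  · have := Nat.mod_lt (A - 1) hQ; omega

theorem leaf_spec (p n : ℕ) [Fact p.Prime] (hn : n ≠ 0) (hF : Fintype.card F = p ^ n) (A B : ℕ) :
    ((leaf p n A B : ℕ) : F) = ∑ x : F, (x + 1) ^ A * x ^ B := by
  classical
  haveI := charP_of_card hn hF
  have hp : 2 ≤ p := (Fact.out : p.Prime).two_le
  have hQ : 0 < p ^ n - 1 := by have := Nat.one_lt_pow hn hp; omega
  have ha := red_le _ A hQ
  have hb := red_le _ B hQ
  have hr : ∀ x : F, (x + 1) ^ A * x ^ B = (x + 1) ^ red (p ^ n - 1) A * x ^ red (p ^ n - 1) B := by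
    intro x; rw [← hF, pow_red, pow_red]
  rw [Finset.sum_congr rfl (fun x _ => hr x), leaf]
  generalize red (p ^ n - 1) A = a at *
  generalize red (p ^ n - 1) B = b at *
  have h1 : ∀ x : F, (x + 1) ^ a * x ^ b = ∑ i ∈ Finset.range (a + 1), (Nat.choose a i : F) * x ^ (i + b) := by
    intro x
    rw [add_pow, Finset.sum_mul]
    apply Finset.sum_congr rfl
    intro i _
    rw [one_pow, pow_add]; ring
  rw [Finset.sum_congr rfl (fun x _ => h1 x), Finset.sum_comm]
  simp only [← Finset.mul_sum, sum_pow_F, hF]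
  have hlu := luc_spec p n a (p ^ n - 1 - b) (by omega) (by omega)
  have hlu' : ((luc p n a (p ^ n - 1 - b) : ℕ) : F) = (Nat.choose a (p ^ n - 1 - b) : F) :=
    ((CharP.natCast_eq_natCast F p).2 hlu).symm
  have hp1 : ((p - 1 : ℕ) : F) = -1 := by
    rw [Nat.cast_sub (by omega), CharP.cast_eq_zero]; simp
  rw [Nat.cast_mul, Nat.cast_add, hlu', hp1]
  set Q := p ^ n - 1
  have h2 : ∀ i ∈ Finset.range (a + 1), (Nat.choose a i : F) * (if i + b ≠ 0 ∧ Q ∣ i + b then -1 else 0) =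
      (if i = Q - b then -(Nat.choose a i : F) else 0) + (if i = Q then (if a = Q ∧ b = Q then -1 else 0) else 0) := by
    intro i hi
    have hia : i ≤ a := by simpa [Nat.lt_succ_iff] using hi
    by_cases h0 : i + b ≠ 0 ∧ Q ∣ i + b
    · rw [if_pos h0]
      obtain ⟨h00, c, hc⟩ := h0
      have hc2 : c = 1 ∨ c = 2 := by
        have : c ≠ 0 := by rintro rfl; simp at hc; omega
        have : c ≤ 2 := by
          by_contra h
          have : Q * 3 ≤ Q * c := Nat.mul_le_mul_left _ (by omega)
          omega
        omega
      rcases hc2 with rfl | rfl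
      · have e1 : i = Q - b := by omega
        rw [if_pos e1]
        have : ¬ (i = Q ∧ (a = Q ∧ b = Q)) := by omega
        by_cases h3 : i = Q
        · rw [if_pos h3, if_neg (by tauto)]; ring
        · rw [if_neg h3]; ring
      · have e1 : i = Q := by omega
        have e2 : a = Q := by omega
        have e3 : b = Q := by omega
        have h3 : ¬ i = Q - b := by omega
        have h4 : a = Q ∧ b = Q := ⟨e2, e3⟩
        rw [if_neg h3, if_pos e1, if_pos h4, e1, e2, Nat.choose_self]; simp
    · rw [if_neg h0, mul_zero]
      have e1 : i ≠ Q - b := by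
        rintro rfl
        exact h0 ⟨by omega, ⟨1, by omega⟩⟩
      rw [if_neg e1]
      by_cases h3 : i = Q
      · rw [if_pos h3, if_neg]
        · simp
        · rintro ⟨h4, h5⟩
          exact h0 ⟨by omega, ⟨2, by omega⟩⟩
      · rw [if_neg h3]; simp
  rw [Finset.sum_congr rfl h2, Finset.sum_add_distrib, Finset.sum_ite_eq', Finset.sum_ite_eq']
  have e1 : (if Q - b ∈ Finset.range (a + 1) then -(Nat.choose a (Q - b) : F) else 0) = -(Nat.choose a (Q - b) : F) := by
    split_ifs with h
    · rfl
    · rw [Nat.choose_eq_zero_of_lt (by simp only [Finset.mem_range] at h; omega)]; simp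
  have e2 : (if Q ∈ Finset.range (a + 1) then (if a = Q ∧ b = Q then (-1 : F) else 0) else 0) = if a = Q ∧ b = Q then -1 else 0 := by
    by_cases h : a = Q ∧ b = Q
    · rw [if_pos h, if_pos (by simp; omega)]
    · rw [if_neg h]; simp
  rw [e1, e2]
  split_ifs <;> push_cast <;> ring

theorem HT_spec (p n k : ℕ) [Fact p.Prime] (hn : n ≠ 0) (hF : Fintype.card F = p ^ n) (bs : List ℕ) : ∀ A B : ℕ,
    ((HT p n k bs A B : ℕ) : F) = ∑ x : F, (bs.map (fun b => ((x + 1) ^ k - x ^ k) ^ p ^ b)).prod * ((x + 1) ^ A * x ^ B) := by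
  haveI := charP_of_card hn hF
  have hp : 2 ≤ p := (Fact.out : p.Prime).two_le
  have hp1 : ((p - 1 : ℕ) : F) = -1 := by
    rw [Nat.cast_sub (by omega), CharP.cast_eq_zero]; simp
  induction bs with
  | nil => intro A B; simp [HT, leaf_spec p n hn hF]
  | cons b bs ih =>
    intro A B
    rw [HT, Nat.cast_add, Nat.cast_mul, ih, ih, hp1, Finset.mul_sum, ← Finset.sum_add_distrib]
    apply Finset.sum_congr rfl
    intro x _
    rw [List.map_cons, List.prod_cons, sub_pow_char_pow, pow_add, pow_add, pow_mul, pow_mul]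
    ring

theorem H_zero (p n k : ℕ) [Fact p.Prime] (hn : n ≠ 0) (hF : Fintype.card F = p ^ n) (hpl : Planar F k) (bs : List ℕ)
    (h0 : bs ≠ []) (h1 : (bs.map (fun b => p ^ b)).sum < p ^ n - 1) : p ∣ HT p n k bs 0 0 := by
  classical
  haveI := charP_of_card hn hF
  rw [← CharP.cast_eq_zero_iff F p, HT_spec p n k hn hF]
  simp only [pow_zero, mul_one]
  have h2 : ∀ x : F, (bs.map (fun b => ((x + 1) ^ k - x ^ k) ^ p ^ b)).prod = ((x + 1) ^ k - x ^ k) ^ (bs.map (fun b => p ^ b)).sum := by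
    intro x; rw [list_prod_pow]
  rw [Finset.sum_congr rfl (fun x _ => h2 x)]
  rw [Function.Bijective.sum_comp (hpl 1 one_ne_zero) (fun y => y ^ (bs.map (fun b => p ^ b)).sum)]
  rw [sum_pow_F, hF, if_neg]
  rintro ⟨h3, h4⟩
  have := Nat.le_of_dvd (by omega) h4
  omega

end herm

theorem Planar.descend {F : Type*} [Field F] [Fintype F] {p n k : ℕ} [Fact p.Prime] (hn : n ≠ 0)
    (hF : Fintype.card F = p ^ n) (hpl : Planar F k) {d : ℕ} (hd : d ∣ n) (hd0 : d ≠ 0) :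
    ∃ (E : Type) (_ : Field E) (_ : Fintype E), Fintype.card E = p ^ d ∧ Planar E k := by
  haveI := charP_of_card hn hF
  letI : Algebra (ZMod p) F := ZMod.algebra F p
  have hE : Nat.card (GaloisField p d) = p ^ d := GaloisField.card p d hd0
  letI : Fintype (GaloisField p d) := Fintype.ofFinite _
  refine ⟨GaloisField p d, inferInstance, inferInstance, by rw [← Nat.card_eq_fintype_card, hE], ?_⟩
  have hfr : Module.finrank (ZMod p) F = n := by
    have h1 := Module.card_eq_pow_finrank (K := ZMod p) (V := F)
    rw [hF, ZMod.card] at h1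
    exact (Nat.pow_right_injective (Fact.out : p.Prime).two_le h1).symm
  obtain ⟨φ⟩ := FiniteField.nonempty_algHom_of_finrank_dvd (F := ZMod p) (K := GaloisField p d) (L := F)
    (by rw [hfr, GaloisField.finrank p hd0]; exact hd)
  exact Planar.sub φ.toRingHom hpl

/-- The numerical consequences of planarity that are used. -/
structure Good (p n k : ℕ) : Prop where
  pos : 0 < k
  gcd : Nat.gcd k (p ^ n - 1) = 2
  J : ∀ bs : List ℕ, 2 * (p - 1) * ∑ i ∈ Finset.range n, (p ^ i * ((bs.map (fun b => p ^ b)).sum * k)) % (p ^ n - 1)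
      ≤ (2 * bs.length + n * (p - 1)) * (p ^ n - 1)
  H : ∀ e : ℕ, e ∣ n → e ≠ 0 → ∀ bs : List ℕ, bs ≠ [] → (bs.map (fun b => p ^ b)).sum < p ^ e - 1 → p ∣ HT p e k bs 0 0

theorem Planar.good {F : Type*} [Field F] [Fintype F] {p n k : ℕ} [Fact p.Prime] (hp2 : p ≠ 2) (hn : n ≠ 0)
    (hF : Fintype.card F = p ^ n) (hpl : Planar F k) : Good p n k where
  pos := hpl.k_pos
  gcd := by rw [← hF]; exact gcd_two hpl
  J := J_bound p n k hp2 hn hF hpl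
  H := fun e he he0 bs h0 h1 => by
    obtain ⟨E, _, _, hE, hplE⟩ := hpl.descend hn hF he he0
    exact H_zero p e k he0 hE hplE bs h0 h1

end PM

namespace PM

/-- the conclusion -/
def Known (p n k : ℕ) : Prop :=
  ∃ a < n,
      (∃ i < n, Odd (n / Nat.gcd i n) ∧ k ≡ p ^ a * (p ^ i + 1) [MOD p ^ n - 1]) ∨
        (p = 3 ∧ ∃ i < n, Nat.gcd i (2 * n) = 1 ∧
          k ≡ 3 ^ a * ((3 ^ i + 1) / 2) [MOD 3 ^ n - 1])

theorem pow_period (p n x : ℕ) (hp : 0 < p) : p ^ x ≡ p ^ (x % n) [MOD p ^ n - 1] := by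
  have h : p ^ n ≡ 1 [MOD p ^ n - 1] := by
    have : 1 ≤ p ^ n := Nat.one_le_pow _ _ hp
    exact (Nat.modEq_iff_dvd' this).2 (dvd_refl _) |>.symm
  conv_lhs => rw [← Nat.div_add_mod x n, pow_add, pow_mul]
  simpa using Nat.ModEq.mul_right (p ^ (x % n)) (h.pow (x / n))

theorem Known.congr {p n k l : ℕ} (h : k ≡ l [MOD p ^ n - 1]) (hk : Known p n l) : Known p n k := by
  obtain ⟨a, ha, h1⟩ := hk
  refine ⟨a, ha, ?_⟩
  rcases h1 with ⟨i, hi, ho, hc⟩ | ⟨rfl, i, hi, hg, hc⟩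
  · exact Or.inl ⟨i, hi, ho, h.trans hc⟩
  · exact Or.inr ⟨rfl, i, hi, hg, h.trans hc⟩

theorem Known.unrot {p n k b : ℕ} (hp : 0 < p) (hk : Known p n (p ^ b * k)) : Known p n k := by
  obtain ⟨a, ha, h1⟩ := hk
  have hn : 0 < n := by omega
  have hb : b % n < n := Nat.mod_lt _ hn
  have key : ∀ c, p ^ b * k ≡ p ^ a * c [MOD p ^ n - 1] → k ≡ p ^ ((n - b % n + a) % n) * c [MOD p ^ n - 1] := by
    intro c hc
    have h2 : p ^ (n - b % n) * (p ^ b * k) ≡ k [MOD p ^ n - 1] := by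
      have h3 := (pow_period p n (n - b % n + b) hp)
      have h4 : (n - b % n + b) % n = 0 := by
        have e := Nat.div_add_mod b n
        have : n - b % n + b = n * (b / n + 1) := by rw [mul_add]; omega
        rw [this, Nat.mul_mod_right]
      rw [h4] at h3
      rw [← mul_assoc, ← pow_add]
      simpa using h3.mul_right k
    refine h2.symm.trans ?_
    refine (hc.mul_left _).trans ?_
    rw [← mul_assoc, ← pow_add]
    exact (pow_period p n _ hp).mul_right c
  refine ⟨(n - b % n + a) % n, Nat.mod_lt _ hn, ?_⟩
  rcases h1 with ⟨i, hi, ho, hc⟩ | ⟨rfl, i, hi, hg, hc⟩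
  · exact Or.inl ⟨i, hi, ho, key _ hc⟩
  · exact Or.inr ⟨rfl, i, hi, hg, key _ hc⟩

theorem n1_arith (p k : ℕ) (hp : 5 ≤ p) (hodd : Odd p) (hg : Good p 1 k) (hh : ¬ (2 * k ≡ 2 [MOD p - 1])) :
    k % (p - 1) = 2 := by
  obtain ⟨h, hh2⟩ : ∃ h, p - 1 = 2 * h := by
    obtain ⟨m, rfl⟩ := hodd; exact ⟨m, by omega⟩
  have hJ : ∀ l, 2 * ((l * k) % (2 * h)) ≤ 2 * l + 2 * h := by
    intro l
    have h1 := hg.J (List.replicate l 0)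
    simp only [Finset.sum_range_one, pow_zero, one_mul, pow_one, List.map_replicate, List.sum_replicate, smul_eq_mul, mul_one,
      List.length_replicate] at h1
    rw [hh2] at h1
    have h2 : (2 * ((l * k) % (2 * h))) * (2 * h) ≤ (2 * l + 2 * h) * (2 * h) := by linarith
    exact Nat.le_of_mul_le_mul_right h2 (by omega)
  have hgc := hg.gcd
  rw [pow_one, hh2] at hgc
  rw [hh2] at hh ⊢
  have hgr : Nat.gcd (k % (2 * h)) (2 * h) = 2 := by
    exact (Nat.ModEq.gcd_eq (Nat.mod_modEq k (2 * h))).trans hgc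
  have hJr : ∀ l, 2 * ((l * (k % (2 * h))) % (2 * h)) ≤ 2 * l + 2 * h := by
    intro l; rw [Nat.mul_mod_mod]; exact hJ l
  have hrlt : k % (2 * h) < 2 * h := Nat.mod_lt _ (by omega)
  have hhr : ¬ (2 * (k % (2 * h)) ≡ 2 [MOD 2 * h]) := by
    intro h1; apply hh
    exact ((Nat.mod_modEq k (2 * h)).symm.mul_left 2).trans h1
  generalize k % (2 * h) = r at *
  have hreven : 2 ∣ r := by rw [← hgr]; exact Nat.gcd_dvd_left _ _
  obtain ⟨t, rfl⟩ := hreven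
  have h2 : 2 ≤ h := by omega
  have ht0 : t ≠ 0 := by
    rintro rfl
    simp at hgr
    subst hgr
    exact hhr (by simp [Nat.ModEq])
  by_contra hne
  have j1 := hJr 1
  rw [one_mul, Nat.mod_eq_of_lt hrlt] at j1
  have n1 : 2 * t ≠ h + 1 := by
    intro h0
    apply hhr
    rw [h0]
    have : 2 * (h + 1) = 2 + 2 * h := by ring
    rw [this]; simp [Nat.ModEq]
  have n2 : 2 * t ≠ h := by
    intro h0
    rw [h0, Nat.gcd_eq_left (Dvd.intro_left 2 rfl)] at hgr
    omega
  have ht : 2 * t < h := by omega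
  have ht2 : 2 ≤ t := by omega
  obtain ⟨a, ha⟩ : ∃ a, 2 * t = a + 1 := ⟨2 * t - 1, by omega⟩
  have ha3 : 3 ≤ a := by omega
  by_cases hA : h < 2 * a
  · have j2 := hJr 2
    rw [Nat.mod_eq_of_lt (by omega)] at j2
    omega
  · set j := h / a + 1 with hj
    have e1 : h < j * a := by
      rw [hj]; have := Nat.lt_mul_div_succ h (by omega : 0 < a); rw [mul_comm]; exact this
    have e2 : a * (h / a) ≤ h := Nat.mul_div_le h a
    have e3 : j * a = a * (h / a) + a := by rw [hj]; ring
    by_cases h6 : h ≤ 6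
    · have : h = 6 := by omega
      have : t = 2 := by omega
      subst this
      subst h
      simp at hgr
    · have e4 : j + a < h := by
        -- h/a + 1 + a < h  for 3 ≤ a ≤ h/2, h ≥ 7
        have hb : 2 ≤ h / a := by rw [Nat.le_div_iff_mul_le (by omega)]; omega
        generalize h / a = b at *
        by_contra hc
        have : (a - 1) * (b - 1) ≤ 3 := by
          obtain ⟨a', rfl⟩ : ∃ a', a = a' + 1 := ⟨a - 1, by omega⟩
          obtain ⟨b', rfl⟩ : ∃ b', b = b' + 1 := ⟨b - 1, by omega⟩
          simp only [Nat.add_sub_cancel]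
          nlinarith
        have ha5 : a ≤ 4 := by
          by_contra h7
          have : 4 * 1 ≤ (a - 1) * (b - 1) := Nat.mul_le_mul (by omega) (by omega)
          omega
        have hb5 : b ≤ 3 := by
          by_contra h7
          have : 2 * 3 ≤ (a - 1) * (b - 1) := Nat.mul_le_mul (by omega) (by omega)
          omega
        interval_cases a <;> interval_cases b <;> omega
      have j3 := hJr j
      rw [ha] at j3
      have e5 : j * (a + 1) = j * a + j := by ring
      rw [Nat.mod_eq_of_lt (by omega)] at j3
      omega

theorem n1_case {F : Type*} [Field F] [Fintype F] {p k : ℕ} [Fact p.Prime] (hp2 : p ≠ 2)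
    (hF : Fintype.card F = p ^ 1) (hpl : Planar F k) : k ≡ 2 [MOD p - 1] := by
  have hg := hpl.good hp2 one_ne_zero hF
  have hp : p.Prime := Fact.out
  have hodd : Odd p := hp.odd_of_ne_two hp2
  by_cases h3 : p = 3
  · subst h3
    have := hg.gcd
    have h2 : 2 ∣ k := by
      have h4 : 2 ∣ Nat.gcd k (3 ^ 1 - 1) := by rw [this]
      exact h4.trans (Nat.gcd_dvd_left _ _)
    show k % 2 = 2 % 2
    omega
  · have h5 : 5 ≤ p := by
      have := hp.two_le
      obtain ⟨m, rfl⟩ := hodd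
      omega
    haveI := charP_of_card one_ne_zero hF
    have := n1_arith p k h5 hodd hg (by
      have := half_ne (F := F) (k := k) ?_ ?_ hpl
      · rwa [hF, pow_one] at this
      · intro h
        have : ((3 : ℕ) : F) = 0 := by exact_mod_cast h
        rw [CharP.cast_eq_zero_iff F p] at this
        have := Nat.le_of_dvd (by omega) this; omega
      · intro h
        have : ((2 : ℕ) : F) = 0 := by exact_mod_cast h
        rw [CharP.cast_eq_zero_iff F p] at this
        have := Nat.le_of_dvd (by omega) this; omega)
    show k % (p - 1) = 2 % (p - 1)
    rw [this, Nat.mod_eq_of_lt (by omega)]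

theorem Known.one {p k : ℕ} (h : k ≡ 2 [MOD p - 1]) : Known p 1 k :=
  ⟨0, by omega, Or.inl ⟨0, by omega, by simp, by simpa using h⟩⟩

theorem n2_arith (p k : ℕ) (hp : 5 ≤ p) (hg : Good p 2 k) (hkQ : k < p ^ 2 - 1) (h2 : k ≡ 2 [MOD p - 1]) : Known p 2 k := by
  have hJ := hg.J [0]
  have hgc := hg.gcd
  simp only [Finset.sum_range_succ, Finset.sum_range_zero, zero_add, pow_zero, one_mul, List.map_cons, List.map_nil, List.sum_cons,
    List.sum_nil, add_zero, List.length_cons, List.length_nil, mul_one, pow_one] at hJ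
  have hd := Nat.div_add_mod k p
  have hbl : k % p < p := Nat.mod_lt _ (by omega)
  obtain ⟨r, rfl⟩ : ∃ r, p = r + 1 := ⟨p - 1, by omega⟩
  have hQ : (r + 1) ^ 2 - 1 = r * (r + 2) := by
    have : (r + 1) ^ 2 = r * (r + 2) + 1 := by ring
    omega
  rw [hQ] at hgc hkQ hJ
  have hal : k / (r + 1) < r + 1 := Nat.div_lt_of_lt_mul (by nlinarith)
  generalize k / (r + 1) = b at *
  generalize k % (r + 1) = a at *
  subst hd
  have hrot : ((r + 1) * ((r + 1) * b + a)) % (r * (r + 2)) = (r + 1) * a + b := by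
    have e : (r + 1) * ((r + 1) * b + a) = (r + 1) * a + b + (r * (r + 2)) * b := by ring
    rw [e, Nat.add_mul_mod_self_left, Nat.mod_eq_of_lt]
    by_contra hcon
    have hb' : b ≤ r := by omega
    have ha' : a ≤ r := by omega
    have : a = r := by
      by_contra h
      have : a + 1 ≤ r := by omega
      nlinarith
    subst this
    have : b = a := by
      by_contra h
      nlinarith [Nat.lt_of_le_of_ne hb' h]
    subst this
    nlinarith
  rw [Nat.mod_eq_of_lt hkQ, hrot] at hJ
  simp only [Nat.add_sub_cancel] at *
  have hab : a + b ≤ r + 1 := by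
    have e : (a + b) * (2 * r * (r + 2)) ≤ (r + 1) * (2 * r * (r + 2)) := by nlinarith
    exact Nat.le_of_mul_le_mul_right e (Nat.mul_pos (by omega) (by omega))
  have h2' : a + b ≡ 2 [MOD r] := by
    have : (r + 1) * b + a = a + b + r * b := by ring
    rw [this] at h2
    have h3 : a + b + r * b ≡ a + b [MOD r] := by simp [Nat.ModEq]
    exact h3.symm.trans h2
  have hab2 : a + b = 2 := by
    have h3 : (a + b) % r = 2 := by rw [h2', Nat.mod_eq_of_lt (by omega)]
    by_cases h4 : a + b < r
    · rwa [Nat.mod_eq_of_lt h4] at h3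
    · rw [Nat.mod_eq_sub_mod (by omega), Nat.mod_eq_of_lt (by omega)] at h3
      omega
  have hk : ∀ c < 2, (r + 1) * b + a = (r + 1) ^ c * 2 → Known (r + 1) 2 ((r + 1) * b + a) := by
    intro c hc h
    refine ⟨c, hc, Or.inl ⟨0, by omega, by decide, ?_⟩⟩
    rw [h]; exact Nat.ModEq.refl _
  have hb2 : b ≤ 2 := by omega
  interval_cases b
  · exact hk 0 (by omega) (by simp; omega)
  · have : a = 1 := by omega
    subst this
    have e : r * (r + 2) = ((r + 1) * 1 + 1) * r := by ring
    rw [e, Nat.gcd_mul_right_right] at hgc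
    omega
  · exact hk 1 (by omega) (by simp; omega)

/-- Interface of the computation. -/
def Eng (p n d : ℕ) (filt : Bool) (c : ℕ) : Prop :=
  ∀ k, k < p ^ n - 1 → Good p n k → k % (p ^ d - 1) = c →
    (filt = true → ∀ i < n, k ≤ (p ^ i * k) % (p ^ n - 1)) → Known p n k

theorem planar_rot {F : Type*} [Field F] [Fintype F] {p n k : ℕ} [Fact p.Prime] (hn : n ≠ 0) (hQ2 : 2 < p ^ n - 1)
    (hF : Fintype.card F = p ^ n) (hpl : Planar F k) (b : ℕ) : Planar F ((p ^ b * k) % (p ^ n - 1)) := by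
  haveI := charP_of_card hn hF
  have h1 := hpl.frob (p := p) b
  have h2 : p ^ b * k ≡ (p ^ b * k) % (p ^ n - 1) [MOD Fintype.card F - 1] := by rw [hF]; exact (Nat.mod_modEq _ _).symm
  refine h1.congr (Nat.pos_of_ne_zero ?_) h2
  intro h0
  have h3 := gcd_two h1
  rw [hF, Nat.gcd_eq_right (Nat.dvd_of_mod_eq_zero h0)] at h3
  omega

theorem dvd_pow_sub {p d n : ℕ} (h : d ∣ n) : p ^ d - 1 ∣ p ^ n - 1 := by
  obtain ⟨c, rfl⟩ := h
  rw [pow_mul]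
  simpa using Nat.sub_dvd_pow_sub_pow (p ^ d) 1 c

/-- prime `n` -/
theorem step_prime {F : Type*} [Field F] [Fintype F] {p n k : ℕ} [Fact p.Prime] (hp2 : p ≠ 2) (hn : n ≠ 0) (hQ2 : 2 < p ^ n - 1)
    (hF : Fintype.card F = p ^ n) (hpl : Planar F k) (hE : Eng p n 1 true (2 % (p - 1))) : Known p n k := by
  have hp : p.Prime := Fact.out
  have hQ0 : 0 < p ^ n - 1 := by omega
  obtain ⟨E, _, _, hcE, hplE⟩ := hpl.descend hn hF (one_dvd n) one_ne_zero
  have hk2 := n1_case hp2 hcE hplE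
  obtain ⟨b, hb, hmin⟩ := Finset.exists_min_image (Finset.range n) (fun b => (p ^ b * k) % (p ^ n - 1)) ⟨0, by simp; omega⟩
  have hpl' := planar_rot hn hQ2 hF hpl b
  have h1 := hE ((p ^ b * k) % (p ^ n - 1)) (Nat.mod_lt _ hQ0) (hpl'.good hp2 hn hF) ?_ ?_
  · exact (h1.congr (Nat.mod_modEq _ _).symm).unrot hp.pos
  · rw [pow_one, Nat.mod_mod_of_dvd _ (by simpa using dvd_pow_sub (p := p) (one_dvd n))]
    have h2 : p ^ b ≡ 1 [MOD p - 1] := by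
      have : p ≡ 1 [MOD p - 1] := (Nat.modEq_iff_dvd' hp.one_le).2 (dvd_refl _) |>.symm
      simpa using this.pow b
    have := h2.mul hk2
    rw [one_mul] at this
    exact this
  · intro _ i _
    have h3 : (p ^ i * ((p ^ b * k) % (p ^ n - 1))) % (p ^ n - 1) = (p ^ ((i + b) % n) * k) % (p ^ n - 1) := by
      rw [Nat.mul_mod_mod, ← mul_assoc, ← pow_add]
      exact (pow_period p n (i + b) hp.pos).mul_right k
    rw [h3]
    exact hmin _ (by simp; exact Nat.mod_lt _ (by omega))

theorem Known.norm {p d k : ℕ} (hp : 0 < p) (h : Known p d k) : ∃ a < d,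
      (∃ i < d, 2 * i ≤ d ∧ Odd (d / Nat.gcd i d) ∧ k ≡ p ^ a * (p ^ i + 1) [MOD p ^ d - 1]) ∨
        (p = 3 ∧ ∃ i < d, 2 ≤ i ∧ Nat.gcd i (2 * d) = 1 ∧
          k ≡ 3 ^ a * ((3 ^ i + 1) / 2) [MOD 3 ^ d - 1]) := by
  obtain ⟨a, ha, h1⟩ := h
  rcases h1 with ⟨i, hi, ho, hc⟩ | ⟨rfl, i, hi, hg, hc⟩
  · by_cases h2 : 2 * i ≤ d
    · exact ⟨a, ha, Or.inl ⟨i, hi, h2, ho, hc⟩⟩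
    · refine ⟨(a + i) % d, Nat.mod_lt _ (by omega), Or.inl ⟨d - i, by omega, by omega, ?_, hc.trans ?_⟩⟩
      · have : Nat.gcd (d - i) d = Nat.gcd i d := by
          rw [Nat.gcd_comm, Nat.gcd_comm i d]
          have := Nat.gcd_self_sub_right (m := d) (n := i) hi.le
          exact this
        rwa [this]
      · have e1 := (pow_period p d (a + i) hp).symm.mul_right (p ^ (d - i) + 1)
        refine Nat.ModEq.trans ?_ e1.symm
        have e2 : p ^ (a + i) * (p ^ (d - i) + 1) = p ^ d * p ^ a + p ^ a * p ^ i := by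
          rw [mul_add, mul_one, ← pow_add, ← pow_add, ← pow_add]
          congr 2
          omega
        have e3 := (pow_period p d d hp).mul_right (p ^ a)
        rw [Nat.mod_self, pow_zero, one_mul] at e3
        rw [e2, mul_add, mul_one, add_comm]
        exact e3.symm.add_right _
  · by_cases h2 : 2 ≤ i
    · exact ⟨a, ha, Or.inr ⟨rfl, i, hi, h2, hg, hc⟩⟩
    · interval_cases i
      · simp at hg
      · exact ⟨a, ha, Or.inl ⟨0, hi.trans' (by omega), by omega, by simp [Nat.div_self (show 0 < d by omega)], by simpa using hc⟩⟩

/-- composite `n` -/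
theorem step_comp {F : Type*} [Field F] [Fintype F] {p n k : ℕ} [Fact p.Prime] (hp2 : p ≠ 2) (hn : n ≠ 0) (hQ2 : 2 < p ^ n - 1)
    (hF : Fintype.card F = p ^ n) (hpl : Planar F k) (d : ℕ) (hd : d ∣ n)
    (ih : Known p d k)
    (hE : ∀ i < d, 2 * i ≤ d → Odd (d / Nat.gcd i d) → Eng p n d false ((p ^ i + 1) % (p ^ d - 1)))
    (hE3 : p = 3 → ∀ i < d, 2 ≤ i → Nat.gcd i (2 * d) = 1 → Eng p n d false (((3 ^ i + 1) / 2) % (3 ^ d - 1))) : Known p n k := by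
  have hp : p.Prime := Fact.out
  have hQ0 : 0 < p ^ n - 1 := by omega
  obtain ⟨a, ha, h1⟩ := ih.norm hp.pos
  have hpl' := planar_rot hn hQ2 hF hpl (d - a)
  have key : ∀ c, k ≡ p ^ a * c [MOD p ^ d - 1] → ((p ^ (d - a) * k) % (p ^ n - 1)) % (p ^ d - 1) = c % (p ^ d - 1) := by
    intro c hc
    rw [Nat.mod_mod_of_dvd _ (dvd_pow_sub hd)]
    have h2 := hc.mul_left (p ^ (d - a))
    rw [← mul_assoc, ← pow_add, Nat.sub_add_cancel ha.le] at h2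
    have h3 := (pow_period p d d hp.pos).mul_right c
    rw [Nat.mod_self, pow_zero, one_mul] at h3
    exact h2.trans h3
  suffices h : Known p n ((p ^ (d - a) * k) % (p ^ n - 1)) from (h.congr (Nat.mod_modEq _ _).symm).unrot hp.pos
  rcases h1 with ⟨i, hi, h2, ho, hc⟩ | ⟨rfl, i, hi, h2, hg, hc⟩
  · exact hE i hi h2 ho _ (Nat.mod_lt _ hQ0) (hpl'.good hp2 hn hF) (key _ hc) (by simp)
  · exact hE3 rfl i hi h2 hg _ (Nat.mod_lt _ hQ0) (hpl'.good hp2 hn hF) (key _ hc) (by simp)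

theorem n2_case {F : Type*} [Field F] [Fintype F] {p k : ℕ} [Fact p.Prime] (hp : 5 ≤ p)
    (hF : Fintype.card F = p ^ 2) (hpl : Planar F k) : Known p 2 k := by
  have hQ2 : 2 < p ^ 2 - 1 := by
    have : 5 * 5 ≤ p * p := Nat.mul_le_mul hp hp
    rw [pow_two]; omega
  obtain ⟨E, _, _, hcE, hplE⟩ := hpl.descend two_ne_zero hF (one_dvd 2) one_ne_zero
  have hk2 := n1_case (by omega) hcE hplE
  have hpl' := planar_rot two_ne_zero hQ2 hF hpl 0
  rw [pow_zero, one_mul] at hpl'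
  refine (n2_arith p _ hp (hpl'.good (by omega) two_ne_zero hF) (Nat.mod_lt _ (by omega)) ?_).congr (Nat.mod_modEq _ _).symm
  have : (k % (p ^ 2 - 1)) ≡ k [MOD p - 1] := (Nat.mod_modEq _ _).of_dvd (by simpa using dvd_pow_sub (p := p) (one_dvd 2))
  exact this.trans hk2

end PM

namespace PM

/-! Packed vectors of naturals -/

def pack (w : ℕ) (f : ℕ → ℕ) (T : ℕ) : ℕ := ∑ t ∈ Finset.range T, f t * 2 ^ (w * t)

theorem pack_succ (w f T) : pack w f (T + 1) = 2 ^ (w * T) * f T + pack w f T := by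
  rw [pack, Finset.sum_range_succ, ← pack]; ring

theorem pack_zero (w f) : pack w f 0 = 0 := rfl

theorem pack_add (w f g T) : pack w f T + pack w g T = pack w (fun t => f t + g t) T := by
  simp only [pack, ← Finset.sum_add_distrib, add_mul]

theorem pack_mul (w f c T) : pack w f T * c = pack w (fun t => f t * c) T := by
  simp only [pack, Finset.sum_mul]; apply Finset.sum_congr rfl; intros; ring

theorem pack_congr {w f g T} (h : ∀ t < T, f t = g t) : pack w f T = pack w g T := by
  apply Finset.sum_congr rfl; intro t ht; rw [h t (Finset.mem_range.1 ht)]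

theorem pack_append (w f g T S) : pack w f T + 2 ^ (w * T) * pack w g S = pack w (fun t => if t < T then f t else g (t - T)) (T + S) := by
  rw [pack, pack, pack, Finset.sum_range_add, Finset.mul_sum]
  congr 1
  · apply Finset.sum_congr rfl; intro t ht; rw [if_pos (Finset.mem_range.1 ht)]
  · apply Finset.sum_congr rfl; intro t _
    rw [if_neg (by omega), Nat.add_sub_cancel_left, mul_add, pow_add]; ring

theorem pack_lt {w f T} (h : ∀ t, f t < 2 ^ w) : pack w f T < 2 ^ (w * T) := by
  induction T with
  | zero => simp [pack]
  | succ T ih =>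
    rw [pack_succ, Nat.mul_succ, pow_add]
    have := h T
    nlinarith [Nat.mul_le_mul_left (2 ^ (w * T)) (Nat.succ_le_of_lt this)]

theorem pack_le_pack {w f g T} (h : ∀ t, f t ≤ g t) : pack w f T ≤ pack w g T :=
  Finset.sum_le_sum (fun t _ => Nat.mul_le_mul_right _ (h t))

theorem pack_sub {w f g T} (h : ∀ t, g t ≤ f t) : pack w f T - pack w g T = pack w (fun t => f t - g t) T := by
  have h1 : pack w (fun t => f t - g t) T + pack w g T = pack w f T := by
    rw [pack_add]; exact pack_congr (fun t _ => Nat.sub_add_cancel (h t))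
  omega

theorem land_split {i a b a' b' : ℕ} (hb : b < 2 ^ i) (hb' : b' < 2 ^ i) :
    (2 ^ i * a + b) &&& (2 ^ i * a' + b') = 2 ^ i * (a &&& a') + (b &&& b') := by
  apply Nat.eq_of_testBit_eq
  intro j
  rw [Nat.testBit_and, Nat.testBit_two_pow_mul_add _ hb, Nat.testBit_two_pow_mul_add _ hb',
    Nat.testBit_two_pow_mul_add _ (lt_of_le_of_lt Nat.and_le_left hb)]
  split_ifs <;> simp [Nat.testBit_and]

theorem lor_split {i a b a' b' : ℕ} (hb : b < 2 ^ i) (hb' : b' < 2 ^ i) :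
    (2 ^ i * a + b) ||| (2 ^ i * a' + b') = 2 ^ i * (a ||| a') + (b ||| b') := by
  apply Nat.eq_of_testBit_eq
  intro j
  rw [Nat.testBit_or, Nat.testBit_two_pow_mul_add _ hb, Nat.testBit_two_pow_mul_add _ hb',
    Nat.testBit_two_pow_mul_add _ (Nat.or_lt_two_pow hb hb')]
  split_ifs <;> simp [Nat.testBit_or]

theorem pack_land {w f g T} (hf : ∀ t, f t < 2 ^ w) (hg : ∀ t, g t < 2 ^ w) :
    pack w f T &&& pack w g T = pack w (fun t => f t &&& g t) T := by
  induction T with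
  | zero => simp [pack]
  | succ T ih => rw [pack_succ, pack_succ, land_split (pack_lt hf) (pack_lt hg), ih, pack_succ]

theorem pack_lor {w f g T} (hf : ∀ t, f t < 2 ^ w) (hg : ∀ t, g t < 2 ^ w) :
    pack w f T ||| pack w g T = pack w (fun t => f t ||| g t) T := by
  induction T with
  | zero => simp [pack]
  | succ T ih => rw [pack_succ, pack_succ, lor_split (pack_lt hf) (pack_lt hg), ih, pack_succ]

/-! Circular approximations -/

def Near (Q r E m x : ℕ) : Prop := ∃ e ≤ E * Q, Q * x ≡ 2 ^ r * m + e [MOD 2 ^ r * Q]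

theorem Near.mono {Q r E E' m x} (h : Near Q r E m x) (hE : E ≤ E') : Near Q r E' m x := by
  obtain ⟨e, he, h1⟩ := h
  exact ⟨e, he.trans (Nat.mul_le_mul_right _ hE), h1⟩

theorem Near.add {Q r E E' m m' x x'} (h : Near Q r E m x) (h' : Near Q r E' m' x') : Near Q r (E + E') (m + m') (x + x') := by
  obtain ⟨e, he, h1⟩ := h
  obtain ⟨e', he', h1'⟩ := h'
  refine ⟨e + e', by rw [add_mul]; omega, ?_⟩
  have := h1.add h1'
  rw [mul_add, mul_add]
  convert this using 1
  ring

theorem Near.mod {Q r E m x} (h : Near Q r E m x) : Near Q r E m (x % 2 ^ r) := by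
  obtain ⟨e, he, h1⟩ := h
  refine ⟨e, he, ?_⟩
  refine Nat.ModEq.trans ?_ h1
  rw [mul_comm (2 ^ r) Q]
  exact (Nat.mod_modEq x (2 ^ r)).mul_left' Q

theorem Near.congr {Q r E m m' x} (h : Near Q r E m x) (hm : m ≡ m' [MOD Q]) : Near Q r E m' x := by
  obtain ⟨e, he, h1⟩ := h
  exact ⟨e, he, h1.trans ((hm.mul_left' (2 ^ r)).add_right e)⟩

theorem Near.zero {Q r} : Near Q r 0 0 0 := ⟨0, by simp, by simp [Nat.ModEq]⟩

theorem near_ceil {Q r m : ℕ} (hQ : 0 < Q) : Near Q r 1 m ((2 ^ r * m + (Q - 1)) / Q) := by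
  have h := Nat.div_add_mod (2 ^ r * m + (Q - 1)) Q
  have h2 := Nat.mod_lt (2 ^ r * m + (Q - 1)) hQ
  refine ⟨Q - 1 - (2 ^ r * m + (Q - 1)) % Q, by omega, ?_⟩
  have : Q * ((2 ^ r * m + (Q - 1)) / Q) = 2 ^ r * m + (Q - 1 - (2 ^ r * m + (Q - 1)) % Q) := by omega
  rw [this]

theorem Near.final {Q r E m x} (h : Near Q r E m x) (hx : x < 2 ^ r) : Q * x ≤ 2 ^ r * (m % Q) + E * Q := by
  obtain ⟨e, he, h1⟩ := h.congr (Nat.mod_modEq m Q).symm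
  rcases Nat.eq_zero_or_pos Q with rfl | hQ
  · simp
  have h2 : Q * x < 2 ^ r * Q := by rw [mul_comm]; exact Nat.mul_lt_mul_of_pos_right hx hQ
  have h3 : Q * x = (2 ^ r * (m % Q) + e) % (2 ^ r * Q) := by rw [← h1, Nat.mod_eq_of_lt h2]
  have := Nat.mod_le (2 ^ r * (m % Q) + e) (2 ^ r * Q)
  omega

/-- lower bound, when no wrap around is possible -/
theorem Near.lower {Q r E m x} (hQ : 0 < Q) (h : Near Q r E m x) (hx : x < 2 ^ r) (hE : E ≤ x) (hE2 : E ≤ 2 ^ r) : 2 ^ r * (m % Q) ≤ Q * x := by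
  obtain ⟨e, he, h1⟩ := h.congr (Nat.mod_modEq m Q).symm
  have h2 : Q * x < 2 ^ r * Q := by rw [mul_comm]; exact Nat.mul_lt_mul_of_pos_right hx hQ
  have hm := Nat.mod_lt m hQ
  have h3 : Q * x = (2 ^ r * (m % Q) + e) % (2 ^ r * Q) := by rw [← h1, Nat.mod_eq_of_lt h2]
  by_cases hlt : 2 ^ r * (m % Q) + e < 2 ^ r * Q
  · rw [Nat.mod_eq_of_lt hlt] at h3; omega
  · exfalso
    have hm2 : 2 ^ r * (m % Q) + 2 ^ r ≤ 2 ^ r * Q := by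
      have := Nat.mul_le_mul_left (2 ^ r) (Nat.succ_le_of_lt hm)
      simpa [Nat.mul_succ] using this
    have h5 : E * Q ≤ x * Q := Nat.mul_le_mul_right _ hE
    have h6 : E * Q ≤ 2 ^ r * Q := Nat.mul_le_mul_right _ hE2
    have hp : 0 < 2 ^ r := by positivity
    rw [Nat.mod_eq_sub_mod (by omega), Nat.mod_eq_of_lt (by omega)] at h3
    have : x * Q = Q * x := mul_comm _ _
    omega

theorem Near.round {Q r g E m x} (h : Near Q (r + g) E m x) (hE : E ≤ 2 ^ g) : Near Q r 2 m (x / 2 ^ g + 1) := by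
  obtain ⟨e, he, h1⟩ := h
  have hd := Nat.div_add_mod x (2 ^ g)
  have hl := Nat.mod_lt x (show 0 < 2 ^ g by positivity)
  generalize x / 2 ^ g = y at *
  generalize x % 2 ^ g = z at *
  subst hd
  obtain ⟨c, hc⟩ := (Nat.modEq_iff_dvd.1 h1)
  push_cast at hc
  -- 2^(r+g) m + e - Q (2^g y + z) = 2^(r+g) Q c
  have hez : (e : ℤ) + Q * (2 ^ g - z) = 2 ^ g * (Q * (y + 1) + 2 ^ r * Q * c - 2 ^ r * m) := by
    rw [pow_add] at hc; linear_combination hc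
  have hpos : 0 ≤ (e : ℤ) + Q * (2 ^ g - z) := by
    have : (0 : ℤ) ≤ 2 ^ g - z := by
      have : (z : ℤ) < 2 ^ g := by exact_mod_cast hl
      omega
    positivity
  have hg : (0 : ℤ) < 2 ^ g := by positivity
  have hle : (e : ℤ) + Q * (2 ^ g - z) ≤ 2 ^ g * (2 * Q) := by
    have h1 : (e : ℤ) ≤ E * Q := by exact_mod_cast he
    have h2 : (E : ℤ) * Q ≤ 2 ^ g * Q := by exact_mod_cast Nat.mul_le_mul_right Q hE
    have h3 : (0 : ℤ) ≤ Q * z := by positivity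
    linarith
  rw [hez] at hpos hle
  have e0 := nonneg_of_mul_nonneg_right hpos hg
  have e1 := le_of_mul_le_mul_left hle hg
  obtain ⟨e', he'⟩ := Int.eq_ofNat_of_zero_le e0
  rw [he'] at e1
  refine ⟨e', by exact_mod_cast e1, ?_⟩
  rw [Nat.modEq_iff_dvd]
  refine ⟨c, ?_⟩
  push_cast
  linear_combination -he'

end PM

namespace PM

/-! The engine: definitions, written with raw recursors for fast kernel evaluation -/

noncomputable def force {α : Type} (x : ℕ) (f : ℕ → α) : α := Nat.rec (f 0) (fun m _ => f (Nat.succ m)) x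

theorem force_eq {α : Type} (x : ℕ) (f : ℕ → α) : force x f = f x := by cases x <;> rfl

noncomputable def orB (a b : Bool) : Bool := Bool.rec b true a
noncomputable def andB (a b : Bool) : Bool := Bool.rec false b a
theorem orB_eq (a b) : orB a b = (a || b) := by cases a <;> rfl
theorem andB_eq (a b) : andB a b = (a && b) := by cases a <;> rfl

noncomputable def addL (l : List ℕ) : List ℕ → List ℕ :=
  List.rec (fun _ => []) (fun h _ ih l2 => List.rec [] (fun h2 t2 _ => Nat.add h h2 :: ih t2) l2) l
noncomputable def foldY (low : ℕ) (l : List ℕ) : ℕ := List.rec 0 (fun h _ ih => Nat.add (Nat.land h low) ih) l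
noncomputable def dropL (b : ℕ) (l : List ℕ) : List ℕ :=
  Nat.rec (fun l => l) (fun _ ih l => List.rec [] (fun _ t _ => ih t) l) b l
noncomputable def appL (l m : List ℕ) : List ℕ := List.rec m (fun h _ ih => h :: ih) l
noncomputable def xL (R R2 : List ℕ) (bs : List ℕ) : List ℕ := List.rec R (fun b _ ih => addL ih (dropL b R2)) bs
noncomputable def ones (w L : ℕ) : ℕ :=
  Nat.rec 1 (fun l o => force o fun o => Nat.add o (Nat.mul (Nat.pow 2 (Nat.mul w (Nat.pow 2 l))) o)) L
noncomputable def cdiv (r m Q : ℕ) : ℕ := Nat.div (Nat.add (Nat.mul (Nat.pow 2 r) m) (Nat.sub Q 1)) Q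
noncomputable def build (w r Q g L : ℕ) : ℕ :=
  Nat.rec 0 (fun l P => force P fun P => force (ones w l) fun o =>
    Nat.add P (Nat.mul (Nat.pow 2 (Nat.mul w (Nat.pow 2 l)))
      (Nat.land (Nat.add P (Nat.mul o (cdiv r (Nat.mod (Nat.mul g (Nat.pow 2 l)) Q) Q)))
        (Nat.mul o (Nat.sub (Nat.pow 2 r) 1))))) L
noncomputable def rnd (r g o X : ℕ) : ℕ :=
  Nat.add (Nat.shiftRight (Nat.land X (Nat.mul o (Nat.sub (Nat.pow 2 (Nat.add r g)) (Nat.pow 2 g)))) g) o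
noncomputable def buildAll {α : Type} (w r gd Q p o L n : ℕ) (g : ℕ) (k : List ℕ → α) : α :=
  Nat.rec (fun (_ : ℕ) (k : List ℕ → α) => k [])
    (fun _ ih g k => force (rnd r gd o (build w (Nat.add r gd) Q g L)) fun P =>
      force (Nat.mod (Nat.mul p g) Q) fun g => ih g fun l => k (P :: l)) n g k
noncomputable def mkR {α : Type} (r Q p o low : ℕ) (Ps : List ℕ) (B : ℕ) (k : List ℕ → α) : α :=
  List.rec (fun (_ : ℕ) (k : List ℕ → α) => k []) (fun P _ ih B k =>
    force (Nat.land (Nat.add P (Nat.mul o (cdiv r B Q))) low) fun R =>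
      force (Nat.mod (Nat.mul p B) Q) fun B => ih B fun l => k (R :: l)) Ps B k
noncomputable def jdead (low : ℕ) (R R2 : List ℕ) (js : List (List ℕ × ℕ)) : ℕ :=
  List.rec 0 (fun j _ ih => Nat.lor (Nat.add (foldY low (xL R R2 j.1)) j.2) ih) js
noncomputable def neck (D C : ℕ) (R : List ℕ) : ℕ :=
  List.rec 0 (fun h _ ih => Nat.lor (Nat.land (Nat.sub D h) (Nat.add h C)) ih) R
noncomputable def headL (l : List ℕ) : ℕ := List.rec 0 (fun h _ _ => h) l

/-! Basic facts -/

theorem addL_nil (l) : addL [] l = [] := rfl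
theorem addL_nil' (l) : addL l [] = [] := by cases l <;> rfl
theorem addL_cons (a l b m) : addL (a :: l) (b :: m) = (a + b) :: addL l m := rfl
theorem dropL_zero (l) : dropL 0 l = l := rfl
theorem dropL_nil (b) : dropL b [] = [] := by cases b <;> rfl
theorem dropL_succ (b a l) : dropL (b + 1) (a :: l) = dropL b l := rfl
theorem appL_eq (l m) : appL l m = l ++ m := by
  induction l with
  | nil => rfl
  | cons a l ih => show a :: appL l m = _; rw [ih]; rfl

theorem ones_eq (w L) : ones w L = pack w (fun _ => 1) (2 ^ L) := by
  induction L with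
  | zero => simp [pack]; rfl
  | succ l ih =>
    have e : ones w (l + 1) = force (ones w l) fun o => o + 2 ^ (w * 2 ^ l) * o := rfl
    rw [e, force_eq, ih, pack_append, pow_succ, mul_two]
    exact pack_congr (fun t _ => by split_ifs <;> rfl)

theorem ones_mul (w L c) : ones w L * c = pack w (fun _ => c) (2 ^ L) := by
  rw [ones_eq, pack_mul]; exact pack_congr (fun t _ => by simp)

theorem land_low (x r : ℕ) : x &&& (2 ^ r - 1) = x % 2 ^ r := Nat.and_two_pow_sub_one_eq_mod x r

/-! Representations -/

def Rep (w r Q T bnd E : ℕ) (m : ℕ → ℕ) (X : ℕ) : Prop :=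
  ∃ f, X = pack w f T ∧ (∀ t, f t ≤ bnd) ∧ ∀ t < T, Near Q r E (m t) (f t)

theorem cdiv_le {r m Q : ℕ} (hm : m < Q) : cdiv r m Q ≤ 2 ^ r := by
  show (2 ^ r * m + (Q - 1)) / Q ≤ 2 ^ r
  apply Nat.le_of_lt_succ
  rw [Nat.div_lt_iff_lt_mul (by omega)]
  have := Nat.mul_le_mul_left (2 ^ r) (Nat.succ_le_of_lt hm)
  rw [Nat.mul_succ] at this
  rw [Nat.succ_mul]
  have : 0 < 2 ^ r := by positivity
  omega

theorem two_pow_le {a b : ℕ} (h : a ≤ b) : 2 ^ a ≤ 2 ^ b := Nat.pow_le_pow_right (by norm_num) h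

/-- add a constant and reduce -/
theorem Rep.shift {w r Q T bnd E m X B o low : ℕ} {mm : ℕ → ℕ} (hQ : 0 < Q) (hX : Rep w r Q T bnd E mm X)
    (ho : ∀ c, o * c = pack w (fun _ => c) T) (hlow : low = pack w (fun _ => 2 ^ r - 1) T)
    (hB : B < Q) (hBm : B ≡ m [MOD Q]) (hb : bnd ≤ 2 ^ r) (hw : r + 2 ≤ w) :
    Rep w r Q T (2 ^ r - 1) (E + 1) (fun t => mm t + m) (Nat.land (X + o * cdiv r B Q) low) := by
  obtain ⟨f, rfl, hf, hn⟩ := hX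
  have hp : 0 < 2 ^ r := by positivity
  have h4 : 2 ^ r * 4 ≤ 2 ^ w := by
    have := two_pow_le hw
    rwa [pow_add] at this
  have hc := cdiv_le (r := r) hB
  refine ⟨fun t => (f t + cdiv r B Q) % 2 ^ r, ?_, ?_, ?_⟩
  · rw [ho, pack_add, hlow]
    show (pack w (fun t => f t + cdiv r B Q) T) &&& (pack w (fun _ => 2 ^ r - 1) T) = _
    rw [pack_land]
    · exact pack_congr (fun t _ => land_low _ _)
    · intro t; have := hf t; show f t + cdiv r B Q < _; omega
    · intro t; show 2 ^ r - 1 < 2 ^ w; omega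
  · intro t
    have := Nat.mod_lt (f t + cdiv r B Q) hp
    show _ % _ ≤ _
    omega
  · intro t ht
    exact (((hn t ht).add (near_ceil hQ (m := B))).mod).congr (hBm.add_left _)

theorem build_rep {w r Q : ℕ} (hQ : 0 < Q) (hw : r + 2 ≤ w) (g L : ℕ) :
    Rep w r Q (2 ^ L) (2 ^ r - 1) L (fun t => g * t) (build w r Q g L) := by
  induction L with
  | zero =>
    refine ⟨fun _ => 0, ?_, ?_, ?_⟩
    · simp [pack]; rfl
    · simp
    · intro t ht
      have : t = 0 := by simpa using ht
      subst this
      exact Near.zero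
  | succ l ih =>
    have hs := ih.shift (m := g * 2 ^ l) (B := (g * 2 ^ l) % Q) (o := ones w l) (low := ones w l * (2 ^ r - 1)) hQ
      (ones_mul w l) (ones_mul w l _) (Nat.mod_lt _ hQ) (Nat.mod_modEq _ _) (Nat.sub_le _ _) hw
    have e : build w r Q g (l + 1) = build w r Q g l + 2 ^ (w * 2 ^ l) *
        (Nat.land (build w r Q g l + ones w l * cdiv r ((g * 2 ^ l) % Q) Q) (ones w l * (2 ^ r - 1))) := by
      have e0 : build w r Q g (l + 1) = force (build w r Q g l) fun P => force (ones w l) fun o =>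
        P + 2 ^ (w * 2 ^ l) * (Nat.land (P + o * cdiv r ((g * 2 ^ l) % Q) Q) (o * (2 ^ r - 1))) := rfl
      rw [e0, force_eq, force_eq]
    rw [e]
    generalize Nat.land (build w r Q g l + ones w l * cdiv r ((g * 2 ^ l) % Q) Q) (ones w l * (2 ^ r - 1)) = Y at hs
    generalize build w r Q g l = X at ih
    obtain ⟨f, rfl, hf, hn⟩ := ih
    obtain ⟨f', rfl, hf', hn'⟩ := hs
    refine ⟨_, (pack_append _ _ _ _ _).trans (by rw [pow_succ, mul_two]), ?_, ?_⟩
    · intro t; split_ifs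
      · exact hf t
      · exact hf' _
    · intro t ht
      dsimp only
      split_ifs with h
      · exact (hn t h).mono (by omega)
      · have := hn' (t - 2 ^ l) (by rw [pow_succ] at ht; omega)
        convert this using 1
        show g * t = g * (t - 2 ^ l) + g * 2 ^ l
        rw [← mul_add]; congr 1; omega

theorem rnd_rep {w r g Q L E X o : ℕ} {m : ℕ → ℕ} (ho : ∀ c, o * c = pack w (fun _ => c) (2 ^ L)) (hw : r + g + 2 ≤ w) (hE : E ≤ 2 ^ g)
    (h : Rep w (r + g) Q (2 ^ L) (2 ^ (r + g) - 1) E m X) : Rep w r Q (2 ^ L) (2 ^ r) 2 m (rnd r g o X) := by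
  obtain ⟨f, rfl, hf, hn⟩ := h
  have hpg : 0 < 2 ^ g := by positivity
  have hprg : 0 < 2 ^ (r + g) := by positivity
  have hlt : ∀ t, f t < 2 ^ (r + g) := fun t => by have := hf t; omega
  have hdiv : ∀ t, f t / 2 ^ g < 2 ^ r := fun t => by
    rw [Nat.div_lt_iff_lt_mul hpg, ← pow_add]; exact hlt t
  refine ⟨fun t => f t / 2 ^ g + 1, ?_, fun t => hdiv t, fun t ht => (hn t ht).round hE⟩
  show ((pack w f (2 ^ L) &&& (o * (2 ^ (r + g) - 2 ^ g))) >>> g) + o = _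
  have hw2 : 2 ^ (r + g) ≤ 2 ^ w := two_pow_le (by omega)
  rw [ho, pack_land (fun t => (hlt t).trans_le hw2) (fun t => by omega)]
  have e : ∀ t, f t &&& (2 ^ (r + g) - 2 ^ g) = (f t / 2 ^ g) * 2 ^ g := by
    intro t
    have h1 : 2 ^ (r + g) - 2 ^ g = 2 ^ g * (2 ^ r - 1) + 0 := by rw [pow_add, Nat.mul_sub, mul_comm]; simp
    conv_lhs => rw [← Nat.div_add_mod (f t) (2 ^ g), h1]
    rw [land_split (Nat.mod_lt _ hpg) hpg, land_low, Nat.mod_eq_of_lt (hdiv t)]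
    simp [mul_comm]
  rw [pack_congr (fun t _ => e t), ← pack_mul, Nat.shiftRight_eq_div_pow, Nat.mul_div_cancel _ hpg]
  have h1 := ho 1
  rw [mul_one] at h1
  rw [h1, pack_add]

def RL (p w r Q T bnd E : ℕ) : (ℕ → ℕ) → List ℕ → Prop
  | _, [] => True
  | m, X :: Xs => Rep w r Q T bnd E m X ∧ RL p w r Q T bnd E (fun t => p * m t) Xs

section
variable {p w r Q T : ℕ}

theorem Rep.congr {bnd E X} {m m' : ℕ → ℕ} (h : Rep w r Q T bnd E m X) (hm : ∀ t, m t ≡ m' t [MOD Q]) : Rep w r Q T bnd E m' X := by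
  obtain ⟨f, h1, h2, h3⟩ := h
  exact ⟨f, h1, h2, fun t ht => (h3 t ht).congr (hm t)⟩

theorem RL.congr {bnd E} : ∀ {l : List ℕ} {m m' : ℕ → ℕ}, RL p w r Q T bnd E m l → (∀ t, m t ≡ m' t [MOD Q]) → RL p w r Q T bnd E m' l
  | [], _, _, _, _ => trivial
  | _ :: _, _, _, h, hm => ⟨h.1.congr hm, h.2.congr (fun t => (hm t).mul_left p)⟩

theorem RL.append {bnd E} {l' : List ℕ} : ∀ {l : List ℕ} {m : ℕ → ℕ}, RL p w r Q T bnd E m l →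
    RL p w r Q T bnd E (fun t => p ^ l.length * m t) l' → RL p w r Q T bnd E m (l ++ l')
  | [], m, _, h' => by simpa using h'
  | _ :: l, m, h, h' => ⟨h.1, h.2.append (by
      convert h' using 2 with t
      rw [List.length_cons, pow_succ, mul_assoc])⟩

theorem RL.drop {bnd E} : ∀ (b : ℕ) {l : List ℕ} {m : ℕ → ℕ}, RL p w r Q T bnd E m l → RL p w r Q T bnd E (fun t => p ^ b * m t) (dropL b l)
  | 0, l, m, h => by simpa [dropL_zero] using h
  | b + 1, [], m, _ => by rw [dropL_nil]; trivial
  | b + 1, a :: l, m, h => by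
    rw [dropL_succ]
    convert h.2.drop b using 2 with t
    rw [pow_succ, mul_assoc]

theorem RL.addL {bnd E bnd' E'} : ∀ {l l' : List ℕ} {m m' : ℕ → ℕ}, RL p w r Q T bnd E m l → RL p w r Q T bnd' E' m' l' →
    RL p w r Q T (bnd + bnd') (E + E') (fun t => m t + m' t) (addL l l')
  | [], l', m, m', _, _ => by rw [addL_nil]; trivial
  | _ :: _, [], m, m', _, _ => by rw [addL_nil']; trivial
  | a :: l, b :: l', m, m', h, h' => by
    rw [addL_cons]
    refine ⟨?_, ?_⟩
    · obtain ⟨f, rfl, h2, h3⟩ := h.1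
      obtain ⟨f', rfl, h2', h3'⟩ := h'.1
      exact ⟨_, pack_add _ _ _ _, fun t => Nat.add_le_add (h2 t) (h2' t), fun t ht => (h3 t ht).add (h3' t ht)⟩
    · convert h.2.addL h'.2 using 2 with t
      rw [mul_add]

theorem addL_length : ∀ (l l' : List ℕ), (addL l l').length ≤ l.length
  | [], l' => by rw [addL_nil]
  | _ :: _, [] => by rw [addL_nil']; simp
  | a :: l, b :: l' => by rw [addL_cons]; simpa using addL_length l l'

theorem xL_length (R R2 bs) : (xL R R2 bs).length ≤ R.length := by
  induction bs with
  | nil => exact le_refl _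
  | cons b bs ih => exact (addL_length _ _).trans ih

theorem xL_rep {bnd E} {R R2 : List ℕ} {m : ℕ → ℕ} (hR : RL p w r Q T bnd E m R) (hR2 : RL p w r Q T bnd E m R2) (bs : List ℕ) :
    RL p w r Q T ((bs.length + 1) * bnd) ((bs.length + 1) * E) (fun t => ((0 :: bs).map (fun b => p ^ b)).sum * m t) (xL R R2 bs) := by
  induction bs with
  | nil => simp; exact hR
  | cons b bs ih =>
    have := ih.addL (hR2.drop b)
    show RL _ _ _ _ _ _ _ _ (addL (xL R R2 bs) (dropL b R2))
    convert this using 1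
    · simp; ring
    · simp; ring
    · funext t; simp; ring

theorem foldY_rep {bnd E low : ℕ} (hlow : low = pack w (fun _ => 2 ^ r - 1) T) (hb : bnd < 2 ^ w) (hr : r ≤ w) :
    ∀ {l : List ℕ} {m : ℕ → ℕ}, RL p w r Q T bnd E m l → ∃ y, foldY low l = pack w y T ∧ (∀ t, y t ≤ l.length * 2 ^ r) ∧
      ∀ t < T, Q * y t ≤ ∑ i ∈ Finset.range l.length, (2 ^ r * ((p ^ i * m t) % Q) + E * Q)
  | [], m, _ => ⟨fun _ => 0, by simp [pack]; rfl, by simp, by simp⟩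
  | a :: l, m, h => by
    obtain ⟨y, h1, h2, h3⟩ := foldY_rep hlow hb hr h.2
    obtain ⟨f, rfl, h2', h3'⟩ := h.1
    have hp : 0 < 2 ^ r := by positivity
    have hrw : 2 ^ r ≤ 2 ^ w := two_pow_le hr
    refine ⟨fun t => f t % 2 ^ r + y t, ?_, ?_, ?_⟩
    · show (pack w f T &&& low) + foldY low l = _
      rw [h1, hlow, pack_land (fun t => (h2' t).trans_lt hb) (fun t => by omega), pack_add]
      exact pack_congr (fun t _ => by rw [land_low])
    · intro t
      have e1 := h2 t
      have e2 := Nat.mod_lt (f t) hp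
      simp only [List.length_cons, Nat.succ_mul]
      omega
    · intro t ht
      have e1 := h3 t ht
      have e2 := (h3' t ht).mod.final (Nat.mod_lt _ hp)
      rw [List.length_cons, Finset.sum_range_succ', mul_add, pow_zero, one_mul]
      have e3 : ∑ i ∈ Finset.range l.length, (2 ^ r * ((p ^ i * (p * m t)) % Q) + E * Q) =
        ∑ i ∈ Finset.range l.length, (2 ^ r * ((p ^ (i + 1) * m t) % Q) + E * Q) := by
        apply Finset.sum_congr rfl; intro i _
        rw [pow_succ, mul_assoc]
      rw [← e3]
      omega

end

/-- plain form of `buildAll` -/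
noncomputable def buildL (w r gd Q p o L : ℕ) : ℕ → ℕ → List ℕ
  | 0, _ => []
  | n + 1, g => rnd r gd o (build w (r + gd) Q g L) :: buildL w r gd Q p o L n ((p * g) % Q)

theorem buildAll_eq {α : Type} (w r gd Q p o L n g : ℕ) (k : List ℕ → α) :
    buildAll w r gd Q p o L n g k = k (buildL w r gd Q p o L n g) := by
  induction n generalizing g k with
  | zero => rfl
  | succ n ih =>
    have : buildAll w r gd Q p o L (n + 1) g k = force (rnd r gd o (build w (r + gd) Q g L)) fun P =>
      force ((p * g) % Q) fun g => buildAll w r gd Q p o L n g fun l => k (P :: l) := rfl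
    rw [this, force_eq, force_eq, ih]; rfl

theorem buildL_length (w r gd Q p o L n g) : (buildL w r gd Q p o L n g).length = n := by
  induction n generalizing g with
  | zero => rfl
  | succ n ih => simp [buildL, ih]

theorem buildL_rep {w r gd Q p o L : ℕ} (hQ : 0 < Q) (ho : ∀ c, o * c = pack w (fun _ => c) (2 ^ L)) (hw : r + gd + 2 ≤ w)
    (hL : L ≤ 2 ^ gd) (n g : ℕ) :
    RL p w r Q (2 ^ L) (2 ^ r) 2 (fun t => g * t) (buildL w r gd Q p o L n g) := by
  induction n generalizing g with
  | zero => trivial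
  | succ n ih =>
    refine ⟨rnd_rep ho hw hL (build_rep hQ hw g L), (ih ((p * g) % Q)).congr fun t => ?_⟩
    rw [← mul_assoc]
    exact (Nat.mod_modEq _ _).mul_right t

noncomputable def mkRL (r Q p o low : ℕ) : List ℕ → ℕ → List ℕ
  | [], _ => []
  | P :: Ps, B => Nat.land (P + o * cdiv r B Q) low :: mkRL r Q p o low Ps ((p * B) % Q)

theorem mkR_eq {α : Type} (r Q p o low : ℕ) (Ps : List ℕ) (B : ℕ) (k : List ℕ → α) :
    mkR r Q p o low Ps B k = k (mkRL r Q p o low Ps B) := by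
  induction Ps generalizing B k with
  | nil => rfl
  | cons P Ps ih =>
    have : mkR r Q p o low (P :: Ps) B k = force (Nat.land (P + o * cdiv r B Q) low) fun R =>
      force ((p * B) % Q) fun B => mkR r Q p o low Ps B fun l => k (R :: l) := rfl
    rw [this, force_eq, force_eq, ih]; rfl

theorem mkRL_length (r Q p o low Ps B) : (mkRL r Q p o low Ps B).length = Ps.length := by
  induction Ps generalizing B with
  | nil => rfl
  | cons n _ ih => simp [mkRL, ih]

theorem mkRL_rep {w r Q p o low T bnd E : ℕ} (hQ : 0 < Q) (ho : ∀ c, o * c = pack w (fun _ => c) T)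
    (hlow : low = pack w (fun _ => 2 ^ r - 1) T) (hb : bnd ≤ 2 ^ r) (hw : r + 2 ≤ w) :
    ∀ (Ps : List ℕ) (B m : ℕ) (mm : ℕ → ℕ), B < Q → B ≡ m [MOD Q] → RL p w r Q T bnd E mm Ps →
    RL p w r Q T (2 ^ r - 1) (E + 1) (fun t => mm t + m) (mkRL r Q p o low Ps B)
  | [], _, _, _, _, _, _ => trivial
  | P :: Ps, B, m, mm, hB, hBm, h => by
    refine ⟨h.1.shift hQ ho hlow hB hBm hb hw, ?_⟩
    have := mkRL_rep hQ ho hlow hb hw Ps ((p * B) % Q) (p * m) _ (Nat.mod_lt _ hQ) ((Nat.mod_modEq _ _).trans (hBm.mul_left p)) h.2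
    convert this using 2 with t
    rw [mul_add]

end PM

namespace PM

noncomputable def thrN (p n r s : ℕ) : ℕ :=
  Nat.add (Nat.div (Nat.mul (Nat.pow 2 r) (Nat.add (Nat.mul 2 s) (Nat.mul n (Nat.sub p 1)))) (Nat.mul 2 (Nat.sub p 1)))
    (Nat.add (Nat.mul n (Nat.mul s 3)) 1)
noncomputable def lenL (l : List ℕ) : ℕ := List.rec 1 (fun _ _ ih => Nat.succ ih) l
theorem lenL_eq (l) : lenL l = l.length + 1 := by
  induction l with
  | nil => rfl
  | cons a l ih => show (lenL l).succ = _; rw [ih]; rfl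

noncomputable def jprep {α : Type} (p n r w o : ℕ) (js : List (List ℕ)) (k : List (List ℕ × ℕ) → α) : α :=
  List.rec (fun (k : List (List ℕ × ℕ) → α) => k []) (fun j _ ih k =>
    force (lenL j) fun s => force (thrN p n r s) fun th =>
      Bool.rec (ih k) (force (Nat.mul o (Nat.sub (Nat.pow 2 (Nat.sub w 1)) th)) fun c => ih fun l => k ((j, c) :: l))
        (andB (Nat.ble th (Nat.pow 2 (Nat.sub w 1))) (andB
          (Nat.ble (Nat.succ (Nat.add (Nat.mul n (Nat.pow 2 r)) (Nat.pow 2 (Nat.sub w 1)))) (Nat.add (Nat.pow 2 w) th))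
          (Nat.ble (Nat.mul s (Nat.pow 2 r)) (Nat.pow 2 w))))) js k

def JOK (p n r w o : ℕ) (e : List ℕ × ℕ) : Prop :=
  e.2 = o * (2 ^ (w - 1) - thrN p n r (e.1.length + 1)) ∧ thrN p n r (e.1.length + 1) ≤ 2 ^ (w - 1) ∧
    n * 2 ^ r + 2 ^ (w - 1) < 2 ^ w + thrN p n r (e.1.length + 1) ∧ (e.1.length + 1) * 2 ^ r ≤ 2 ^ w

theorem jprep_spec (p n r w o : ℕ) (js : List (List ℕ)) :
    ∃ l : List (List ℕ × ℕ), (∀ e ∈ l, JOK p n r w o e) ∧ ∀ (α : Type) (k : List (List ℕ × ℕ) → α), jprep p n r w o js k = k l := by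
  induction js with
  | nil => exact ⟨[], by simp, fun _ _ => rfl⟩
  | cons j js ih =>
    obtain ⟨l, hl, hk⟩ := ih
    have h1 : ∀ (α : Type) (k : List (List ℕ × ℕ) → α), jprep p n r w o (j :: js) k = force (lenL j) fun s => force (thrN p n r s) fun th =>
      Bool.rec (jprep p n r w o js k) (force (o * (2 ^ (w - 1) - th)) fun c => jprep p n r w o js fun l => k ((j, c) :: l))
        (andB (Nat.ble th (2 ^ (w - 1))) (andB (Nat.ble (Nat.succ (n * 2 ^ r + 2 ^ (w - 1))) (2 ^ w + th))
          (Nat.ble (s * 2 ^ r) (2 ^ w)))) := fun _ _ => rfl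
    simp only [force_eq, lenL_eq, andB_eq] at h1
    cases hb : (Nat.ble (thrN p n r (j.length + 1)) (2 ^ (w - 1)) &&
      (Nat.ble (Nat.succ (n * 2 ^ r + 2 ^ (w - 1))) (2 ^ w + thrN p n r (j.length + 1)) &&
        Nat.ble ((j.length + 1) * 2 ^ r) (2 ^ w))) with
    | false =>
      refine ⟨l, hl, fun α k => ?_⟩
      rw [h1, hb]
      exact hk α k
    | true =>
      refine ⟨(j, o * (2 ^ (w - 1) - thrN p n r (j.length + 1))) :: l, ?_, fun α k => ?_⟩
      · intro e he
        rcases List.mem_cons.1 he with rfl | he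
        · simp only [Bool.and_eq_true, Nat.ble_eq] at hb
          exact ⟨rfl, hb.1, hb.2.1, hb.2.2⟩
        · exact hl e he
      · rw [h1, hb]
        show jprep p n r w o js _ = _
        rw [hk]

/-- what remains to be shown impossible or known -/
def Pk (filt : Bool) (p n k : ℕ) : Prop :=
  Good p n k ∧ k < p ^ n - 1 ∧ (filt = true → ∀ i < n, k ≤ (p ^ i * k) % (p ^ n - 1))

def Dead (w T : ℕ) (P : ℕ → Prop) (X : ℕ) : Prop :=
  ∃ d, X = pack w d T ∧ (∀ t, d t < 2 ^ w) ∧ ∀ t < T, 2 ^ (w - 1) ≤ d t → ¬ P t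

theorem hi_or {w a b : ℕ} (h : 2 ^ (w - 1) ≤ a ||| b) : 2 ^ (w - 1) ≤ a ∨ 2 ^ (w - 1) ≤ b := by
  by_contra hc
  push Not at hc
  have := Nat.or_lt_two_pow hc.1 hc.2
  omega

theorem hi_and {w a b : ℕ} (h : 2 ^ (w - 1) ≤ a &&& b) : 2 ^ (w - 1) ≤ a ∧ 2 ^ (w - 1) ≤ b :=
  ⟨h.trans Nat.and_le_left, h.trans Nat.and_le_right⟩

theorem Dead.zero (w T P) : Dead w T P 0 := ⟨fun _ => 0, by simp [pack], by simp, by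
  intro t _ h
  have h1 : 0 < 2 ^ (w - 1) := by positivity
  exact absurd h (not_le.2 h1)⟩

theorem Dead.lor {w T P X Y} (hX : Dead w T P X) (hY : Dead w T P Y) : Dead w T P (X ||| Y) := by
  obtain ⟨d, rfl, h1, h2⟩ := hX
  obtain ⟨e, rfl, h3, h4⟩ := hY
  refine ⟨_, pack_lor h1 h3, fun t => Nat.or_lt_two_pow (h1 t) (h3 t), fun t ht h => ?_⟩
  rcases hi_or h with h | h
  · exact h2 t ht h
  · exact h4 t ht h

theorem J_kill0 {p n r s k y Q : ℕ} (bs : List ℕ) (hp : 2 ≤ p) (hQ : Q = p ^ n - 1) (hQ0 : 0 < Q) (hG : Good p n k) (hs : bs.length = s) (C : ℕ)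
    (h1 : Q * y ≤ 2 ^ r * (∑ i ∈ Finset.range n, (p ^ i * ((bs.map (fun b => p ^ b)).sum * k)) % Q) + C * Q) :
    y ≤ (2 ^ r * (2 * s + n * (p - 1))) / (2 * (p - 1)) + C := by
  subst hs
  have hJ := hG.J bs
  rw [← hQ] at hJ
  generalize ∑ i ∈ Finset.range n, (p ^ i * ((bs.map (fun b => p ^ b)).sum * k)) % Q = S at *
  have hq : 0 < 2 * (p - 1) := by omega
  by_cases hc : y ≤ C
  · exact hc.trans (Nat.le_add_left _ _)
  obtain ⟨z, rfl⟩ : ∃ z, y = z + C := ⟨y - C, by omega⟩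
  have h2 : Q * z ≤ 2 ^ r * S := by nlinarith
  suffices z ≤ (2 ^ r * (2 * bs.length + n * (p - 1))) / (2 * (p - 1)) by omega
  rw [Nat.le_div_iff_mul_le hq]
  have h3 : Q * (z * (2 * (p - 1))) ≤ Q * (2 ^ r * (2 * bs.length + n * (p - 1))) := by
    calc Q * (z * (2 * (p - 1))) = (Q * z) * (2 * (p - 1)) := by ring
      _ ≤ (2 ^ r * S) * (2 * (p - 1)) := Nat.mul_le_mul_right _ h2
      _ = 2 ^ r * (2 * (p - 1) * S) := by ring
      _ ≤ 2 ^ r * ((2 * bs.length + n * (p - 1)) * Q) := Nat.mul_le_mul_left _ hJ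
      _ = _ := by ring
  exact Nat.le_of_mul_le_mul_left h3 hQ0

theorem J_kill {p n r s k y Q : ℕ} (bs : List ℕ) (hp : 2 ≤ p) (hQ : Q = p ^ n - 1) (hQ0 : 0 < Q) (hG : Good p n k) (hs : bs.length = s) (len E C : ℕ) (hlen : len ≤ n)
    (hE : len * E ≤ C)
    (hy : Q * y ≤ ∑ i ∈ Finset.range len, (2 ^ r * ((p ^ i * ((bs.map (fun b => p ^ b)).sum * k)) % Q) + E * Q)) :
    y ≤ (2 ^ r * (2 * s + n * (p - 1))) / (2 * (p - 1)) + C := by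
  refine J_kill0 bs hp hQ hQ0 hG hs C ?_
  rw [Finset.sum_add_distrib, ← Finset.mul_sum, Finset.sum_const, Finset.card_range, smul_eq_mul] at hy
  have hsub : ∑ i ∈ Finset.range len, (p ^ i * ((bs.map (fun b => p ^ b)).sum * k)) % Q ≤
      ∑ i ∈ Finset.range n, (p ^ i * ((bs.map (fun b => p ^ b)).sum * k)) % Q :=
    Finset.sum_le_sum_of_subset (Finset.range_mono hlen)
  have e1 := Nat.mul_le_mul_left (2 ^ r) hsub
  have e2 := Nat.mul_le_mul_right Q hE
  have e3 : len * E * Q = len * (E * Q) := by ring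
  exact hy.trans (Nat.add_le_add e1 (e3 ▸ e2))

section
variable {p n w r Q T M B o low : ℕ} {filt : Bool} {R : List ℕ}

theorem jdead_dead (hp : 2 ≤ p) (hQ : Q = p ^ n - 1) (hQ0 : 0 < Q) (ho : ∀ c, o * c = pack w (fun _ => c) T)
    (hlow : low = pack w (fun _ => 2 ^ r - 1) T) (hw : r + 2 ≤ w)
    (hR : RL p w r Q T (2 ^ r - 1) 3 (fun t => M * t + B) R) (hlen : R.length = n) (js : List (List ℕ × ℕ))
    (hjs : ∀ e ∈ js, JOK p n r w o e) :
    Dead w T (fun t => Pk filt p n (B + M * t)) (jdead low R (appL R R) js) := by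
  have hR2 : RL p w r Q T (2 ^ r - 1) 3 (fun t => M * t + B) (appL R R) := by
    rw [appL_eq]
    refine hR.append (hR.congr fun t => ?_)
    have := (pow_period p n n (by omega)).mul_right (M * t + B)
    rw [Nat.mod_self, pow_zero, one_mul, ← hQ] at this
    rw [hlen]; exact this.symm
  induction js with
  | nil => exact Dead.zero _ _ _
  | cons j js ih =>
    show Dead w T _ ((foldY low (xL R (appL R R) j.1) + j.2) ||| jdead low R (appL R R) js)
    refine Dead.lor ?_ (ih fun e he => hjs e (List.mem_cons_of_mem _ he))
    obtain ⟨h1, h2, h3, h4⟩ := hjs j List.mem_cons_self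
    have hpr : 0 < 2 ^ r := by positivity
    have hx := xL_rep hR hR2 j.1
    have hb : (j.1.length + 1) * (2 ^ r - 1) < 2 ^ w := by
      refine lt_of_lt_of_le ?_ h4
      exact Nat.mul_lt_mul_of_pos_left (by omega) (by omega)
    obtain ⟨y, e1, e2, e3⟩ := foldY_rep hlow hb (by omega) hx
    have hl := (xL_length R (appL R R) j.1).trans hlen.le
    generalize (xL R (appL R R) j.1).length = len at *
    have hw1 : 2 ^ w = 2 ^ (w - 1) * 2 := by rw [← pow_succ]; congr 1; omega
    refine ⟨_, by rw [e1, h1, ho, pack_add], fun t => ?_, fun t ht hd hP => ?_⟩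
    · have := e2 t
      have := Nat.mul_le_mul_right (2 ^ r) hl
      omega
    · have e3' := e3 t ht
      rw [add_comm (M * t) B] at e3'
      have := J_kill (0 :: j.1) hp hQ hQ0 hP.1 rfl len ((j.1.length + 1) * 3) (n * ((j.1.length + 1) * 3)) hl (Nat.mul_le_mul_right _ hl) e3'
      have ht : thrN p n r (j.1.length + 1) = 2 ^ r * (2 * (j.1.length + 1) + n * (p - 1)) / (2 * (p - 1)) + (n * ((j.1.length + 1) * 3) + 1) := rfl
      rw [List.length_cons] at this
      omega

theorem neck_dead (hQ : Q = p ^ n - 1) (hQ0 : 0 < Q)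
    (ho : ∀ c, o * c = pack w (fun _ => c) T) (hr : 2 ≤ r) (hw : r + 2 ≤ w) (hf : filt = true)
    {D C : ℕ} {d0 : ℕ → ℕ} (hD : D = pack w (fun t => d0 t + (2 ^ (w - 1) - 4)) T) (hd0 : ∀ t, d0 t ≤ 2 ^ r - 1)
    (hN : ∀ t < T, Near Q r 3 (M * t + B) (d0 t)) (hC : C = o * (2 ^ (w - 1) - 3)) (Rs : List ℕ) :
    ∀ i, i + Rs.length ≤ n → RL p w r Q T (2 ^ r - 1) 3 (fun t => p ^ i * (M * t + B)) Rs →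
    Dead w T (fun t => Pk filt p n (B + M * t)) (neck D C Rs) := by
  induction Rs with
  | nil => intros; exact Dead.zero _ _ _
  | cons a Rs ih =>
    intro i hi h
    show Dead w T _ (((D - a) &&& (a + C)) ||| neck D C Rs)
    have hpr : 2 ^ 2 ≤ 2 ^ r := two_pow_le hr
    have hw2 : 2 ^ (r + 1) ≤ 2 ^ (w - 1) := two_pow_le (by omega)
    have hw1 : 2 ^ w = 2 ^ (w - 1) * 2 := by rw [← pow_succ]; congr 1; omega
    rw [pow_succ] at hw2
    refine Dead.lor ?_ (ih (i + 1) (by simp at hi; omega) ?_)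
    · obtain ⟨f, rfl, h2, h3⟩ := h.1
      rw [hD, hC, ho, pack_add, pack_sub]
      · have b1 : ∀ t, d0 t + (2 ^ (w - 1) - 4) - f t < 2 ^ w := fun t => by have := hd0 t; omega
        have b2 : ∀ t, f t + (2 ^ (w - 1) - 3) < 2 ^ w := fun t => by have := h2 t; omega
        refine ⟨_, pack_land b1 b2, fun t => lt_of_le_of_lt Nat.and_le_left (b1 t), fun t ht hd hP => ?_⟩
        obtain ⟨q1, q2⟩ := hi_and hd
        have n1 := (hN t ht).final (by have := hd0 t; omega)
        have n2 := (h3 t ht).lower hQ0 (x := f t) (by have := h2 t; omega) (by show 3 ≤ f t; have q2' : 2 ^ (w - 1) ≤ f t + (2 ^ (w - 1) - 3) := q2; omega) (by omega)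
        have hm := hP.2.2 hf i (by simp at hi; omega)
        rw [← hQ] at hm
        have hk : (M * t + B) % Q ≤ (p ^ i * (M * t + B)) % Q := by
          rw [Nat.mod_eq_of_lt]
          · rw [add_comm (M * t)]; exact hm
          · rw [add_comm (M * t), hQ]; exact hP.2.1
        have h5 := Nat.mul_le_mul_left (2 ^ r) hk
        have h6 : Q * d0 t ≤ Q * (f t + 3) := by
          rw [mul_add, mul_comm Q 3]; exact n1.trans ((Nat.add_le_add_right h5 _).trans (Nat.add_le_add_right n2 _))
        have h7 := Nat.le_of_mul_le_mul_left h6 hQ0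
        omega
      · intro t; have := h2 t; show f t ≤ d0 t + _; omega
    · convert h.2 using 2 with t
      rw [pow_succ]; ring

end
end PM

namespace PM

noncomputable def anyN (n : ℕ) (f : ℕ → Bool) : Bool := Nat.rec false (fun i ih => orB (f i) ih) n
noncomputable def allN (n : ℕ) (f : ℕ → Bool) : Bool := Nat.rec true (fun i ih => andB (f i) ih) n
noncomputable def anyL {α : Type} (l : List α) (f : α → Bool) : Bool := List.rec false (fun a _ ih => orB (f a) ih) l
noncomputable def allL {α : Type} (l : List α) (f : α → Bool) : Bool := List.rec true (fun a _ ih => andB (f a) ih) l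

theorem anyN_spec {n f} (h : anyN n f = true) : ∃ i < n, f i = true := by
  induction n with
  | zero => exact absurd h (by decide : ¬ (false = true))
  | succ n ih =>
    have h1 : orB (f n) (anyN n f) = true := h
    rw [orB_eq, Bool.or_eq_true] at h1
    rcases h1 with h1 | h1
    · exact ⟨n, by omega, h1⟩
    · obtain ⟨i, hi, h2⟩ := ih h1
      exact ⟨i, by omega, h2⟩

theorem allN_spec {n f} (h : allN n f = true) : ∀ i < n, f i = true := by
  induction n with
  | zero => intro i hi; omega
  | succ n ih =>
    have h1 : andB (f n) (allN n f) = true := h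
    rw [andB_eq, Bool.and_eq_true] at h1
    intro i hi
    rcases Nat.lt_succ_iff_lt_or_eq.1 hi with h2 | rfl
    · exact ih h1.2 i h2
    · exact h1.1

theorem anyL_spec {α : Type} {l : List α} {f} (h : anyL l f = true) : ∃ a ∈ l, f a = true := by
  induction l with
  | nil => exact absurd h (by decide : ¬ (false = true))
  | cons a l ih =>
    have h1 : orB (f a) (anyL l f) = true := h
    rw [orB_eq, Bool.or_eq_true] at h1
    rcases h1 with h1 | h1
    · exact ⟨a, List.mem_cons_self, h1⟩
    · obtain ⟨i, hi, h2⟩ := ih h1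
      exact ⟨i, List.mem_cons_of_mem _ hi, h2⟩

theorem allL_spec {α : Type} {l : List α} {f} (h : allL l f = true) : ∀ a ∈ l, f a = true := by
  induction l with
  | nil => intro a ha; exact absurd ha (by simp)
  | cons a l ih =>
    have h1 : andB (f a) (allL l f) = true := h
    rw [andB_eq, Bool.and_eq_true] at h1
    intro i hi
    rcases List.mem_cons.1 hi with rfl | h2
    · exact h1.1
    · exact ih h1.2 i h2

/-! skipping of blocks -/

noncomputable def skipL (p Q B f b l : ℕ) : Bool :=
  Nat.rec (fun (_ _ : ℕ) => false) (fun _ ih b l => Bool.rec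
    (orB (andB (Nat.ble (Nat.succ (Nat.add b l)) Q) (Nat.ble (Nat.add b l) B))
      (force (Nat.mod (Nat.mul p b) Q) fun b => force (Nat.mul p l) fun l => ih b l)) false (Nat.ble Q l)) f b l

theorem skipL_spec {p Q B f b l : ℕ} (h : skipL p Q B f b l = true) :
    ∃ i < f, ∃ b', b' ≡ p ^ i * b [MOD Q] ∧ b' + p ^ i * l < Q ∧ b' + p ^ i * l ≤ B := by
  induction f generalizing b l with
  | zero => exact absurd h (by decide : ¬ (false = true))
  | succ f ih =>
    have h1 : Bool.rec (orB (andB (Nat.ble (Nat.succ (b + l)) Q) (Nat.ble (b + l) B))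
      (force ((p * b) % Q) fun b => force (p * l) fun l => skipL p Q B f b l)) false (Nat.ble Q l) = true := h
    cases hq : Nat.ble Q l with
    | true => rw [hq] at h1; exact absurd h1 (by decide : ¬ (false = true))
    | false =>
      rw [hq] at h1
      replace h1 : orB (andB (Nat.ble (Nat.succ (b + l)) Q) (Nat.ble (b + l) B))
        (force ((p * b) % Q) fun b => force (p * l) fun l => skipL p Q B f b l) = true := h1
      simp only [force_eq, orB_eq, andB_eq, Bool.or_eq_true, Bool.and_eq_true, Nat.ble_eq] at h1
      rcases h1 with ⟨h1, h2⟩ | h1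
      · exact ⟨0, by omega, b, by simp; rfl, by simpa using h1, by simpa using h2⟩
      · obtain ⟨i, hi, b', e1, e2, e3⟩ := ih h1
        have e4 : p ^ (i + 1) * l = p ^ i * (p * l) := by rw [pow_succ]; ring
        refine ⟨i + 1, by omega, b', ?_, by rw [e4]; exact e2, by rw [e4]; exact e3⟩
        rw [pow_succ, mul_assoc]
        exact e1.trans ((Nat.mod_modEq _ _).mul_left _)

noncomputable def skipB (p n Q Λ : ℕ) (filt : Bool) (B : ℕ) : Bool :=
  orB (Nat.ble Q B) (andB filt (orB
    (Nat.ble (Nat.succ (Nat.mul (Nat.add 2 (Nat.mul n (Nat.sub p 1))) Q)) (Nat.mul (Nat.mul n B) (Nat.mul 2 (Nat.sub p 1))))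
    (skipL p Q B n B Λ)))

theorem skipB_spec {p n Q M T B t : ℕ} {filt : Bool} (hp : 2 ≤ p) (hQ : Q = p ^ n - 1) (ht : t < T)
    (hM : 0 < M) (h : skipB p n Q (M * T) filt B = true) : ¬ Pk filt p n (B + M * t) := by
  intro hP
  obtain ⟨hG, hk, hmin⟩ := hP
  rw [← hQ] at hk hmin
  simp only [skipB, orB_eq, andB_eq, Bool.or_eq_true, Bool.and_eq_true, Nat.ble_eq] at h
  rcases h with h | ⟨hf, h | h⟩
  · omega
  · replace h : (2 + n * (p - 1)) * Q < (n * B) * (2 * (p - 1)) := h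
    have hJ := hG.J [0]
    rw [← hQ] at hJ
    simp only [List.map_cons, pow_zero, List.map_nil, List.sum_cons, List.sum_nil, add_zero, one_mul, List.length_cons, List.length_nil] at hJ
    have h1 : n * B ≤ ∑ i ∈ Finset.range n, (p ^ i * (B + M * t)) % Q := by
      calc n * B = ∑ i ∈ Finset.range n, B := by simp
        _ ≤ _ := Finset.sum_le_sum (fun i hi => (Nat.le_add_right _ _).trans (hmin hf i (Finset.mem_range.1 hi)))
    have h2 := Nat.mul_le_mul_left (2 * (p - 1)) h1
    have h3 : (n * B) * (2 * (p - 1)) = 2 * (p - 1) * (n * B) := by ring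
    have h4 : 2 * (0 + 1) = 2 := rfl
    rw [h4] at hJ
    omega
  · obtain ⟨i, hi, b', e1, e2, e3⟩ := skipL_spec h
    have h1 := hmin hf i hi
    have h2 : p ^ i * (B + M * t) ≡ b' + p ^ i * (M * t) [MOD Q] := by
      rw [mul_add]; exact e1.symm.add_right _
    have h3 : p ^ i * (M * t) < p ^ i * (M * T) := by
      apply Nat.mul_lt_mul_of_pos_left
      · exact Nat.mul_lt_mul_of_pos_left ht hM
      · positivity
    rw [h2, Nat.mod_eq_of_lt (by omega)] at h1
    omega

/-! scanning for survivors -/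

noncomputable def scan (w M : ℕ) (ok : ℕ → Bool) (L A k : ℕ) : Bool :=
  Nat.rec (fun (A k : ℕ) => Bool.rec (ok k) true (Nat.beq A 0))
    (fun l ih A k => Bool.rec
      (force (Nat.mul w (Nat.pow 2 l)) fun sh => andB
        (force (Nat.land A (Nat.sub (Nat.pow 2 sh) 1)) fun a => ih a k)
        (force (Nat.shiftRight A sh) fun a => force (Nat.add k (Nat.mul M (Nat.pow 2 l))) fun k => ih a k)) true (Nat.beq A 0)) L A k

theorem pack_pos_of {w f T} (h : pack w f T = 0) : ∀ t < T, f t = 0 := by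
  intro t ht
  have := (Finset.sum_eq_zero_iff.1 h) t (Finset.mem_range.2 ht)
  simpa using this

theorem scan_spec {w M : ℕ} {ok : ℕ → Bool} (L : ℕ) : ∀ (a : ℕ → ℕ) (k : ℕ), (∀ t, a t < 2 ^ w) →
    scan w M ok L (pack w a (2 ^ L)) k = true → ∀ t < 2 ^ L, a t ≠ 0 → ok (k + M * t) = true := by
  induction L with
  | zero =>
    intro a k ha h t ht h0
    have : t = 0 := by simpa using ht
    subst this
    have e : pack w a (2 ^ 0) = a 0 := by simp [pack]
    rw [e] at h
    replace h : Bool.rec (ok k) true (Nat.beq (a 0) 0) = true := h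
    have : Nat.beq (a 0) 0 = false := by
      cases hb : Nat.beq (a 0) 0 with
      | true => exact absurd (Nat.eq_of_beq_eq_true hb) h0
      | false => rfl
    rw [this] at h
    simpa using h
  | succ l ih =>
    intro a k ha h t ht h0
    have h1 : Bool.rec (force (w * 2 ^ l) fun sh => andB
        (force ((pack w a (2 ^ (l + 1))) &&& (2 ^ sh - 1)) fun a => scan w M ok l a k)
        (force ((pack w a (2 ^ (l + 1))) >>> sh) fun a => force (k + M * 2 ^ l) fun k => scan w M ok l a k)) true
        (Nat.beq (pack w a (2 ^ (l + 1))) 0) = true := h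
    cases hb : Nat.beq (pack w a (2 ^ (l + 1))) 0 with
    | true => exact absurd (pack_pos_of (Nat.eq_of_beq_eq_true hb) t ht) h0
    | false =>
      rw [hb] at h1
      replace h1 : (force (w * 2 ^ l) fun sh => andB
        (force ((pack w a (2 ^ (l + 1))) &&& (2 ^ sh - 1)) fun a => scan w M ok l a k)
        (force ((pack w a (2 ^ (l + 1))) >>> sh) fun a => force (k + M * 2 ^ l) fun k => scan w M ok l a k)) = true := h1
      simp only [force_eq, andB_eq, Bool.and_eq_true] at h1
      have hsp : pack w a (2 ^ (l + 1)) = pack w a (2 ^ l) + 2 ^ (w * 2 ^ l) * pack w (fun t => a (t + 2 ^ l)) (2 ^ l) := by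
        rw [pack_append, pow_succ, mul_two]
        apply pack_congr
        intro t _
        split_ifs with h
        · rfl
        · rw [Nat.sub_add_cancel (by omega)]
      have hlt : pack w a (2 ^ l) < 2 ^ (w * 2 ^ l) := pack_lt ha
      rw [hsp, land_low, Nat.add_mul_mod_self_left, Nat.mod_eq_of_lt hlt, Nat.shiftRight_eq_div_pow,
        Nat.add_mul_div_left _ _ (by positivity), Nat.div_eq_of_lt hlt, zero_add] at h1
      by_cases htl : t < 2 ^ l
      · exact ih a k ha h1.1 t htl h0
      · have := ih _ _ (fun t => ha _) h1.2 (t - 2 ^ l) (by rw [pow_succ] at ht; omega) (by rwa [Nat.sub_add_cancel (by omega)])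
        convert this using 2
        rw [add_assoc, ← mul_add]; congr 2; omega

/-- the same with the position stored in the low bits, which keeps the hash values of the literals distinct -/
noncomputable def scanT (V W w M : ℕ) (ok : ℕ → Bool) (L X k : ℕ) : Bool :=
  Nat.rec (fun (X k : ℕ) => Bool.rec true (ok k) (Nat.ble W X))
    (fun l ih X k => Bool.rec true
      (force (Nat.add V (Nat.mul w (Nat.pow 2 l))) fun sh => andB
        (force (Nat.land X (Nat.sub (Nat.pow 2 sh) 1)) fun a => ih a k)
        (force (Nat.add k (Nat.mul M (Nat.pow 2 l))) fun k =>
          force (Nat.add (Nat.mul (Nat.shiftRight X sh) W) k) fun a => ih a k)) (Nat.ble W X)) L X k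

theorem ble_tag {W A k : ℕ} (hk : k < W) : Nat.ble W (A * W + k) = !(Nat.beq A 0) := by
  cases A with
  | zero =>
    rw [zero_mul, zero_add]
    rw [Bool.eq_iff_iff, Nat.ble_eq]
    have : Nat.beq 0 0 = true := rfl
    rw [this]
    simp only [Bool.not_true, Bool.false_eq_true, iff_false]
    omega
  | succ A =>
    rw [Bool.eq_iff_iff, Nat.ble_eq]
    have : Nat.beq (A + 1) 0 = false := rfl
    rw [this, Nat.succ_mul]
    simp only [Bool.not_false, iff_true]
    omega

theorem scanT_eq {V W w M : ℕ} {ok : ℕ → Bool} (hW : W = 2 ^ V) (L : ℕ) : ∀ A k, k + M * 2 ^ L ≤ W → k < W →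
    scanT V W w M ok L (A * W + k) k = scan w M ok L A k := by
  have hW0 : 0 < W := by rw [hW]; positivity
  induction L with
  | zero =>
    intro A k _ hk
    show @Bool.rec (fun _ => Bool) true (ok k) (Nat.ble W (A * W + k)) = @Bool.rec (fun _ => Bool) (ok k) true (Nat.beq A 0)
    rw [ble_tag hk]
    cases Nat.beq A 0 <;> rfl
  | succ l ih =>
    intro A k hb hk
    show @Bool.rec (fun _ => Bool) true
      (force (V + w * 2 ^ l) fun sh => andB
        (force ((A * W + k) &&& (2 ^ sh - 1)) fun a => scanT V W w M ok l a k)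
        (force (k + M * 2 ^ l) fun k' =>
          force (((A * W + k) >>> sh) * W + k') fun a => scanT V W w M ok l a k')) (Nat.ble W (A * W + k))
      = @Bool.rec (fun _ => Bool)
      (force (w * 2 ^ l) fun sh => andB
        (force (A &&& (2 ^ sh - 1)) fun a => scan w M ok l a k)
        (force (A >>> sh) fun a => force (k + M * 2 ^ l) fun k => scan w M ok l a k)) true (Nat.beq A 0)
    rw [ble_tag hk]
    simp only [force_eq]
    have hMM : M * 2 ^ (l + 1) = M * 2 ^ l + M * 2 ^ l := by rw [pow_succ]; ring
    have e1 : (A * W + k) &&& (2 ^ (V + w * 2 ^ l) - 1) = (A &&& (2 ^ (w * 2 ^ l) - 1)) * W + k := by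
      rw [land_low, land_low, pow_add, ← hW, Nat.mod_mul, mul_comm A, Nat.mul_add_mod, Nat.mod_eq_of_lt hk,
        Nat.mul_add_div hW0, Nat.div_eq_of_lt hk, add_zero, add_comm, mul_comm]
    have e2 : (A * W + k) >>> (V + w * 2 ^ l) = A >>> (w * 2 ^ l) := by
      rw [Nat.shiftRight_eq_div_pow, Nat.shiftRight_eq_div_pow, pow_add, ← hW, ← Nat.div_div_eq_div_mul, mul_comm A,
        Nat.mul_add_div hW0, Nat.div_eq_of_lt hk, add_zero]
    by_cases hA : Nat.beq A 0 = true
    · rw [hA]; rfl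
    · rw [Bool.not_eq_true] at hA
      rw [hA]
      show andB _ _ = andB _ _
      rw [e1, e2, ih _ _ (by omega) hk]
      by_cases hM : M * 2 ^ l = 0
      · rw [hM, add_zero, ih _ _ (by omega) hk]
      · rw [ih _ _ (by omega) (by omega)]

/-! individual tests -/

noncomputable def dsF (p f j : ℕ) : ℕ :=
  Nat.rec (fun _ => 0) (fun _ ih j => Nat.add (Nat.mod j p) (force (Nat.div j p) ih)) f j

theorem dsF_spec (p : ℕ) (hp : 0 < p) (f : ℕ) : ∀ j, j < p ^ f → ∃ bs : List ℕ, (bs.map (fun b => p ^ b)).sum = j ∧ bs.length = dsF p f j := by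
  induction f with
  | zero => intro j hj; exact ⟨[], by simp at hj; simp [hj], rfl⟩
  | succ f ih =>
    intro j hj
    obtain ⟨bs, h1, h2⟩ := ih (j / p) (Nat.div_lt_of_lt_mul (by rw [← pow_succ']; exact hj))
    refine ⟨List.replicate (j % p) 0 ++ bs.map Nat.succ, ?_, ?_⟩
    · have e : ((fun b => p ^ b) ∘ Nat.succ) = fun b => p * p ^ b := by funext b; simp [pow_succ, mul_comm]
      rw [List.map_append, List.sum_append, List.map_map, e, List.sum_map_mul_left, h1]
      simp [Nat.mod_add_div]
    · have : dsF p (f + 1) j = j % p + force (j / p) (dsF p f) := rfl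
      rw [this, force_eq, ← h2]; simp

noncomputable def sumP (p n : ℕ) : ℕ := Nat.rec 0 (fun i ih => Nat.add (Nat.pow p i) ih) n
noncomputable def PPc (p n : ℕ) : ℕ := Nat.rec 0 (fun i ih => Nat.add (Nat.mul (Nat.pow 2 (Nat.mul 72 i)) (Nat.pow p i)) ih) n
noncomputable def MKc (n : ℕ) : ℕ := Nat.rec 0 (fun i ih => Nat.add (Nat.mul (Nat.pow 2 (Nat.mul 72 i)) 1099511627775) ih) n

theorem sumP_eq (p n) : sumP p n = ∑ i ∈ Finset.range n, p ^ i := by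
  induction n with
  | zero => rfl
  | succ n ih => rw [Finset.sum_range_succ, ← ih, add_comm (sumP p n)]; rfl
theorem PPc_eq (p n) : PPc p n = pack 72 (fun i => p ^ i) n := by
  induction n with
  | zero => rfl
  | succ n ih => rw [pack_succ, ← ih]; rfl
theorem MKc_eq (n) : MKc n = pack 72 (fun _ => 2 ^ 40 - 1) n := by
  induction n with
  | zero => rfl
  | succ n ih => rw [pack_succ, ← ih]; rfl

noncomputable def spprep {α : Type} (p n : ℕ) (js : List ℕ) (k : List (ℕ × ℕ) → α) : α :=
  List.rec (fun (k : List (ℕ × ℕ) → α) => k []) (fun j _ ih k =>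
    Bool.rec (ih k)
      (force (Nat.add (Nat.div (Nat.mul 1099511627776 (Nat.add (Nat.mul 2 (dsF p n j)) (Nat.mul n (Nat.sub p 1)))) (Nat.mul 2 (Nat.sub p 1)))
         (Nat.succ (sumP p n))) fun th => ih fun l => k ((j, th) :: l)) (Nat.ble (Nat.succ j) (Nat.pow p n))) js k

def SOK (p n : ℕ) (e : ℕ × ℕ) : Prop :=
  e.1 < p ^ n ∧ e.2 = (2 ^ 40 * (2 * dsF p n e.1 + n * (p - 1))) / (2 * (p - 1)) + ((∑ i ∈ Finset.range n, p ^ i) + 1)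

theorem spprep_spec (p n : ℕ) (js : List ℕ) :
    ∃ l : List (ℕ × ℕ), (∀ e ∈ l, SOK p n e) ∧ ∀ (α : Type) (k : List (ℕ × ℕ) → α), spprep p n js k = k l := by
  induction js with
  | nil => exact ⟨[], by simp, fun _ _ => rfl⟩
  | cons j js ih =>
    obtain ⟨l, hl, hk⟩ := ih
    have h1 : ∀ (α : Type) (k : List (ℕ × ℕ) → α), spprep p n (j :: js) k = Bool.rec (spprep p n js k)
      (force ((2 ^ 40 * (2 * dsF p n j + n * (p - 1))) / (2 * (p - 1)) + (sumP p n + 1)) fun th => spprep p n js fun l => k ((j, th) :: l))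
      (Nat.ble (Nat.succ j) (p ^ n)) := fun _ _ => rfl
    cases hb : Nat.ble (Nat.succ j) (p ^ n) with
    | false =>
      refine ⟨l, hl, fun α k => ?_⟩
      rw [h1, hb]
      exact hk α k
    | true =>
      refine ⟨(j, (2 ^ 40 * (2 * dsF p n j + n * (p - 1))) / (2 * (p - 1)) + (sumP p n + 1)) :: l, ?_, fun α k => ?_⟩
      · intro e he
        rcases List.mem_cons.1 he with rfl | he
        · exact ⟨Nat.le_of_ble_eq_true hb, by rw [sumP_eq]⟩
        · exact hl e he
      · rw [h1, hb]
        show force _ _ = _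
        rw [force_eq, hk]

noncomputable def killB (Q PP MK : ℕ) (e : ℕ × ℕ) (k : ℕ) : Bool :=
  Nat.ble e.2 (Nat.mod (Nat.land (Nat.mul PP (cdiv 40 (Nat.mod (Nat.mul e.1 k) Q) Q)) MK) 4722366482869645213695)

theorem Near.mul {Q r E m x} (c : ℕ) (h : Near Q r E m x) : Near Q r (c * E) (c * m) (c * x) := by
  obtain ⟨e, he, h1⟩ := h
  refine ⟨c * e, by rw [mul_assoc]; exact Nat.mul_le_mul_left c he, ?_⟩
  have := h1.mul_left c
  convert this using 1 <;> ring

theorem pack_mod (w f T) : pack w f T ≡ ∑ t ∈ Finset.range T, f t [MOD 2 ^ w - 1] := by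
  unfold pack
  induction T with
  | zero => exact Nat.ModEq.refl _
  | succ T ih =>
    rw [Finset.sum_range_succ, Finset.sum_range_succ]
    refine ih.add ?_
    have h : 2 ^ w ≡ 1 [MOD 2 ^ w - 1] := (Nat.modEq_iff_dvd' Nat.one_le_two_pow).2 (dvd_refl _) |>.symm
    rw [pow_mul]
    simpa using (h.pow T).mul_left (f T)

theorem killB_spec {p n Q k : ℕ} {e : ℕ × ℕ} (hp : 2 ≤ p) (hQ : Q = p ^ n - 1) (hQ0 : 0 < Q) (hb : p ^ n ≤ 2 ^ 30)
    (he : SOK p n e) (h : killB Q (PPc p n) (MKc n) e k = true) : ¬ Good p n k := by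
  intro hG
  obtain ⟨bs, h1, h2⟩ := dsF_spec p (by omega) n e.1 he.1
  set m := (e.1 * k) % Q with hm
  set x := cdiv 40 m Q with hx
  have hmQ : m < Q := Nat.mod_lt _ hQ0
  have hx1 : x ≤ 2 ^ 40 := cdiv_le hmQ
  have hN : Near Q 40 1 (e.1 * k) x := (near_ceil hQ0 (m := m)).congr (Nat.mod_modEq _ _)
  have hY : e.2 ≤ ((PPc p n * x) &&& MKc n) % (2 ^ 72 - 1) := Nat.le_of_ble_eq_true h
  have hpk : PPc p n * x = pack 72 (fun t => if t < n then p ^ t * x else 0) n := by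
    rw [PPc_eq, pack_mul]; exact pack_congr (fun t ht => by rw [if_pos ht])
  have hbd : ∀ t < n, p ^ t * x < 2 ^ 72 := by
    intro t ht
    calc p ^ t * x ≤ 2 ^ 30 * 2 ^ 40 := Nat.mul_le_mul ((Nat.pow_le_pow_right (by omega) ht.le).trans hb) hx1
      _ < 2 ^ 72 := by norm_num
  rw [hpk, MKc_eq, pack_land (fun t => by split_ifs with h; exact hbd t h; positivity) (fun _ => by norm_num),
    pack_congr (g := fun t => (p ^ t * x) % 2 ^ 40) (fun t ht => by rw [if_pos ht, land_low]), pack_mod] at hY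
  have hY2 := hY.trans (Nat.mod_le _ _)
  have hkey : Q * (∑ t ∈ Finset.range n, (p ^ t * x) % 2 ^ 40) ≤
      2 ^ 40 * (∑ i ∈ Finset.range n, (p ^ i * ((bs.map (fun b => p ^ b)).sum * k)) % Q) + (∑ i ∈ Finset.range n, p ^ i) * Q := by
    rw [Finset.mul_sum, Finset.mul_sum, Finset.sum_mul, ← Finset.sum_add_distrib]
    apply Finset.sum_le_sum
    intro i _
    have := (hN.mul (p ^ i)).mod.final (Nat.mod_lt _ (by positivity))
    rw [h1]
    simpa using this
  have := J_kill0 bs hp hQ hQ0 hG h2 _ hkey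
  have := he.2
  omega

noncomputable def nonmin (p n Q k : ℕ) : Bool := anyN n fun i => Nat.ble (Nat.succ (Nat.mod (Nat.mul (Nat.pow p i) k) Q)) k

noncomputable def knownB (p n Q k : ℕ) : Bool :=
  anyN n fun a => anyN n fun i => orB
    (andB (Nat.beq (Nat.mod (Nat.div n (Nat.gcd i n)) 2) 1) (Nat.beq (Nat.mod k Q) (Nat.mod (Nat.mul (Nat.pow p a) (Nat.succ (Nat.pow p i))) Q)))
    (andB (Nat.beq p 3) (andB (Nat.beq (Nat.gcd i (Nat.mul 2 n)) 1)
      (Nat.beq (Nat.mod k Q) (Nat.mod (Nat.mul (Nat.pow 3 a) (Nat.div (Nat.succ (Nat.pow 3 i)) 2)) Q))))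

theorem knownB_spec {p n k : ℕ} (h : knownB p n (p ^ n - 1) k = true) : Known p n k := by
  obtain ⟨a, ha, h⟩ := anyN_spec h
  obtain ⟨i, hi, h⟩ := anyN_spec h
  refine ⟨a, ha, ?_⟩
  simp only [orB_eq, andB_eq, Bool.or_eq_true, Bool.and_eq_true] at h
  rcases h with ⟨h1, h2⟩ | ⟨h0, h1, h2⟩
  · exact Or.inl ⟨i, hi, Nat.odd_iff.2 (Nat.eq_of_beq_eq_true h1), Nat.eq_of_beq_eq_true h2⟩
  · have := Nat.eq_of_beq_eq_true h0
    subst this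
    exact Or.inr ⟨rfl, i, hi, Nat.eq_of_beq_eq_true h1, Nat.eq_of_beq_eq_true h2⟩

noncomputable def sumB (p : ℕ) (bs : List ℕ) : ℕ := List.rec 0 (fun b _ ih => Nat.add (Nat.pow p b) ih) bs
theorem sumB_eq (p bs) : sumB p bs = (bs.map (fun b => p ^ b)).sum := by
  induction bs with
  | nil => rfl
  | cons b bs ih => rw [List.map_cons, List.sum_cons, ← ih]; rfl

noncomputable def hermE (p n k e : ℕ) (bs : List ℕ) : Bool :=
  andB (Nat.ble 1 e) (andB (Nat.beq (Nat.mod n e) 0) (force (sumB p bs) fun s => andB (Nat.ble 1 s)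
    (andB (Nat.ble (Nat.succ s) (Nat.sub (Nat.pow p e) 1)) (Nat.ble 1 (Nat.mod (HT p e k bs 0 0) p)))))

/-- the head of the list is the degree of the subfield in which the power sum is taken -/
noncomputable def hermB (p n k : ℕ) (l : List ℕ) : Bool := List.rec false (fun e bs _ => hermE p n k e bs) l

theorem hermB_spec {p n k : ℕ} {l : List ℕ} (h : hermB p n k l = true) : ¬ Good p n k := by
  intro hG
  cases l with
  | nil => exact absurd h (by decide : ¬ (false = true))
  | cons e bs =>
    replace h : hermE p n k e bs = true := h
    simp only [hermE, force_eq, andB_eq, Bool.and_eq_true, Nat.ble_eq, sumB_eq] at h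
    obtain ⟨he, hd, h1, h2, h3⟩ := h
    have h0 : bs ≠ [] := by rintro rfl; simp at h1
    have hd' : n % e = 0 := Nat.eq_of_beq_eq_true hd
    have h2' : (bs.map (fun b => p ^ b)).sum < p ^ e - 1 := h2
    have h3' : 1 ≤ HT p e k bs 0 0 % p := h3
    rw [Nat.mod_eq_zero_of_dvd (hG.H e (Nat.dvd_of_mod_eq_zero hd') (by omega) bs h0 h2')] at h3'
    omega

noncomputable def okB (p n Q PP MK : ℕ) (filt : Bool) (sp : List (ℕ × ℕ)) (hs : List (List ℕ)) (k : ℕ) : Bool :=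
  orB (Nat.ble Q k) (Bool.rec true
    (orB (anyL sp fun e => killB Q PP MK e k)
      (orB (andB filt (nonmin p n Q k)) (orB (knownB p n Q k) (anyL hs (hermB p n k))))) (Nat.beq (Nat.gcd k Q) 2))

theorem okB_spec {p n Q k : ℕ} {filt : Bool} {sp : List (ℕ × ℕ)} {hs : List (List ℕ)} (hp : 2 ≤ p) (hQ : Q = p ^ n - 1)
    (hQ0 : 0 < Q) (hb : p ^ n ≤ 2 ^ 30) (hsp : ∀ e ∈ sp, SOK p n e) (h : okB p n Q (PPc p n) (MKc n) filt sp hs k = true)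
    (hP : Pk filt p n k) : Known p n k := by
  obtain ⟨hG, hk, hmin⟩ := hP
  have hg : Nat.beq (Nat.gcd k Q) 2 = true := by rw [hQ, hG.gcd]; rfl
  unfold okB at h
  rw [hg] at h
  simp only [orB_eq, andB_eq, Bool.or_eq_true, Bool.and_eq_true, Nat.ble_eq] at h
  rcases h with h | h | ⟨hf, h⟩ | h | h
  · omega
  · obtain ⟨e, he, h⟩ := anyL_spec h
    exact absurd hG (killB_spec hp hQ hQ0 hb (hsp e he) h)
  · obtain ⟨i, hi, h⟩ := anyN_spec h
    have h1 : (p ^ i * k) % Q < k := Nat.le_of_ble_eq_true h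
    have := hmin hf i hi
    rw [← hQ] at this
    omega
  · rw [hQ] at h; exact knownB_spec h
  · obtain ⟨bs, _, h⟩ := anyL_spec h
    exact absurd hG (hermB_spec h)

end PM

namespace PM

noncomputable def survA (w low high c4 c3 : ℕ) (filt : Bool) (jsp : List (List ℕ × ℕ)) (R : List ℕ) : ℕ :=
  Nat.sub high (Nat.land (Nat.lor (jdead low R (appL R R) jsp)
    (Bool.rec 0 (force (Nat.add (headL R) c4) fun D => neck D c3 R) filt)) high)

theorem survA_spec {p n w r Q L M B o low high c4 c3 : ℕ} {filt : Bool} {R : List ℕ} {jsp : List (List ℕ × ℕ)}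
    (hp : 2 ≤ p) (hn : 0 < n) (hQ : Q = p ^ n - 1) (hQ0 : 0 < Q) (ho : ∀ c, o * c = pack w (fun _ => c) (2 ^ L))
    (hlow : low = pack w (fun _ => 2 ^ r - 1) (2 ^ L)) (hhigh : high = o * 2 ^ (w - 1)) (h4 : c4 = o * (2 ^ (w - 1) - 4))
    (h3 : c3 = o * (2 ^ (w - 1) - 3)) (hr : 2 ≤ r) (hw : r + 2 ≤ w)
    (hR : RL p w r Q (2 ^ L) (2 ^ r - 1) 3 (fun t => M * t + B) R) (hlen : R.length = n)
    (hjs : ∀ e ∈ jsp, JOK p n r w o e) :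
    ∃ a, survA w low high c4 c3 filt jsp R = pack w a (2 ^ L) ∧ (∀ t, a t < 2 ^ w) ∧
      ∀ t < 2 ^ L, a t = 0 → ¬ Pk filt p n (B + M * t) := by
  have hneck : Dead w (2 ^ L) (fun t => Pk filt p n (B + M * t))
      (Bool.rec 0 (force (Nat.add (headL R) c4) fun D => neck D c3 R) filt) := by
    cases hf : filt with
    | false => exact Dead.zero _ _ _
    | true =>
      cases R with
      | nil => simp at hlen; omega
      | cons a Rs =>
        show Dead w _ _ (force (a + c4) fun D => neck D c3 (a :: Rs))
        rw [force_eq]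
        obtain ⟨f, hf1, hf2, hf3⟩ := hR.1
        refine neck_dead (d0 := f) hQ hQ0 ho hr hw rfl ?_ hf2 hf3 h3 (a :: Rs) 0 (by omega) ?_
        · rw [hf1, h4, ho, pack_add]
        · simpa using hR
  have hD := (jdead_dead (filt := filt) hp hQ hQ0 ho hlow hw hR hlen jsp hjs).lor hneck
  obtain ⟨d, e1, e2, e3⟩ := hD
  have hw1 : 2 ^ w = 2 ^ (w - 1) * 2 := by rw [← pow_succ]; congr 1; omega
  have hpos : 0 < 2 ^ (w - 1) := by positivity
  have hh : ∀ t : ℕ, (fun _ => 2 ^ (w - 1) : ℕ → ℕ) t < 2 ^ w := fun t => by show 2 ^ (w - 1) < _; omega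
  refine ⟨fun t => 2 ^ (w - 1) - (d t &&& 2 ^ (w - 1)), ?_, fun t => by show _ - _ < _; omega, fun t ht h0 => ?_⟩
  · show high - ((jdead low R (appL R R) jsp ||| _) &&& high) = _
    rw [e1, hhigh, ho, pack_land e2 hh, pack_sub]
    intro t; exact Nat.and_le_right
  · apply e3 t ht
    have h0' : 2 ^ (w - 1) - (d t &&& 2 ^ (w - 1)) = 0 := h0
    exact (Nat.sub_eq_zero_iff_le.1 h0').trans Nat.and_le_left

noncomputable def runB (V W p n r w Q L M T : ℕ) (filt : Bool) (o low high c4 c3 : ℕ) (jsp : List (List ℕ × ℕ)) (Ps : List ℕ)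
    (ok : ℕ → Bool) (c lo cnt : ℕ) : Bool :=
  Nat.rec (fun _ => true) (fun _ ih s => force (Nat.add c (Nat.mul M (Nat.mul s T))) fun B =>
    andB (orB (skipB p n Q (Nat.mul M T) filt B)
      (mkR r Q p o low Ps B fun R => force (survA w low high c4 c3 filt jsp R) fun A =>
        force (Nat.add (Nat.mul A W) B) fun X => scanT V W w M ok L X B))
      (force (Nat.succ s) ih)) cnt lo

def Cov (p n d L : ℕ) (filt : Bool) (c lo cnt : ℕ) : Prop :=
  ∀ s, lo ≤ s → s < lo + cnt → ∀ t < 2 ^ L, Pk filt p n (c + (p ^ d - 1) * (s * 2 ^ L) + (p ^ d - 1) * t) →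
    Known p n (c + (p ^ d - 1) * (s * 2 ^ L) + (p ^ d - 1) * t)

noncomputable def setup (p n d L r w g : ℕ) (filt : Bool) (js : List (List ℕ)) (sp : List ℕ) (hs : List (List ℕ))
    (k : (ℕ → ℕ → ℕ → Bool) → Bool) : Bool :=
  andB (Nat.ble 2 p) (andB (Nat.ble 1 n) (andB (Nat.ble 1 d) (andB (Nat.ble L 32) (andB (Nat.ble d n) (andB (Nat.ble (Nat.pow p n) 1073741824) (andB (Nat.ble 2 r)
    (andB (Nat.ble (Nat.add (Nat.add r g) 2) w) (andB (Nat.ble L (Nat.pow 2 g))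
  (force (Nat.sub (Nat.pow p n) 1) fun Q => force (Nat.sub (Nat.pow p d) 1) fun M => force (Nat.pow 2 L) fun T =>
   force (ones w L) fun o => force (Nat.mul o (Nat.sub (Nat.pow 2 r) 1)) fun low =>
   force (Nat.mul o (Nat.pow 2 (Nat.sub w 1))) fun high => force (Nat.mul o (Nat.sub (Nat.pow 2 (Nat.sub w 1)) 4)) fun c4 =>
   force (Nat.mul o (Nat.sub (Nat.pow 2 (Nat.sub w 1)) 3)) fun c3 =>
   force (PPc p n) fun PP => force (MKc n) fun MK =>
   buildAll w r g Q p o L n M fun Ps => jprep p n r w o js fun jsp => spprep p n sp fun spp =>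
   force (Nat.pow 2 64) fun W => k (runB 64 W p n r w Q L M T filt o low high c4 c3 jsp Ps (okB p n Q PP MK filt spp hs)))))))))))

theorem setup_spec {p n d L r w g : ℕ} {filt : Bool} {js : List (List ℕ)} {sp : List ℕ} {hs : List (List ℕ)}
    {k : (ℕ → ℕ → ℕ → Bool) → Bool} (h : setup p n d L r w g filt js sp hs k = true) :
    ∃ rn, k rn = true ∧ ∀ c lo cnt, rn c lo cnt = true → Cov p n d L filt c lo cnt := by
  obtain ⟨jsp, hjsp, hj⟩ := jprep_spec p n r w (ones w L) js
  obtain ⟨spp, hspp, hs'⟩ := spprep_spec p n sp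
  simp only [setup, force_eq, andB_eq, Bool.and_eq_true, Nat.ble_eq, buildAll_eq, hj, hs'] at h
  obtain ⟨hp, hn, hd, hL32, hdn, hb, hr, hw, hL, h⟩ := h
  refine ⟨_, h, ?_⟩
  intro c lo cnt
  replace hb : p ^ n ≤ 2 ^ 30 := hb
  generalize hW : Nat.pow 2 64 = W
  replace hW : W = 2 ^ 64 := hW.symm
  generalize hV : 64 = V at hW ⊢
  replace hw : r + g + 2 ≤ w := hw
  replace hL : L ≤ 2 ^ g := hL
  generalize hQ : Nat.sub (Nat.pow p n) 1 = Q
  replace hQ : Q = p ^ n - 1 := hQ.symm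
  have hQ0 : 0 < Q := by
    have : p ^ 1 ≤ p ^ n := Nat.pow_le_pow_right (by omega) hn
    rw [pow_one] at this
    omega
  have hM0 : 0 < p ^ d - 1 := by
    have : p ^ 1 ≤ p ^ d := Nat.pow_le_pow_right (by omega) hd
    rw [pow_one] at this
    omega
  induction cnt generalizing lo with
  | zero => intro _ s h1 h2; omega
  | succ cnt ih =>
    intro hr1
    generalize hPs : buildL w r g Q p (ones w L) L n (Nat.sub (Nat.pow p d) 1) = Ps at *
    have hr2 : (force (c + (p ^ d - 1) * (lo * 2 ^ L)) fun B =>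
      andB (orB (skipB p n Q ((p ^ d - 1) * 2 ^ L) filt B)
      (mkR r Q p (ones w L) (ones w L * (2 ^ r - 1)) Ps B fun R => force (survA w (ones w L * (2 ^ r - 1)) (ones w L * 2 ^ (w - 1))
        (ones w L * (2 ^ (w - 1) - 4)) (ones w L * (2 ^ (w - 1) - 3)) filt jsp R) fun A =>
          force (A * W + B) fun X => scanT V W w (p ^ d - 1) (okB p n Q (PPc p n) (MKc n) filt spp hs) L X B))
      (force (Nat.succ lo) (runB V W p n r w Q L (p ^ d - 1) (2 ^ L) filt (ones w L) (ones w L * (2 ^ r - 1)) (ones w L * 2 ^ (w - 1))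
        (ones w L * (2 ^ (w - 1) - 4)) (ones w L * (2 ^ (w - 1) - 3)) jsp Ps (okB p n Q (PPc p n) (MKc n) filt spp hs) c · cnt))) = true := hr1
    simp only [force_eq, andB_eq, orB_eq, mkR_eq, Bool.and_eq_true, Bool.or_eq_true] at hr2
    intro s h1 h2 t ht hP
    by_cases hs : s = lo
    · subst hs
      generalize hB : c + (p ^ d - 1) * (s * 2 ^ L) = B at *
      rcases hr2.1 with hr3 | hr3
      · exact absurd hP (skipB_spec hp hQ ht hM0 hr3)
      · have hBQ : B < Q := by have := hP.2.1; rw [← hQ] at this; omega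
        have hPr : RL p w r Q (2 ^ L) (2 ^ r) 2 (fun t => (p ^ d - 1) * t) Ps := by
          rw [← hPs]; exact buildL_rep hQ0 (ones_mul w L) hw hL n _
        have hRr := mkRL_rep hQ0 (ones_mul w L) (ones_mul w L (2 ^ r - 1)) le_rfl (by omega) Ps B B _ hBQ rfl hPr
        have hlen : (mkRL r Q p (ones w L) (ones w L * (2 ^ r - 1)) Ps B).length = n := by
          rw [mkRL_length, ← hPs, buildL_length]
        obtain ⟨a, e1, e2, e3⟩ := survA_spec (filt := filt) hp hn hQ hQ0 (ones_mul w L) (ones_mul w L (2 ^ r - 1)) rfl rfl rfl hr (by omega) hRr hlen hjsp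
        have hMb : p ^ d - 1 ≤ 2 ^ 30 := by
          have : p ^ d ≤ p ^ n := Nat.pow_le_pow_right (by omega) hdn
          omega
        have hLb : (p ^ d - 1) * 2 ^ L ≤ 2 ^ 30 * 2 ^ 32 := Nat.mul_le_mul hMb (Nat.pow_le_pow_right (by omega) hL32)
        rw [scanT_eq hW L _ _ (by rw [hW, ← hV]; omega) (by rw [hW, ← hV]; omega), e1] at hr3
        have := scan_spec L a B e2 hr3 t ht (fun h0 => e3 t ht h0 hP)
        exact okB_spec hp hQ hQ0 hb hspp this hP
    · exact ih (lo + 1) hr2.2 s (by omega) (by omega) t ht hP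

theorem Cov.append {p n d L : ℕ} {filt : Bool} {c lo a b : ℕ} (h1 : Cov p n d L filt c lo a) (h2 : Cov p n d L filt c (lo + a) b) :
    Cov p n d L filt c lo (a + b) := by
  intro s hs1 hs2
  by_cases h : s < lo + a
  · exact h1 s hs1 h
  · exact h2 s (by omega) (by omega)

theorem Cov.eng {p n d L : ℕ} {filt : Bool} {c S : ℕ} (h : Cov p n d L filt c 0 S) (hS : p ^ n - 1 ≤ (p ^ d - 1) * 2 ^ L * S) :
    Eng p n d filt c := by
  intro k hk hG hc hmin
  have h1 := Nat.div_add_mod k (p ^ d - 1)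
  rw [hc] at h1
  have h2 := Nat.div_add_mod (k / (p ^ d - 1)) (2 ^ L)
  have h3 : k / (p ^ d - 1) / 2 ^ L < S := by
    rw [Nat.div_div_eq_div_mul]
    exact Nat.div_lt_of_lt_mul (by omega)
  have e : c + (p ^ d - 1) * (k / (p ^ d - 1) / 2 ^ L * 2 ^ L) + (p ^ d - 1) * ((k / (p ^ d - 1)) % 2 ^ L) = k := by
    rw [add_assoc, ← mul_add, mul_comm _ (2 ^ L), h2]
    omega
  have := h (k / (p ^ d - 1) / 2 ^ L) (Nat.zero_le _) (by omega) ((k / (p ^ d - 1)) % 2 ^ L) (Nat.mod_lt _ (by positivity))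
  rw [e] at this
  exact this ⟨hG, hk, hmin⟩

/-- prime case, part of the range -/
noncomputable def chkR (p n L r w g : ℕ) (js : List (List ℕ)) (sp : List ℕ) (hs : List (List ℕ)) (lo cnt : ℕ) : Bool :=
  setup p n 1 L r w g true js sp hs fun rn => rn (Nat.mod 2 (Nat.sub p 1)) lo cnt

theorem chkR_spec {p n L r w g js sp hs lo cnt} (h : chkR p n L r w g js sp hs lo cnt = true) :
    Cov p n 1 L true (2 % (p - 1)) lo cnt := by
  obtain ⟨rn, h1, h2⟩ := setup_spec h
  exact h2 _ _ _ h1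

/-- prime case, full range -/
noncomputable def chkP (n L r w g : ℕ) (js : List (List ℕ)) (sp : List ℕ) (hs : List (List ℕ)) (p : ℕ) : Bool :=
  force (Nat.succ (Nat.div (Nat.sub (Nat.pow p n) 1) (Nat.mul (Nat.sub p 1) (Nat.pow 2 L)))) fun S =>
    andB (Nat.ble (Nat.sub (Nat.pow p n) 1) (Nat.mul (Nat.mul (Nat.sub p 1) (Nat.pow 2 L)) S)) (chkR p n L r w g js sp hs 0 S)

theorem chkP_spec {p n L r w g js sp hs} (h : chkP n L r w g js sp hs p = true) : Eng p n 1 true (2 % (p - 1)) := by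
  simp only [chkP, force_eq, andB_eq, Bool.and_eq_true, Nat.ble_eq] at h
  exact (chkR_spec h.2).eng (by simpa using h.1)

/-- composite case -/
noncomputable def chkC (n d L r w g : ℕ) (js : List (List ℕ)) (sp : List ℕ) (hs : List (List ℕ)) (p : ℕ) : Bool :=
  force (Nat.succ (Nat.div (Nat.sub (Nat.pow p n) 1) (Nat.mul (Nat.sub (Nat.pow p d) 1) (Nat.pow 2 L)))) fun S =>
    andB (Nat.ble (Nat.sub (Nat.pow p n) 1) (Nat.mul (Nat.mul (Nat.sub (Nat.pow p d) 1) (Nat.pow 2 L)) S))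
      (setup p n d L r w g false js sp hs fun rn => allN d fun i =>
        andB (Bool.rec true (force (Nat.mod (Nat.succ (Nat.pow p i)) (Nat.sub (Nat.pow p d) 1)) fun c => rn c 0 S)
            (andB (Nat.ble (Nat.mul 2 i) d) (Nat.beq (Nat.mod (Nat.div d (Nat.gcd i d)) 2) 1)))
          (Bool.rec true (force (Nat.mod (Nat.div (Nat.succ (Nat.pow 3 i)) 2) (Nat.sub (Nat.pow 3 d) 1)) fun c => rn c 0 S)
            (andB (Nat.ble 2 i) (andB (Nat.beq p 3) (Nat.beq (Nat.gcd i (Nat.mul 2 d)) 1)))))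

theorem beq_true {a b : ℕ} (h : a = b) : Nat.beq a b = true := by subst h; exact Nat.beq_refl a

theorem ble_true {a b : ℕ} (h : a ≤ b) : Nat.ble a b = true := Nat.ble_eq ▸ h

theorem chkC_spec {p n d L r w g js sp hs} (h : chkC n d L r w g js sp hs p = true) :
    (∀ i < d, 2 * i ≤ d → Odd (d / Nat.gcd i d) → Eng p n d false ((p ^ i + 1) % (p ^ d - 1))) ∧
    (p = 3 → ∀ i < d, 2 ≤ i → Nat.gcd i (2 * d) = 1 → Eng p n d false (((3 ^ i + 1) / 2) % (3 ^ d - 1))) := by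
  simp only [chkC, force_eq, andB_eq, Bool.and_eq_true, Nat.ble_eq] at h
  obtain ⟨hS, h⟩ := h
  obtain ⟨rn, h1, h2⟩ := setup_spec h
  have h3 := allN_spec h1
  simp only [Bool.and_eq_true] at h3
  refine ⟨fun i hi hh ho => ?_, fun hp3 i hi hh hg => ?_⟩
  · have h4 := (h3 i hi).1
    rw [ble_true (show Nat.mul 2 i ≤ d from hh), beq_true (show Nat.mod (Nat.div d (Nat.gcd i d)) 2 = 1 from Nat.odd_iff.1 ho)] at h4
    exact (h2 _ _ _ h4).eng hS
  · have h4 := (h3 i hi).2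
    rw [ble_true hh, beq_true hp3, beq_true (show Nat.gcd i (Nat.mul 2 d) = 1 from hg)] at h4
    exact (h2 _ _ _ h4).eng (by subst hp3; exact hS)

end PM

namespace PM

noncomputable def addJ {α : Type} (p : ℕ) (js : List (List ℕ)) (k : List ℕ → α) : α :=
  List.rec (fun (k : List ℕ → α) => k []) (fun j _ ih k => force (Nat.succ (sumB p j)) fun x => ih fun l => k (x :: l)) js k

theorem addJ_spec (p : ℕ) (js : List (List ℕ)) : ∃ l : List ℕ, ∀ (α : Type) (k : List ℕ → α), addJ p js k = k l := by
  induction js with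
  | nil => exact ⟨[], fun _ _ => rfl⟩
  | cons j js ih =>
    obtain ⟨l, hl⟩ := ih
    refine ⟨Nat.succ (sumB p j) :: l, fun α k => ?_⟩
    show (force (Nat.succ (sumB p j)) fun x => addJ p js fun l => k (x :: l)) = _
    rw [force_eq, hl]

/-- a table entry: the prime, the block size, the list of small exponents, extra exponents, and power sums -/
abbrev Ent := ℕ × ℕ × List (List ℕ) × List ℕ × List (List ℕ)

noncomputable def chkPE (n : ℕ) (e : Ent) : Bool :=
  Prod.rec (fun p e => Prod.rec (fun L e => Prod.rec (fun js e => Prod.rec (fun sp hs =>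
    force p fun p => force L fun L => addJ p js fun l => chkP n L 14 20 4 js (appL sp l) hs p) e) e) e) e

noncomputable def chkCE (n d : ℕ) (e : Ent) : Bool :=
  Prod.rec (fun p e => Prod.rec (fun L e => Prod.rec (fun js e => Prod.rec (fun sp hs =>
    force p fun p => force L fun L => addJ p js fun l => chkC n d L 14 20 4 js (appL sp l) hs p) e) e) e) e

/-- all blocks with index between `lo` and `lo + cnt` -/
noncomputable def chkRE (p n L r w : ℕ) (js : List (List ℕ)) (sp : List ℕ) (hs : List (List ℕ)) (lo cnt : ℕ) : Bool :=
  addJ p js fun l => chkR p n L r w 4 js (appL sp l) hs lo cnt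

theorem chkRE_spec {p n L r w js sp hs lo cnt} (h : chkRE p n L r w js sp hs lo cnt = true) :
    Cov p n 1 L true (2 % (p - 1)) lo cnt := by
  obtain ⟨l, hl⟩ := addJ_spec p js
  rw [chkRE, hl] at h
  exact chkR_spec h

theorem allL_mem {α : Type} {l : List α} {f : α → Bool} (h : allL l f = true) : ∀ a ∈ l, f a = true := by
  induction l with
  | nil => simp
  | cons b l ih =>
    have h1 : andB (f b) (allL l f) = true := h
    rw [andB_eq, Bool.and_eq_true] at h1
    intro a ha
    rcases List.mem_cons.1 ha with rfl | ha
    · exact h1.1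
    · exact ih h1.2 a ha

theorem tabP {n p : ℕ} {l : List Ent} (h : allL l (chkPE n) = true) (hp : p ∈ l.map Prod.fst) : Eng p n 1 true (2 % (p - 1)) := by
  obtain ⟨⟨q, L, js, sp, hs⟩, he, rfl⟩ := List.mem_map.1 hp
  have h1 := allL_mem h _ he
  obtain ⟨l, hl⟩ := addJ_spec q js
  have h2 : (force q fun p => force L fun L => addJ p js fun l => chkP n L 14 20 4 js (appL sp l) hs p) = true := h1
  rw [force_eq, force_eq, hl] at h2
  exact chkP_spec h2

theorem tabC {n d p : ℕ} {l : List Ent} (h : allL l (chkCE n d) = true) (hp : p ∈ l.map Prod.fst) :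
    (∀ i < d, 2 * i ≤ d → Odd (d / Nat.gcd i d) → Eng p n d false ((p ^ i + 1) % (p ^ d - 1))) ∧
    (p = 3 → ∀ i < d, 2 ≤ i → Nat.gcd i (2 * d) = 1 → Eng p n d false (((3 ^ i + 1) / 2) % (3 ^ d - 1))) := by
  obtain ⟨⟨q, L, js, sp, hs⟩, he, rfl⟩ := List.mem_map.1 hp
  have h1 := allL_mem h _ he
  obtain ⟨l, hl⟩ := addJ_spec q js
  have h2 : (force q fun p => force L fun L => addJ p js fun l => chkC n d L 14 20 4 js (appL sp l) hs p) = true := h1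
  rw [force_eq, force_eq, hl] at h2
  exact chkC_spec h2

end PM

namespace PM

def c3_17_H : List (List ℕ) := [[17, 0, 0, 8, 9], [17, 0, 0, 2, 15], [17, 0, 0, 6, 11], [17, 0, 0, 8, 8], [17, 0, 0, 7, 10], [17, 0, 0], [17, 0, 0, 3, 14], [17, 0, 0, 5, 12], [17, 0, 0, 4, 13], [17, 0, 0, 1, 16], [17, 0, 0, 2, 2], [17, 0, 0, 1, 10], [17, 0, 0, 10, 11], [17, 0, 0, 3, 3], [17, 0, 0, 4, 11], [17, 0, 0, 1, 2], [17, 0, 0, 1, 1, 4, 4], [17, 0, 0, 1, 1, 5, 6]]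
def c3_17_J0 : List (List ℕ) := [[8], [4, 8, 12], [3, 8, 11], [2, 8, 10], [5, 11], [7], [2, 7, 12], [1, 8, 9], [3, 7, 7], [3, 6, 9], [4, 7, 11], [4, 7, 7], [2, 7, 7], [1, 7, 10], [3, 7, 12], [4, 6, 7], [1, 6, 8], [3, 7, 10], [2, 6, 10], [5, 5, 8], [4, 7, 12], [5, 6, 11], [2, 4, 6], [6, 7, 10], [5, 5, 11], [2, 2, 9], [3, 8, 10], [4, 8, 8], [6, 6, 7], [4, 5, 11], [2, 4, 7], [1, 3, 10], [3, 4, 7], [2, 8, 9], [3, 5, 7], [2, 7, 10], [0, 4, 8], [3, 4, 6], [1, 5, 8], [2, 5, 11], [0, 4, 10], [4, 4, 10], [6, 7, 8], [5, 6, 10], [2, 5, 8]]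
def c3_17_S0 : List ℕ := [179578, 2218, 177958, 177418, 21898, 21872, 39376, 6574, 26974, 7372, 65854, 7318, 40, 19696, 274, 2272, 6886, 22114, 61480, 2197, 2431, 6724, 59294, 112, 6592, 59374, 59086, 8776, 8830, 6652, 6832, 21880, 196912, 179362, 183790, 66430, 709564, 592930, 85306, 364, 1614334, 4962388, 4966930, 3195694, 144364, 28914625, 1069528, 14375884, 652216, 5317330, 5144314, 15470872, 590506, 52582, 4310590, 29781112, 86152576, 11026, 236452, 538744, 8842, 7312, 1603102, 9625000, 5139460, 3249208, 14723050, 28737436, 41728, 356584, 31886716, 87688528, 1660, 9686254, 3370417, 1655654, 61672, 555022]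
theorem c3_17_0 : chkRE 3 17 14 11 17 c3_17_J0 c3_17_S0 c3_17_H 0 1 = true := by decide +kernel
def c3_17_J1 : List (List ℕ) := [[7], [8], [5, 11], [3, 6, 6], [4, 8, 12], [5, 10], [2, 8, 10], [3, 8, 11], [4], [1, 5, 7], [2, 6, 6], [4, 7, 11], [3, 6, 9], [1, 8, 9], [2, 7, 12], [5, 5, 6], [1, 6, 6], [5, 6, 11], [2, 4, 6], [1, 7, 10], [2, 2, 7], [4, 5, 8], [3, 7, 10], [4, 9, 9], [4, 10, 10], [0, 2, 7], [4, 4, 6], [3, 6, 7], [3, 4, 8], [3, 9, 10], [2, 4, 9], [3, 4, 6], [0, 4, 9], [4, 4, 9], [4, 6, 7], [1, 3, 9], [4, 8, 10], [5, 7, 9], [2, 5, 10], [3, 5, 8], [3, 5, 9], [1, 3, 6], [1, 7, 11], [4, 5, 9], [6, 6, 9]]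
def c3_17_S1 : List ℕ := [177904, 1054, 274, 26974, 59140, 177400, 196912, 2270, 19690, 60022, 2458, 59788, 65638, 6563, 757, 59077, 19688, 59078, 59780, 40, 256, 742, 19696, 28432, 328, 2272, 766, 78976, 982, 2278, 6814, 179578, 61246, 179344, 183790, 364, 4966930, 4962388, 1614334, 592930, 538744, 5315230, 1603102, 14375884, 709564, 124906, 4785430, 5317330, 5316688, 2657245, 28914625, 10098130, 9920506, 28737436, 10099624]
theorem c3_17_1 : chkRE 3 17 14 11 17 c3_17_J1 c3_17_S1 c3_17_H 1 2 = true := by decide +kernel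
def c3_17_J2 : List (List ℕ) := [[6], [8], [5], [1, 4, 6], [3, 6], [2, 4, 6], [3, 3, 6], [2, 2, 6], [0, 3, 6], [2, 5, 6], [0, 4, 6], [1, 2, 6], [4, 8, 12], [1, 1, 6], [0, 4, 10], [5, 10], [4, 5, 9], [3, 4, 6], [3, 6, 9], [0, 5, 11], [1, 6, 10], [7], [5, 8, 10], [1, 5, 6], [2, 8, 11], [4, 7, 10], [5, 5, 8], [1, 6, 11], [1, 3, 5], [2, 5, 10], [3, 5, 6], [4, 6, 8], [5, 7, 11], [5, 8, 9], [3, 6, 8], [3, 7, 10], [0, 6, 10], [2, 5, 7], [3, 6, 6], [6, 8, 10], [4, 4, 10], [2, 4, 10], [5, 5, 6], [1, 5, 10], [2, 3, 7]]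
def c3_17_S2 : List ℕ := [178120, 26272, 20494, 65692, 364, 14408206, 10936, 20170, 40, 6574, 118, 760, 21874, 8830, 10628902, 1614334, 4966930, 14882548, 15057508, 238]
theorem c3_17_2 : chkRE 3 17 14 11 17 c3_17_J2 c3_17_S2 c3_17_H 3 2 = true := by decide +kernel
def c3_17_J3 : List (List ℕ) := [[7], [5], [8], [4], [4, 8, 12], [2, 5, 5], [1, 5, 5], [5, 11], [1, 8, 9], [3, 5, 5], [2, 7, 12], [4, 4, 5], [2, 8, 10], [0, 2, 7], [0, 7, 9], [6, 10, 10], [3, 7, 10], [3, 8, 11], [1, 7, 11], [4, 7, 11], [2, 4, 6], [1, 6, 7], [3, 8, 8], [4, 5, 9], [2, 3, 9], [4, 5, 7], [1, 4, 10], [0, 3, 7], [1, 2, 3], [2, 7, 10], [6, 9, 9], [1, 5, 11], [3, 3, 5], [3, 9, 10], [3, 5, 8], [5, 5, 7], [0, 3, 10], [3, 4, 9], [3, 3, 9], [2, 5, 11], [4, 8, 8], [1, 4, 8], [2, 7, 11], [0, 1, 9], [1, 2, 9]]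
def c3_17_S3 : List ℕ := [79462, 20440, 2296, 61240, 26326, 272, 59320, 892, 59536, 5104, 19768, 2278, 179578, 538030, 2200, 274, 60022, 6670, 66340, 21952, 364, 5316688, 4842130, 1773748, 3195694, 238, 4962388, 4966930, 1635886, 4785430, 5315230, 8842, 1603102, 3254260, 9625000, 15057508, 1614046, 177916, 1358131]
theorem c3_17_3 : chkRE 3 17 14 11 17 c3_17_J3 c3_17_S3 c3_17_H 5 4 = true := by decide +kernel
def c3_17_J4 : List (List ℕ) := [[5], [8], [4], [7], [3, 3, 5], [0, 3, 5], [0, 4, 5], [2, 4, 5], [3, 5], [1, 4, 5], [1, 2, 5], [6], [1, 3, 5], [3, 5, 7], [4, 8, 12], [1, 1, 5], [2, 2, 5], [4, 5, 8], [2, 3, 5], [2, 7, 12], [4, 7, 11], [3, 7, 10], [3, 6, 9], [0, 2, 5], [4, 4, 9], [0, 7, 9], [4, 6, 10], [1, 7, 10], [5, 5, 8], [0, 4, 9], [3, 4, 8], [1, 4, 10], [2, 4, 6], [6, 8, 9], [3, 9, 9], [1, 2, 4], [4, 7, 9], [3, 4, 9]]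
def c3_17_S4 : List ℕ := [496, 21880, 61246, 19954, 5316688, 66430, 6724, 177878, 26248, 14408206, 86093476, 1358131, 65620, 14545768, 4842130]
theorem c3_17_4 : chkRE 3 17 14 11 17 c3_17_J4 c3_17_S4 c3_17_H 9 4 = true := by decide +kernel
def c3_17_J5 : List (List ℕ) := [[5], [8], [6], [4], [7], [3], [4, 8, 12], [3, 4, 4], [3, 6, 9], [2, 3, 6], [1, 4, 4], [1, 7, 11], [5, 11], [1, 8, 9], [2, 4, 4], [4, 9, 11], [3, 3, 7], [3, 7, 11], [3, 7, 10], [2, 4, 6], [2, 6, 7], [3, 4, 8], [0, 4, 10], [0, 7, 9], [2, 8, 9], [0, 6, 10], [4, 7, 12], [4, 4, 5], [4, 9, 10], [3, 4, 6], [5, 7, 7], [0, 2, 9], [6, 7, 8], [4, 4, 10], [4, 5, 8], [1, 2, 8], [6, 6, 9], [1, 4, 6], [1, 4, 7], [1, 1, 7], [2, 3, 7]]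
def c3_17_S5 : List ℕ := [364, 61480, 88, 66430, 86093476, 118828, 40, 10936, 238, 740, 13204, 24058, 65638, 592930, 14, 6598, 8830, 10628902, 85306, 573004]
theorem c3_17_5 : chkRE 3 17 14 11 17 c3_17_J5 c3_17_S5 c3_17_H 13 7 = true := by decide +kernel
def c3_17_J6 : List (List ℕ) := [[4], [7], [8], [6], [3], [5], [1, 2, 3], [2], [2, 3, 4], [2, 4], [1, 3, 3], [4, 8, 12], [5, 5, 10], [0, 3, 7], [2, 3, 6], [3, 5, 5], [3, 3, 9], [5, 6, 11], [0, 4, 5], [3, 7, 12], [3, 7, 10], [6, 6, 8], [1, 2, 4], [2, 3, 3], [2, 5, 5], [3, 3, 4], [4, 6, 6], [1, 7, 11], [3, 6, 9], [1, 1, 4], [1, 3, 5], [0, 2, 6], [2, 2, 5], [2, 2, 7], [2, 4, 6], [5, 8, 8], [2, 8, 9], [0, 3, 10], [8, 8]]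
def c3_17_S6 : List ℕ := [568, 19768, 3160, 26974, 179344, 65692, 46, 6832, 21952, 59134, 177472, 177394, 13204, 86093476, 56, 83, 2926, 85306, 4966930, 2278, 6644, 6670, 533710, 2198, 34, 19846, 14408206, 1459, 172, 6886, 11026, 3249208]
theorem c3_17_6 : chkRE 3 17 14 11 17 c3_17_J6 c3_17_S6 c3_17_H 20 8 = true := by decide +kernel
theorem c3_17_7 : chkRE 3 17 14 11 17 c3_17_J6 c3_17_S6 c3_17_H 28 8 = true := by decide +kernel
theorem c3_17_8 : chkRE 3 17 14 11 17 c3_17_J6 c3_17_S6 c3_17_H 36 8 = true := by decide +kernel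
theorem c3_17_9 : chkRE 3 17 14 11 17 c3_17_J6 c3_17_S6 c3_17_H 44 8 = true := by decide +kernel
theorem c3_17_10 : chkRE 3 17 14 11 17 c3_17_J6 c3_17_S6 c3_17_H 52 8 = true := by decide +kernel
def c3_17_J7 : List (List ℕ) := [[3], [7], [2], [5], [4], [6], [8], [1], [1, 3], [1, 1, 3], [0, 1, 3], [0, 3], [2, 3], [0, 2], [1, 2], [2, 2], [8, 8], [1, 2, 3], [0, 7, 10], [1, 4, 4], [2, 8, 11], [0, 5], [2, 4, 4], [2, 9], [5, 11], [4, 8, 12], [2, 2, 3], [4, 4, 6], [3, 6, 9], [3, 3, 7], [6, 7]]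
def c3_17_S7 : List ℕ := [66340, 2944, 262, 2206, 59374, 79462, 19774, 177958, 21880, 177880, 731, 20422, 814, 7318, 20494, 8992, 4966930, 56, 59104, 256, 65854, 4456, 59080, 59134, 14, 21898, 14545768, 5316688, 9586111, 20414, 4962388, 14349433]
theorem c3_17_11 : chkRE 3 17 14 11 17 c3_17_J7 c3_17_S7 c3_17_H 60 8 = true := by decide +kernel
theorem c3_17_12 : chkRE 3 17 14 11 17 c3_17_J7 c3_17_S7 c3_17_H 68 8 = true := by decide +kernel
theorem c3_17_13 : chkRE 3 17 14 11 17 c3_17_J7 c3_17_S7 c3_17_H 76 8 = true := by decide +kernel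
theorem c3_17_14 : chkRE 3 17 14 11 17 c3_17_J7 c3_17_S7 c3_17_H 84 8 = true := by decide +kernel
theorem c3_17_15 : chkRE 3 17 14 11 17 c3_17_J7 c3_17_S7 c3_17_H 92 8 = true := by decide +kernel
theorem c3_17_16 : chkRE 3 17 14 11 17 c3_17_J7 c3_17_S7 c3_17_H 100 8 = true := by decide +kernel
theorem c3_17_17 : chkRE 3 17 14 11 17 c3_17_J7 c3_17_S7 c3_17_H 108 8 = true := by decide +kernel
theorem c3_17_18 : chkRE 3 17 14 11 17 c3_17_J7 c3_17_S7 c3_17_H 116 8 = true := by decide +kernel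
theorem c3_17_19 : chkRE 3 17 14 11 17 c3_17_J7 c3_17_S7 c3_17_H 124 6 = true := by decide +kernel
def c3_17_J8 : List (List ℕ) := [[4], [6], [5], [1], [7], [8], [3], [2], [0], [2, 2], [1, 1, 2], [1, 2], [1, 1], [2, 2, 3], [1, 2, 2], [0, 4], [1, 1, 3], [4, 6], [6, 6, 7], [3, 3, 5], [2, 5], [8, 8], [4, 4], [2, 7, 12], [6, 7], [0, 1], [1, 4], [0, 1, 8]]
def c3_17_S8 : List ℕ := [177878, 100, 20008, 20416, 118342, 8750, 13204, 19711, 59782, 39394, 6590, 8776, 6808, 118180, 1462, 177394, 65614, 59374, 734, 6644, 26246, 78814, 39448, 487, 19712, 38, 24058, 177472, 4960156]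
theorem c3_17_20 : chkRE 3 17 14 11 17 c3_17_J8 c3_17_S8 c3_17_H 130 8 = true := by decide +kernel
theorem c3_17_21 : chkRE 3 17 14 11 17 c3_17_J8 c3_17_S8 c3_17_H 138 13 = true := by decide +kernel
theorem c3_17_22 : chkRE 3 17 14 11 17 c3_17_J8 c3_17_S8 c3_17_H 151 8 = true := by decide +kernel
theorem c3_17_23 : chkRE 3 17 14 11 17 c3_17_J8 c3_17_S8 c3_17_H 159 8 = true := by decide +kernel
theorem c3_17_24 : chkRE 3 17 14 11 17 c3_17_J8 c3_17_S8 c3_17_H 167 8 = true := by decide +kernel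
theorem c3_17_25 : chkRE 3 17 14 11 17 c3_17_J8 c3_17_S8 c3_17_H 175 8 = true := by decide +kernel
theorem c3_17_26 : chkRE 3 17 14 11 17 c3_17_J8 c3_17_S8 c3_17_H 183 8 = true := by decide +kernel
theorem c3_17_27 : chkRE 3 17 14 11 17 c3_17_J8 c3_17_S8 c3_17_H 191 9 = true := by decide +kernel
def c3_17_J9 : List (List ℕ) := [[2], [1], [5], [3], [4], [], [7], [6], [8], [0, 2], [1, 2], [0, 3], [4, 4], [0, 4], [0], [0, 5], [0, 1], [3, 4], [0, 6], [5, 5], [3, 3], [6, 6], [1, 1], [4, 9], [6, 10], [2, 8, 11]]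
def c3_17_S9 : List ℕ := [2218, 334, 59860, 4456, 19720, 118342, 40096, 66340, 2215, 20656, 2944, 19927, 20494, 20413, 13852, 110, 2917, 533638, 4618, 7372, 4966930, 2216, 19693, 1614334, 2270, 78760, 4962388, 6616, 1772284, 5317330, 59212, 13123, 1614046, 14375884]
theorem c3_17_28 : chkRE 3 17 14 11 17 c3_17_J9 c3_17_S9 c3_17_H 200 8 = true := by decide +kernel
theorem c3_17_29 : chkRE 3 17 14 11 17 c3_17_J9 c3_17_S9 c3_17_H 208 8 = true := by decide +kernel
theorem c3_17_30 : chkRE 3 17 14 11 17 c3_17_J9 c3_17_S9 c3_17_H 216 8 = true := by decide +kernel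
theorem c3_17_31 : chkRE 3 17 14 11 17 c3_17_J9 c3_17_S9 c3_17_H 224 8 = true := by decide +kernel
theorem c3_17_32 : chkRE 3 17 14 11 17 c3_17_J9 c3_17_S9 c3_17_H 232 8 = true := by decide +kernel
theorem c3_17_33 : chkRE 3 17 14 11 17 c3_17_J9 c3_17_S9 c3_17_H 240 10 = true := by decide +kernel
theorem c3_17_34 : chkRE 3 17 14 11 17 c3_17_J9 c3_17_S9 c3_17_H 250 8 = true := by decide +kernel
theorem c3_17_35 : chkRE 3 17 14 11 17 c3_17_J9 c3_17_S9 c3_17_H 258 8 = true := by decide +kernel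
theorem c3_17_36 : chkRE 3 17 14 11 17 c3_17_J9 c3_17_S9 c3_17_H 266 8 = true := by decide +kernel
theorem c3_17_37 : chkRE 3 17 14 11 17 c3_17_J9 c3_17_S9 c3_17_H 274 8 = true := by decide +kernel
theorem c3_17_38 : chkRE 3 17 14 11 17 c3_17_J9 c3_17_S9 c3_17_H 282 8 = true := by decide +kernel
theorem c3_17_39 : chkRE 3 17 14 11 17 c3_17_J9 c3_17_S9 c3_17_H 290 10 = true := by decide +kernel
def c3_17_J10 : List (List ℕ) := [[2], [1], [], [4], [5], [0], [6], [7], [8], [3], [1, 1], [2, 2], [0, 2], [1, 7], [0, 5], [2, 3], [5, 5], [6, 7], [1, 6, 6], [5, 6], [1, 3], [4, 5], [6, 10]]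
def c3_17_S10 : List ℕ := [179338, 8, 811, 59860, 13126, 6806, 757, 59134, 26246, 26326, 39610, 6805, 7292, 109, 7291, 20170, 39376, 254, 1486, 59302, 6808, 1459, 6574, 733, 1216, 740, 60508, 19930, 6565, 709564]
theorem c3_17_40 : chkRE 3 17 14 11 17 c3_17_J10 c3_17_S10 c3_17_H 300 11 = true := by decide +kernel
theorem c3_17_41 : chkRE 3 17 14 11 17 c3_17_J10 c3_17_S10 c3_17_H 311 8 = true := by decide +kernel
theorem c3_17_42 : chkRE 3 17 14 11 17 c3_17_J10 c3_17_S10 c3_17_H 319 8 = true := by decide +kernel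
theorem c3_17_43 : chkRE 3 17 14 11 17 c3_17_J10 c3_17_S10 c3_17_H 327 8 = true := by decide +kernel
theorem c3_17_44 : chkRE 3 17 14 11 17 c3_17_J10 c3_17_S10 c3_17_H 335 11 = true := by decide +kernel
theorem c3_17_45 : chkRE 3 17 14 11 17 c3_17_J10 c3_17_S10 c3_17_H 346 8 = true := by decide +kernel
theorem c3_17_46 : chkRE 3 17 14 11 17 c3_17_J10 c3_17_S10 c3_17_H 354 9 = true := by decide +kernel
theorem c3_17_47 : chkRE 3 17 14 11 17 c3_17_J10 c3_17_S10 c3_17_H 363 8 = true := by decide +kernel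
theorem c3_17_48 : chkRE 3 17 14 11 17 c3_17_J10 c3_17_S10 c3_17_H 371 8 = true := by decide +kernel
theorem c3_17_49 : chkRE 3 17 14 11 17 c3_17_J10 c3_17_S10 c3_17_H 379 8 = true := by decide +kernel
theorem c3_17_50 : chkRE 3 17 14 11 17 c3_17_J10 c3_17_S10 c3_17_H 387 12 = true := by decide +kernel
theorem c3_17_51 : chkRE 3 17 14 11 17 c3_17_J10 c3_17_S10 c3_17_H 399 1 = true := by decide +kernel
def c3_17_J11 : List (List ℕ) := [[], [0], [3], [6], [5], [7], [4], [8], [1], [0, 1], [2, 4], [7, 9], [2, 9], [6, 8], [1, 1], [3, 5]]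
def c3_17_S11 : List ℕ := [6571, 34, 811, 253, 739, 2269, 6808, 538030, 19927, 65614, 352, 20008, 2216, 742, 26272, 6572, 731, 19766, 59536, 21952, 10, 490, 256, 2200, 2270, 13204, 19696, 37, 4962388, 14545768, 551863]
theorem c3_17_52 : chkRE 3 17 14 11 17 c3_17_J11 c3_17_S11 c3_17_H 400 9 = true := by decide +kernel
theorem c3_17_53 : chkRE 3 17 14 11 17 c3_17_J11 c3_17_S11 c3_17_H 409 8 = true := by decide +kernel
theorem c3_17_54 : chkRE 3 17 14 11 17 c3_17_J11 c3_17_S11 c3_17_H 417 9 = true := by decide +kernel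
theorem c3_17_55 : chkRE 3 17 14 11 17 c3_17_J11 c3_17_S11 c3_17_H 426 8 = true := by decide +kernel
theorem c3_17_56 : chkRE 3 17 14 11 17 c3_17_J11 c3_17_S11 c3_17_H 434 62 = true := by decide +kernel
theorem c3_17_57 : chkRE 3 17 14 11 17 c3_17_J11 c3_17_S11 c3_17_H 496 9 = true := by decide +kernel
theorem c3_17_58 : chkRE 3 17 14 11 17 c3_17_J11 c3_17_S11 c3_17_H 505 8 = true := by decide +kernel
theorem c3_17_59 : chkRE 3 17 14 11 17 c3_17_J11 c3_17_S11 c3_17_H 513 10 = true := by decide +kernel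
theorem c3_17_60 : chkRE 3 17 14 11 17 c3_17_J11 c3_17_S11 c3_17_H 523 8 = true := by decide +kernel
theorem c3_17_61 : chkRE 3 17 14 11 17 c3_17_J11 c3_17_S11 c3_17_H 531 13 = true := by decide +kernel
theorem c3_17_62 : chkRE 3 17 14 11 17 c3_17_J11 c3_17_S11 c3_17_H 544 9 = true := by decide +kernel
theorem c3_17_63 : chkRE 3 17 14 11 17 c3_17_J11 c3_17_S11 c3_17_H 553 8 = true := by decide +kernel
theorem c3_17_64 : chkRE 3 17 14 11 17 c3_17_J11 c3_17_S11 c3_17_H 561 9 = true := by decide +kernel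
theorem c3_17_65 : chkRE 3 17 14 11 17 c3_17_J11 c3_17_S11 c3_17_H 570 8 = true := by decide +kernel
theorem c3_17_66 : chkRE 3 17 14 11 17 c3_17_J11 c3_17_S11 c3_17_H 578 22 = true := by decide +kernel
def c3_17_J12 : List (List ℕ) := [[], [0], [1], [4], [8], [0, 1], [6], [7], [5], [3], [2], [0, 3], [0, 8], [4, 7]]
def c3_17_S12 : List ℕ := [19711, 19765, 739, 6589, 733, 2197, 757, 177634, 26246, 731, 8749, 2206, 325, 20413, 2189, 61238, 1540, 183718, 253, 37, 974, 13204, 20656, 59536, 59078, 6652, 4375, 533638, 6590, 9478, 28914625, 245, 19846, 973, 40096, 13123, 538084, 2657245, 5144314, 236440, 1594813, 3249208, 31888651, 573004, 13150, 19, 19768, 2191, 26254, 61480, 4962388, 10098130, 14723050, 41728]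
theorem c3_17_67 : chkRE 3 17 14 11 17 c3_17_J12 c3_17_S12 c3_17_H 600 14 = true := by decide +kernel
theorem c3_17_68 : chkRE 3 17 14 11 17 c3_17_J12 c3_17_S12 c3_17_H 614 9 = true := by decide +kernel
theorem c3_17_69 : chkRE 3 17 14 11 17 c3_17_J12 c3_17_S12 c3_17_H 623 8 = true := by decide +kernel
theorem c3_17_70 : chkRE 3 17 14 11 17 c3_17_J12 c3_17_S12 c3_17_H 631 15 = true := by decide +kernel
theorem c3_17_71 : chkRE 3 17 14 11 17 c3_17_J12 c3_17_S12 c3_17_H 646 10 = true := by decide +kernel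
theorem c3_17_72 : chkRE 3 17 14 11 17 c3_17_J12 c3_17_S12 c3_17_H 656 8 = true := by decide +kernel
theorem c3_17_73 : chkRE 3 17 14 11 17 c3_17_J12 c3_17_S12 c3_17_H 664 10 = true := by decide +kernel
theorem c3_17_74 : chkRE 3 17 14 11 17 c3_17_J12 c3_17_S12 c3_17_H 674 15 = true := by decide +kernel
theorem c3_17_75 : chkRE 3 17 14 11 17 c3_17_J12 c3_17_S12 c3_17_H 689 8 = true := by decide +kernel
theorem c3_17_76 : chkRE 3 17 14 11 17 c3_17_J12 c3_17_S12 c3_17_H 697 10 = true := by decide +kernel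
theorem c3_17_77 : chkRE 3 17 14 11 17 c3_17_J12 c3_17_S12 c3_17_H 707 10 = true := by decide +kernel
theorem c3_17_78 : chkRE 3 17 14 11 17 c3_17_J12 c3_17_S12 c3_17_H 717 8 = true := by decide +kernel
theorem c3_17_79 : chkRE 3 17 14 11 17 c3_17_J12 c3_17_S12 c3_17_H 725 35 = true := by decide +kernel
theorem c3_17_80 : chkRE 3 17 14 11 17 c3_17_J12 c3_17_S12 c3_17_H 760 10 = true := by decide +kernel
theorem c3_17_81 : chkRE 3 17 14 11 17 c3_17_J12 c3_17_S12 c3_17_H 770 8 = true := by decide +kernel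
theorem c3_17_82 : chkRE 3 17 14 11 17 c3_17_J12 c3_17_S12 c3_17_H 778 19 = true := by decide +kernel
theorem c3_17_83 : chkRE 3 17 14 11 17 c3_17_J12 c3_17_S12 c3_17_H 797 8 = true := by decide +kernel
theorem c3_17_84 : chkRE 3 17 14 11 17 c3_17_J12 c3_17_S12 c3_17_H 805 11 = true := by decide +kernel
theorem c3_17_85 : chkRE 3 17 14 11 17 c3_17_J12 c3_17_S12 c3_17_H 816 8 = true := by decide +kernel
theorem c3_17_86 : chkRE 3 17 14 11 17 c3_17_J12 c3_17_S12 c3_17_H 824 18 = true := by decide +kernel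
theorem c3_17_87 : chkRE 3 17 14 11 17 c3_17_J12 c3_17_S12 c3_17_H 842 10 = true := by decide +kernel
theorem c3_17_88 : chkRE 3 17 14 11 17 c3_17_J12 c3_17_S12 c3_17_H 852 11 = true := by decide +kernel
theorem c3_17_89 : chkRE 3 17 14 11 17 c3_17_J12 c3_17_S12 c3_17_H 863 9 = true := by decide +kernel
theorem c3_17_90 : chkRE 3 17 14 11 17 c3_17_J12 c3_17_S12 c3_17_H 872 28 = true := by decide +kernel
def c3_17_J13 : List (List ℕ) := [[]]
def c3_17_S13 : List ℕ := [2, 7, 10936, 109, 31, 4402, 2917, 2215, 59294, 325, 19688, 46, 892, 58, 2191, 4962388, 31888651]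
theorem c3_17_91 : chkRE 3 17 14 11 17 c3_17_J13 c3_17_S13 c3_17_H 900 97 = true := by decide +kernel
theorem c3_17_92 : chkRE 3 17 14 11 17 c3_17_J13 c3_17_S13 c3_17_H 997 8 = true := by decide +kernel
theorem c3_17_93 : chkRE 3 17 14 11 17 c3_17_J13 c3_17_S13 c3_17_H 1005 12 = true := by decide +kernel
theorem c3_17_94 : chkRE 3 17 14 11 17 c3_17_J13 c3_17_S13 c3_17_H 1017 47 = true := by decide +kernel
theorem c3_17_95 : chkRE 3 17 14 11 17 c3_17_J13 c3_17_S13 c3_17_H 1064 20 = true := by decide +kernel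
theorem c3_17_96 : chkRE 3 17 14 11 17 c3_17_J13 c3_17_S13 c3_17_H 1084 12 = true := by decide +kernel
theorem c3_17_97 : chkRE 3 17 14 11 17 c3_17_J13 c3_17_S13 c3_17_H 1096 12 = true := by decide +kernel
theorem c3_17_98 : chkRE 3 17 14 11 17 c3_17_J13 c3_17_S13 c3_17_H 1108 9 = true := by decide +kernel
theorem c3_17_99 : chkRE 3 17 14 11 17 c3_17_J13 c3_17_S13 c3_17_H 1117 25 = true := by decide +kernel
theorem c3_17_100 : chkRE 3 17 14 11 17 c3_17_J13 c3_17_S13 c3_17_H 1142 8 = true := by decide +kernel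
theorem c3_17_101 : chkRE 3 17 14 11 17 c3_17_J13 c3_17_S13 c3_17_H 1150 13 = true := by decide +kernel
theorem c3_17_102 : chkRE 3 17 14 11 17 c3_17_J13 c3_17_S13 c3_17_H 1163 52 = true := by decide +kernel
theorem c3_17_103 : chkRE 3 17 14 11 17 c3_17_J13 c3_17_S13 c3_17_H 1215 27 = true := by decide +kernel
theorem c3_17_104 : chkRE 3 17 14 11 17 c3_17_J13 c3_17_S13 c3_17_H 1242 13 = true := by decide +kernel
theorem c3_17_105 : chkRE 3 17 14 11 17 c3_17_J13 c3_17_S13 c3_17_H 1255 9 = true := by decide +kernel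
theorem c3_17_106 : chkRE 3 17 14 11 17 c3_17_J13 c3_17_S13 c3_17_H 1264 27 = true := by decide +kernel
theorem c3_17_107 : chkRE 3 17 14 11 17 c3_17_J13 c3_17_S13 c3_17_H 1291 13 = true := by decide +kernel
theorem c3_17_108 : chkRE 3 17 14 11 17 c3_17_J13 c3_17_S13 c3_17_H 1304 9 = true := by decide +kernel
theorem c3_17_109 : chkRE 3 17 14 11 17 c3_17_J13 c3_17_S13 c3_17_H 1313 665 = true := by decide +kernel
theorem c3_17_110 : chkRE 3 17 14 11 17 c3_17_J13 c3_17_S13 c3_17_H 1978 41 = true := by decide +kernel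
theorem c3_17_111 : chkRE 3 17 14 11 17 c3_17_J13 c3_17_S13 c3_17_H 2019 17 = true := by decide +kernel
theorem c3_17_112 : chkRE 3 17 14 11 17 c3_17_J13 c3_17_S13 c3_17_H 2036 1906 = true := by decide +kernel
theorem c3_17_E : Eng 3 17 1 true (2 % (3 - 1)) :=
  Cov.eng (S := 3942) (((((((((((((((((((((((((((((((((((((((((((((((((((((((((((((((((((((((((((((((((((((((((((((((((((((((((((((((((chkRE_spec c3_17_0).append (chkRE_spec c3_17_1)).append (chkRE_spec c3_17_2)).append (chkRE_spec c3_17_3)).append (chkRE_spec c3_17_4)).append (chkRE_spec c3_17_5)).append (chkRE_spec c3_17_6)).append (chkRE_spec c3_17_7)).append (chkRE_spec c3_17_8)).append (chkRE_spec c3_17_9)).append (chkRE_spec c3_17_10)).append (chkRE_spec c3_17_11)).append (chkRE_spec c3_17_12)).append (chkRE_spec c3_17_13)).append (chkRE_spec c3_17_14)).append (chkRE_spec c3_17_15)).append (chkRE_spec c3_17_16)).append (chkRE_spec c3_17_17)).append (chkRE_spec c3_17_18)).append (chkRE_spec c3_17_19)).append (chkRE_spec c3_17_20)).append (chkRE_spec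 c3_17_21)).append (chkRE_spec c3_17_22)).append (chkRE_spec c3_17_23)).append (chkRE_spec c3_17_24)).append (chkRE_spec c3_17_25)).append (chkRE_spec c3_17_26)).append (chkRE_spec c3_17_27)).append (chkRE_spec c3_17_28)).append (chkRE_spec c3_17_29)).append (chkRE_spec c3_17_30)).append (chkRE_spec c3_17_31)).append (chkRE_spec c3_17_32)).append (chkRE_spec c3_17_33)).append (chkRE_spec c3_17_34)).append (chkRE_spec c3_17_35)).append (chkRE_spec c3_17_36)).append (chkRE_spec c3_17_37)).append (chkRE_spec c3_17_38)).append (chkRE_spec c3_17_39)).append (chkRE_spec c3_17_40)).append (chkRE_spec c3_17_41)).append (chkRE_spec c3_17_42)).append (chkRE_spec c3_17_43)).append (chkRE_spec c3_17_44)).append (chkRE_spec c3_17_45)).append (chkRE_spec c3_17_46)).append (chkRE_spec c3_17_47)).append (chkRE_spec c3_17_48)).append (chkRE_spec c3_17_49)).append (chkRE_spec c3_17_50)).append (chkRE_spec c3_17_51)).append (chkRE_spec c3_17_52)).append (chkRE_spec c3_17_53)).append (chkRE_spec c3_17_54)).append (chkRE_spec c3_17_55)).append (chkRE_spec c3_17_56)).append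 (chkRE_spec c3_17_57)).append (chkRE_spec c3_17_58)).append (chkRE_spec c3_17_59)).append (chkRE_spec c3_17_60)).append (chkRE_spec c3_17_61)).append (chkRE_spec c3_17_62)).append (chkRE_spec c3_17_63)).append (chkRE_spec c3_17_64)).append (chkRE_spec c3_17_65)).append (chkRE_spec c3_17_66)).append (chkRE_spec c3_17_67)).append (chkRE_spec c3_17_68)).append (chkRE_spec c3_17_69)).append (chkRE_spec c3_17_70)).append (chkRE_spec c3_17_71)).append (chkRE_spec c3_17_72)).append (chkRE_spec c3_17_73)).append (chkRE_spec c3_17_74)).append (chkRE_spec c3_17_75)).append (chkRE_spec c3_17_76)).append (chkRE_spec c3_17_77)).append (chkRE_spec c3_17_78)).append (chkRE_spec c3_17_79)).append (chkRE_spec c3_17_80)).append (chkRE_spec c3_17_81)).append (chkRE_spec c3_17_82)).append (chkRE_spec c3_17_83)).append (chkRE_spec c3_17_84)).append (chkRE_spec c3_17_85)).append (chkRE_spec c3_17_86)).append (chkRE_spec c3_17_87)).append (chkRE_spec c3_17_88)).append (chkRE_spec c3_17_89)).append (chkRE_spec c3_17_90)).append (chkRE_spec c3_17_91)).append (chkRE_spec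 c3_17_92)).append (chkRE_spec c3_17_93)).append (chkRE_spec c3_17_94)).append (chkRE_spec c3_17_95)).append (chkRE_spec c3_17_96)).append (chkRE_spec c3_17_97)).append (chkRE_spec c3_17_98)).append (chkRE_spec c3_17_99)).append (chkRE_spec c3_17_100)).append (chkRE_spec c3_17_101)).append (chkRE_spec c3_17_102)).append (chkRE_spec c3_17_103)).append (chkRE_spec c3_17_104)).append (chkRE_spec c3_17_105)).append (chkRE_spec c3_17_106)).append (chkRE_spec c3_17_107)).append (chkRE_spec c3_17_108)).append (chkRE_spec c3_17_109)).append (chkRE_spec c3_17_110)).append (chkRE_spec c3_17_111)).append (chkRE_spec c3_17_112)) (by norm_num)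


def c19_7_H : List (List ℕ) := []
def c19_7_J0 : List (List ℕ) := [[3], [1, 3, 5], [2, 3], [1, 3], [2, 2], [1, 2, 4], [0, 2, 4], [2, 3, 4], [0, 3], [1, 3, 4], [3, 3, 3], [1, 1], [0, 1, 3], [0, 2, 3], [1, 2, 2], [1, 1, 3], [0, 0, 3], [1, 3, 3], [1, 2, 3], [1, 1, 2], [2, 2, 2], [0, 2], [3, 3], [2, 2, 3], [0, 3, 4], [1, 1, 1], [0, 1, 4], [0, 2, 2], [1, 1, 4]]
def c19_7_S0 : List ℕ := [783010, 19808812, 3991, 22285253, 802504, 1042930, 781984, 17332732, 653050, 27551, 48736, 391173, 12382301, 188185331, 282289006, 27353693, 27514]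
theorem c19_7_0 : chkRE 19 7 13 14 20 c19_7_J0 c19_7_S0 c19_7_H 0 5 = true := by decide +kernel
def c19_7_J1 : List (List ℕ) := [[2], [3], [1, 3, 5], [2, 3], [1, 2, 4], [1], [1, 3], [2, 3, 4], [2, 2], [1, 3, 4], [0, 2, 4], [0, 2], [0, 3], [1, 2, 3], [1, 1, 4], [3, 3], [2, 4, 4], [1, 1, 2], [1, 3, 3], [0, 1, 4], [0, 2, 3], [0, 1, 2], [2, 2, 3]]
def c19_7_S1 : List ℕ := [48736, 27551, 17332732, 1042930, 22285253, 282289006, 3991, 19808812, 7428394, 39621556, 188185331, 783010, 391173, 27353693]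
theorem c19_7_1 : chkRE 19 7 13 14 20 c19_7_J1 c19_7_S1 c19_7_H 5 30 = true := by decide +kernel
theorem c19_7_2 : chkRE 19 7 13 14 20 c19_7_J1 c19_7_S1 c19_7_H 35 15 = true := by decide +kernel
def c19_7_J2 : List (List ℕ) := [[1], [3], [2], [1, 2, 3], [0, 1], [2, 2], [1, 1], [3, 3], [0, 2], [1, 3, 4], [0, 0, 3], [0, 3], [1, 3, 5], [2, 3, 4]]
def c19_7_S2 : List ℕ := [802504, 19808812, 7428394, 282289006, 27514, 27551, 17332732, 1042930, 653050, 6880, 7582]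
theorem c19_7_3 : chkRE 19 7 13 14 20 c19_7_J2 c19_7_S2 c19_7_H 50 30 = true := by decide +kernel
theorem c19_7_4 : chkRE 19 7 13 14 20 c19_7_J2 c19_7_S2 c19_7_H 80 30 = true := by decide +kernel
theorem c19_7_5 : chkRE 19 7 13 14 20 c19_7_J2 c19_7_S2 c19_7_H 110 30 = true := by decide +kernel
theorem c19_7_6 : chkRE 19 7 13 14 20 c19_7_J2 c19_7_S2 c19_7_H 140 30 = true := by decide +kernel
theorem c19_7_7 : chkRE 19 7 13 14 20 c19_7_J2 c19_7_S2 c19_7_H 170 30 = true := by decide +kernel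
theorem c19_7_8 : chkRE 19 7 13 14 20 c19_7_J2 c19_7_S2 c19_7_H 200 30 = true := by decide +kernel
theorem c19_7_9 : chkRE 19 7 13 14 20 c19_7_J2 c19_7_S2 c19_7_H 230 30 = true := by decide +kernel
theorem c19_7_10 : chkRE 19 7 13 14 20 c19_7_J2 c19_7_S2 c19_7_H 260 30 = true := by decide +kernel
theorem c19_7_11 : chkRE 19 7 13 14 20 c19_7_J2 c19_7_S2 c19_7_H 290 10 = true := by decide +kernel
def c19_7_J3 : List (List ℕ) := [[], [3], [1], [2], [0], [1, 3, 5], [1, 2, 3], [1, 3, 4], [1, 2, 4], [2, 3]]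
def c19_7_S3 : List ℕ := [19808812, 48736, 282289006, 1042930, 27514, 17332732, 802504, 781984, 130683, 653050, 363, 27551, 22285253, 188185331, 3991]
theorem c19_7_12 : chkRE 19 7 13 14 20 c19_7_J3 c19_7_S3 c19_7_H 300 46 = true := by decide +kernel
theorem c19_7_13 : chkRE 19 7 13 14 20 c19_7_J3 c19_7_S3 c19_7_H 346 30 = true := by decide +kernel
theorem c19_7_14 : chkRE 19 7 13 14 20 c19_7_J3 c19_7_S3 c19_7_H 376 30 = true := by decide +kernel
theorem c19_7_15 : chkRE 19 7 13 14 20 c19_7_J3 c19_7_S3 c19_7_H 406 30 = true := by decide +kernel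
theorem c19_7_16 : chkRE 19 7 13 14 20 c19_7_J3 c19_7_S3 c19_7_H 436 30 = true := by decide +kernel
theorem c19_7_17 : chkRE 19 7 13 14 20 c19_7_J3 c19_7_S3 c19_7_H 466 31 = true := by decide +kernel
theorem c19_7_18 : chkRE 19 7 13 14 20 c19_7_J3 c19_7_S3 c19_7_H 497 31 = true := by decide +kernel
theorem c19_7_19 : chkRE 19 7 13 14 20 c19_7_J3 c19_7_S3 c19_7_H 528 30 = true := by decide +kernel
theorem c19_7_20 : chkRE 19 7 13 14 20 c19_7_J3 c19_7_S3 c19_7_H 558 32 = true := by decide +kernel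
theorem c19_7_21 : chkRE 19 7 13 14 20 c19_7_J3 c19_7_S3 c19_7_H 590 31 = true := by decide +kernel
theorem c19_7_22 : chkRE 19 7 13 14 20 c19_7_J3 c19_7_S3 c19_7_H 621 65 = true := by decide +kernel
theorem c19_7_23 : chkRE 19 7 13 14 20 c19_7_J3 c19_7_S3 c19_7_H 686 32 = true := by decide +kernel
theorem c19_7_24 : chkRE 19 7 13 14 20 c19_7_J3 c19_7_S3 c19_7_H 718 32 = true := by decide +kernel
theorem c19_7_25 : chkRE 19 7 13 14 20 c19_7_J3 c19_7_S3 c19_7_H 750 32 = true := by decide +kernel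
theorem c19_7_26 : chkRE 19 7 13 14 20 c19_7_J3 c19_7_S3 c19_7_H 782 32 = true := by decide +kernel
theorem c19_7_27 : chkRE 19 7 13 14 20 c19_7_J3 c19_7_S3 c19_7_H 814 33 = true := by decide +kernel
theorem c19_7_28 : chkRE 19 7 13 14 20 c19_7_J3 c19_7_S3 c19_7_H 847 32 = true := by decide +kernel
theorem c19_7_29 : chkRE 19 7 13 14 20 c19_7_J3 c19_7_S3 c19_7_H 879 34 = true := by decide +kernel
theorem c19_7_30 : chkRE 19 7 13 14 20 c19_7_J3 c19_7_S3 c19_7_H 913 33 = true := by decide +kernel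
theorem c19_7_31 : chkRE 19 7 13 14 20 c19_7_J3 c19_7_S3 c19_7_H 946 84 = true := by decide +kernel
theorem c19_7_32 : chkRE 19 7 13 14 20 c19_7_J3 c19_7_S3 c19_7_H 1030 34 = true := by decide +kernel
theorem c19_7_33 : chkRE 19 7 13 14 20 c19_7_J3 c19_7_S3 c19_7_H 1064 34 = true := by decide +kernel
theorem c19_7_34 : chkRE 19 7 13 14 20 c19_7_J3 c19_7_S3 c19_7_H 1098 34 = true := by decide +kernel
theorem c19_7_35 : chkRE 19 7 13 14 20 c19_7_J3 c19_7_S3 c19_7_H 1132 35 = true := by decide +kernel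
theorem c19_7_36 : chkRE 19 7 13 14 20 c19_7_J3 c19_7_S3 c19_7_H 1167 34 = true := by decide +kernel
theorem c19_7_37 : chkRE 19 7 13 14 20 c19_7_J3 c19_7_S3 c19_7_H 1201 35 = true := by decide +kernel
theorem c19_7_38 : chkRE 19 7 13 14 20 c19_7_J3 c19_7_S3 c19_7_H 1236 35 = true := by decide +kernel
theorem c19_7_39 : chkRE 19 7 13 14 20 c19_7_J3 c19_7_S3 c19_7_H 1271 102 = true := by decide +kernel
theorem c19_7_40 : chkRE 19 7 13 14 20 c19_7_J3 c19_7_S3 c19_7_H 1373 36 = true := by decide +kernel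
theorem c19_7_41 : chkRE 19 7 13 14 20 c19_7_J3 c19_7_S3 c19_7_H 1409 39 = true := by decide +kernel
theorem c19_7_42 : chkRE 19 7 13 14 20 c19_7_J3 c19_7_S3 c19_7_H 1448 36 = true := by decide +kernel
theorem c19_7_43 : chkRE 19 7 13 14 20 c19_7_J3 c19_7_S3 c19_7_H 1484 16 = true := by decide +kernel
def c19_7_J4 : List (List ℕ) := [[], [2], [0]]
def c19_7_S4 : List ℕ := [6860, 3]
theorem c19_7_44 : chkRE 19 7 13 14 20 c19_7_J4 c19_7_S4 c19_7_H 1500 36 = true := by decide +kernel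
theorem c19_7_45 : chkRE 19 7 13 14 20 c19_7_J4 c19_7_S4 c19_7_H 1536 38 = true := by decide +kernel
theorem c19_7_46 : chkRE 19 7 13 14 20 c19_7_J4 c19_7_S4 c19_7_H 1574 120 = true := by decide +kernel
theorem c19_7_47 : chkRE 19 7 13 14 20 c19_7_J4 c19_7_S4 c19_7_H 1694 41 = true := by decide +kernel
theorem c19_7_48 : chkRE 19 7 13 14 20 c19_7_J4 c19_7_S4 c19_7_H 1735 38 = true := by decide +kernel
theorem c19_7_49 : chkRE 19 7 13 14 20 c19_7_J4 c19_7_S4 c19_7_H 1773 38 = true := by decide +kernel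
theorem c19_7_50 : chkRE 19 7 13 14 20 c19_7_J4 c19_7_S4 c19_7_H 1811 42 = true := by decide +kernel
theorem c19_7_51 : chkRE 19 7 13 14 20 c19_7_J4 c19_7_S4 c19_7_H 1853 39 = true := by decide +kernel
theorem c19_7_52 : chkRE 19 7 13 14 20 c19_7_J4 c19_7_S4 c19_7_H 1892 139 = true := by decide +kernel
theorem c19_7_53 : chkRE 19 7 13 14 20 c19_7_J4 c19_7_S4 c19_7_H 2031 45 = true := by decide +kernel
theorem c19_7_54 : chkRE 19 7 13 14 20 c19_7_J4 c19_7_S4 c19_7_H 2076 39 = true := by decide +kernel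
theorem c19_7_55 : chkRE 19 7 13 14 20 c19_7_J4 c19_7_S4 c19_7_H 2115 45 = true := by decide +kernel
theorem c19_7_56 : chkRE 19 7 13 14 20 c19_7_J4 c19_7_S4 c19_7_H 2160 46 = true := by decide +kernel
theorem c19_7_57 : chkRE 19 7 13 14 20 c19_7_J4 c19_7_S4 c19_7_H 2206 158 = true := by decide +kernel
theorem c19_7_58 : chkRE 19 7 13 14 20 c19_7_J4 c19_7_S4 c19_7_H 2364 47 = true := by decide +kernel
theorem c19_7_59 : chkRE 19 7 13 14 20 c19_7_J4 c19_7_S4 c19_7_H 2411 47 = true := by decide +kernel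
theorem c19_7_60 : chkRE 19 7 13 14 20 c19_7_J4 c19_7_S4 c19_7_H 2458 42 = true := by decide +kernel
theorem c19_7_61 : chkRE 19 7 13 14 20 c19_7_J4 c19_7_S4 c19_7_H 2500 47 = true := by decide +kernel
theorem c19_7_62 : chkRE 19 7 13 14 20 c19_7_J4 c19_7_S4 c19_7_H 2547 184 = true := by decide +kernel
theorem c19_7_63 : chkRE 19 7 13 14 20 c19_7_J4 c19_7_S4 c19_7_H 2731 50 = true := by decide +kernel
theorem c19_7_64 : chkRE 19 7 13 14 20 c19_7_J4 c19_7_S4 c19_7_H 2781 50 = true := by decide +kernel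
theorem c19_7_65 : chkRE 19 7 13 14 20 c19_7_J4 c19_7_S4 c19_7_H 2831 202 = true := by decide +kernel
theorem c19_7_66 : chkRE 19 7 13 14 20 c19_7_J4 c19_7_S4 c19_7_H 3033 3029 = true := by decide +kernel
theorem c19_7_E : Eng 19 7 1 true (2 % (19 - 1)) :=
  Cov.eng (S := 6062) (((((((((((((((((((((((((((((((((((((((((((((((((((((((((((((((((((chkRE_spec c19_7_0).append (chkRE_spec c19_7_1)).append (chkRE_spec c19_7_2)).append (chkRE_spec c19_7_3)).append (chkRE_spec c19_7_4)).append (chkRE_spec c19_7_5)).append (chkRE_spec c19_7_6)).append (chkRE_spec c19_7_7)).append (chkRE_spec c19_7_8)).append (chkRE_spec c19_7_9)).append (chkRE_spec c19_7_10)).append (chkRE_spec c19_7_11)).append (chkRE_spec c19_7_12)).append (chkRE_spec c19_7_13)).append (chkRE_spec c19_7_14)).append (chkRE_spec c19_7_15)).append (chkRE_spec c19_7_16)).append (chkRE_spec c19_7_17)).append (chkRE_spec c19_7_18)).append (chkRE_spec c19_7_19)).append (chkRE_spec c19_7_20)).append (chkRE_spec c19_7_21)).append (chkRE_spec c19_7_22)).append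 (chkRE_spec c19_7_23)).append (chkRE_spec c19_7_24)).append (chkRE_spec c19_7_25)).append (chkRE_spec c19_7_26)).append (chkRE_spec c19_7_27)).append (chkRE_spec c19_7_28)).append (chkRE_spec c19_7_29)).append (chkRE_spec c19_7_30)).append (chkRE_spec c19_7_31)).append (chkRE_spec c19_7_32)).append (chkRE_spec c19_7_33)).append (chkRE_spec c19_7_34)).append (chkRE_spec c19_7_35)).append (chkRE_spec c19_7_36)).append (chkRE_spec c19_7_37)).append (chkRE_spec c19_7_38)).append (chkRE_spec c19_7_39)).append (chkRE_spec c19_7_40)).append (chkRE_spec c19_7_41)).append (chkRE_spec c19_7_42)).append (chkRE_spec c19_7_43)).append (chkRE_spec c19_7_44)).append (chkRE_spec c19_7_45)).append (chkRE_spec c19_7_46)).append (chkRE_spec c19_7_47)).append (chkRE_spec c19_7_48)).append (chkRE_spec c19_7_49)).append (chkRE_spec c19_7_50)).append (chkRE_spec c19_7_51)).append (chkRE_spec c19_7_52)).append (chkRE_spec c19_7_53)).append (chkRE_spec c19_7_54)).append (chkRE_spec c19_7_55)).append (chkRE_spec c19_7_56)).append (chkRE_spec c19_7_57)).append (chkRE_spec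 c19_7_58)).append (chkRE_spec c19_7_59)).append (chkRE_spec c19_7_60)).append (chkRE_spec c19_7_61)).append (chkRE_spec c19_7_62)).append (chkRE_spec c19_7_63)).append (chkRE_spec c19_7_64)).append (chkRE_spec c19_7_65)).append (chkRE_spec c19_7_66)) (by norm_num)


def c17_7_H : List (List ℕ) := []
def c17_7_J0 : List (List ℕ) := [[3], [1, 3, 4], [2, 2], [1, 3], [2, 3], [1, 2, 4], [0, 2, 4], [1, 3, 5], [2, 3, 4], [0, 3], [1, 1], [3, 3, 3], [0, 1, 3], [0, 2, 3], [1, 1, 2], [3, 3], [0, 0, 3], [1, 2, 2], [1, 2, 3], [0, 2], [1, 3, 3], [1, 1, 3], [2, 2, 2], [0, 3, 4], [0, 1, 4], [2, 2, 3], [0, 0, 1], [1, 1, 1], [1, 1, 4], [2, 3, 3]]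
def c17_7_S0 : List ℕ := [7099865, 2041, 334153, 418473, 4289050, 250634, 510953, 4260729, 250649, 953, 9939289, 835500, 193100570, 193110379, 7100153]
theorem c17_7_0 : chkRE 17 7 13 14 20 c17_7_J0 c17_7_S0 c17_7_H 0 5 = true := by decide +kernel
def c17_7_J1 : List (List ℕ) := [[2], [3], [1, 3, 5], [1], [1, 3, 4], [3, 3], [0, 2], [1, 2, 3], [2, 4], [1, 3], [2, 3, 4], [2, 2], [2, 3], [0, 1, 2], [0, 3], [1, 1, 4], [1, 2, 4], [0, 2, 4], [0, 1, 4], [2, 4, 4], [0, 2, 3], [2, 2, 3], [3, 3, 3]]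
def c17_7_S1 : List ℕ := [2041, 9939289, 835500, 334153, 4289050, 250634, 193100570, 510953, 193110379, 7099865, 14843, 21298009, 4489, 250649]
theorem c17_7_1 : chkRE 17 7 13 14 20 c17_7_J1 c17_7_S1 c17_7_H 5 30 = true := by decide +kernel
theorem c17_7_2 : chkRE 17 7 13 14 20 c17_7_J1 c17_7_S1 c17_7_H 35 15 = true := by decide +kernel
def c17_7_J2 : List (List ℕ) := [[2], [1], [3], [1, 2, 3], [], [1, 3, 4], [0, 1], [1, 3, 5], [1, 1], [3, 3], [0, 3], [2, 2], [0, 2], [1, 3], [2, 3, 4]]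
def c17_7_S2 : List ℕ := [7099865, 9939289, 334153, 510953, 4260729, 2041, 953, 250634, 4289050, 193100570]
theorem c17_7_3 : chkRE 17 7 13 14 20 c17_7_J2 c17_7_S2 c17_7_H 50 30 = true := by decide +kernel
theorem c17_7_4 : chkRE 17 7 13 14 20 c17_7_J2 c17_7_S2 c17_7_H 80 30 = true := by decide +kernel
theorem c17_7_5 : chkRE 17 7 13 14 20 c17_7_J2 c17_7_S2 c17_7_H 110 30 = true := by decide +kernel
theorem c17_7_6 : chkRE 17 7 13 14 20 c17_7_J2 c17_7_S2 c17_7_H 140 30 = true := by decide +kernel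
theorem c17_7_7 : chkRE 17 7 13 14 20 c17_7_J2 c17_7_S2 c17_7_H 170 40 = true := by decide +kernel
theorem c17_7_8 : chkRE 17 7 13 14 20 c17_7_J2 c17_7_S2 c17_7_H 210 30 = true := by decide +kernel
theorem c17_7_9 : chkRE 17 7 13 14 20 c17_7_J2 c17_7_S2 c17_7_H 240 30 = true := by decide +kernel
theorem c17_7_10 : chkRE 17 7 13 14 20 c17_7_J2 c17_7_S2 c17_7_H 270 30 = true := by decide +kernel
def c17_7_J3 : List (List ℕ) := [[], [1], [2], [0], [3], [0, 0], [1, 2, 3]]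
def c17_7_S3 : List ℕ := [88452, 1424788, 83828, 9939289, 193100570, 88724, 4931, 4289050, 953, 7099865]
theorem c17_7_11 : chkRE 17 7 13 14 20 c17_7_J3 c17_7_S3 c17_7_H 300 31 = true := by decide +kernel
theorem c17_7_12 : chkRE 17 7 13 14 20 c17_7_J3 c17_7_S3 c17_7_H 331 30 = true := by decide +kernel
theorem c17_7_13 : chkRE 17 7 13 14 20 c17_7_J3 c17_7_S3 c17_7_H 361 54 = true := by decide +kernel
theorem c17_7_14 : chkRE 17 7 13 14 20 c17_7_J3 c17_7_S3 c17_7_H 415 30 = true := by decide +kernel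
theorem c17_7_15 : chkRE 17 7 13 14 20 c17_7_J3 c17_7_S3 c17_7_H 445 33 = true := by decide +kernel
theorem c17_7_16 : chkRE 17 7 13 14 20 c17_7_J3 c17_7_S3 c17_7_H 478 32 = true := by decide +kernel
theorem c17_7_17 : chkRE 17 7 13 14 20 c17_7_J3 c17_7_S3 c17_7_H 510 33 = true := by decide +kernel
theorem c17_7_18 : chkRE 17 7 13 14 20 c17_7_J3 c17_7_S3 c17_7_H 543 65 = true := by decide +kernel
theorem c17_7_19 : chkRE 17 7 13 14 20 c17_7_J3 c17_7_S3 c17_7_H 608 33 = true := by decide +kernel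
theorem c17_7_20 : chkRE 17 7 13 14 20 c17_7_J3 c17_7_S3 c17_7_H 641 35 = true := by decide +kernel
theorem c17_7_21 : chkRE 17 7 13 14 20 c17_7_J3 c17_7_S3 c17_7_H 676 33 = true := by decide +kernel
theorem c17_7_22 : chkRE 17 7 13 14 20 c17_7_J3 c17_7_S3 c17_7_H 709 79 = true := by decide +kernel
theorem c17_7_23 : chkRE 17 7 13 14 20 c17_7_J3 c17_7_S3 c17_7_H 788 38 = true := by decide +kernel
theorem c17_7_24 : chkRE 17 7 13 14 20 c17_7_J3 c17_7_S3 c17_7_H 826 36 = true := by decide +kernel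
theorem c17_7_25 : chkRE 17 7 13 14 20 c17_7_J3 c17_7_S3 c17_7_H 862 36 = true := by decide +kernel
theorem c17_7_26 : chkRE 17 7 13 14 20 c17_7_J3 c17_7_S3 c17_7_H 898 95 = true := by decide +kernel
theorem c17_7_27 : chkRE 17 7 13 14 20 c17_7_J3 c17_7_S3 c17_7_H 993 39 = true := by decide +kernel
theorem c17_7_28 : chkRE 17 7 13 14 20 c17_7_J3 c17_7_S3 c17_7_H 1032 39 = true := by decide +kernel
theorem c17_7_29 : chkRE 17 7 13 14 20 c17_7_J3 c17_7_S3 c17_7_H 1071 106 = true := by decide +kernel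
theorem c17_7_30 : chkRE 17 7 13 14 20 c17_7_J3 c17_7_S3 c17_7_H 1177 42 = true := by decide +kernel
theorem c17_7_31 : chkRE 17 7 13 14 20 c17_7_J3 c17_7_S3 c17_7_H 1219 44 = true := by decide +kernel
theorem c17_7_32 : chkRE 17 7 13 14 20 c17_7_J3 c17_7_S3 c17_7_H 1263 119 = true := by decide +kernel
theorem c17_7_33 : chkRE 17 7 13 14 20 c17_7_J3 c17_7_S3 c17_7_H 1382 46 = true := by decide +kernel
theorem c17_7_34 : chkRE 17 7 13 14 20 c17_7_J3 c17_7_S3 c17_7_H 1428 72 = true := by decide +kernel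
def c17_7_J4 : List (List ℕ) := [[]]
def c17_7_S4 : List ℕ := []
theorem c17_7_35 : chkRE 17 7 13 14 20 c17_7_J4 c17_7_S4 c17_7_H 1500 1631 = true := by decide +kernel
theorem c17_7_E : Eng 17 7 1 true (2 % (17 - 1)) :=
  Cov.eng (S := 3131) ((((((((((((((((((((((((((((((((((((chkRE_spec c17_7_0).append (chkRE_spec c17_7_1)).append (chkRE_spec c17_7_2)).append (chkRE_spec c17_7_3)).append (chkRE_spec c17_7_4)).append (chkRE_spec c17_7_5)).append (chkRE_spec c17_7_6)).append (chkRE_spec c17_7_7)).append (chkRE_spec c17_7_8)).append (chkRE_spec c17_7_9)).append (chkRE_spec c17_7_10)).append (chkRE_spec c17_7_11)).append (chkRE_spec c17_7_12)).append (chkRE_spec c17_7_13)).append (chkRE_spec c17_7_14)).append (chkRE_spec c17_7_15)).append (chkRE_spec c17_7_16)).append (chkRE_spec c17_7_17)).append (chkRE_spec c17_7_18)).append (chkRE_spec c17_7_19)).append (chkRE_spec c17_7_20)).append (chkRE_spec c17_7_21)).append (chkRE_spec c17_7_22)).append (chkRE_spec c17_7_23)).append (chkRE_spec c17_7_24)).append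 (chkRE_spec c17_7_25)).append (chkRE_spec c17_7_26)).append (chkRE_spec c17_7_27)).append (chkRE_spec c17_7_28)).append (chkRE_spec c17_7_29)).append (chkRE_spec c17_7_30)).append (chkRE_spec c17_7_31)).append (chkRE_spec c17_7_32)).append (chkRE_spec c17_7_33)).append (chkRE_spec c17_7_34)).append (chkRE_spec c17_7_35)) (by norm_num)


def c13_7_H : List (List ℕ) := []
def c13_7_J0 : List (List ℕ) := [[3], [2], [1, 3, 5], [2, 3], [1, 3], [1, 2], [1, 3, 4], [3, 3], [2, 3, 4], [2, 2], [1, 2, 4], [1], [0, 3], [0, 2, 4], [0, 2], [1, 2, 3], [1, 1, 2], [3, 3, 3], [0, 1, 3], [2, 4, 4], [0, 2, 3], [1, 2, 2], [0, 0, 3], [1, 1, 4], [1, 3, 3], [2, 2, 3], [0, 1, 2], [1, 1], [2, 4], [2, 2, 2], [0, 0, 2], [2, 3, 3], [0, 1, 4], [1, 1, 3], [0, 3, 4], [0, 0, 0], [1, 1, 1], [0, 2, 2], [2, 2, 4], [1, 2, 2, 2, 2, 2], [2, 5, 5, 5, 5, 5], [1, 1, 1, 1, 4, 4], [0, 1,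 1, 2, 2, 2], [0, 3, 3, 3, 6, 6, 6], [2, 2, 2, 4, 4, 4]]
def c13_7_S0 : List ℕ := [1485512, 743432, 142845, 760163, 28960868, 4829177, 48285667, 2599159, 5226665, 1199563]
theorem c13_7_0 : chkRE 13 7 13 14 20 c13_7_J0 c13_7_S0 c13_7_H 0 5 = true := by decide +kernel
def c13_7_J1 : List (List ℕ) := [[1], [2], [3], [1, 1], [0, 3], [], [1, 2, 3], [1, 3], [2, 3], [2, 2], [0, 1], [3, 3], [0, 2], [1, 2, 4], [3, 3, 3], [1, 3, 4], [2, 4], [1, 3, 5], [0, 1, 4], [1, 1, 4], [2, 2, 4]]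
def c13_7_S1 : List ℕ := [1856635, 859, 57175, 28960868, 1199563, 535, 142845, 86191, 5226665, 760163]
theorem c13_7_1 : chkRE 13 7 13 14 20 c13_7_J1 c13_7_S1 c13_7_H 5 30 = true := by decide +kernel
theorem c13_7_2 : chkRE 13 7 13 14 20 c13_7_J1 c13_7_S1 c13_7_H 35 15 = true := by decide +kernel
def c13_7_J2 : List (List ℕ) := [[], [1], [3], [2], [0], [0, 0], [1, 2, 3], [0, 2], [2, 2], [1, 3, 4]]
def c13_7_S2 : List ℕ := [1856635, 57175, 859, 535, 1199563, 743432, 28960868, 86191, 508, 6592, 2199, 142845, 184]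
theorem c13_7_3 : chkRE 13 7 13 14 20 c13_7_J2 c13_7_S2 c13_7_H 50 33 = true := by decide +kernel
theorem c13_7_4 : chkRE 13 7 13 14 20 c13_7_J2 c13_7_S2 c13_7_H 83 37 = true := by decide +kernel
theorem c13_7_5 : chkRE 13 7 13 14 20 c13_7_J2 c13_7_S2 c13_7_H 120 41 = true := by decide +kernel
theorem c13_7_6 : chkRE 13 7 13 14 20 c13_7_J2 c13_7_S2 c13_7_H 161 30 = true := by decide +kernel
theorem c13_7_7 : chkRE 13 7 13 14 20 c13_7_J2 c13_7_S2 c13_7_H 191 46 = true := by decide +kernel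
theorem c13_7_8 : chkRE 13 7 13 14 20 c13_7_J2 c13_7_S2 c13_7_H 237 55 = true := by decide +kernel
theorem c13_7_9 : chkRE 13 7 13 14 20 c13_7_J2 c13_7_S2 c13_7_H 292 347 = true := by decide +kernel
theorem c13_7_E : Eng 13 7 1 true (2 % (13 - 1)) :=
  Cov.eng (S := 639) ((((((((((chkRE_spec c13_7_0).append (chkRE_spec c13_7_1)).append (chkRE_spec c13_7_2)).append (chkRE_spec c13_7_3)).append (chkRE_spec c13_7_4)).append (chkRE_spec c13_7_5)).append (chkRE_spec c13_7_6)).append (chkRE_spec c13_7_7)).append (chkRE_spec c13_7_8)).append (chkRE_spec c13_7_9)) (by norm_num)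


def c5_11_H : List (List ℕ) := [[11, 0, 0, 1, 1], [11, 0, 0, 4, 7]]
def c5_11_J0 : List (List ℕ) := [[0, 5], [3, 7], [3, 5], [2, 5], [1, 6], [2, 4], [3, 6], [2, 6], [4, 4], [4, 5], [2, 2, 6], [0, 3, 6], [1, 5], [2, 6, 6], [3, 3, 7], [3, 4, 4], [3, 3, 6], [5, 5, 5], [0, 3, 5], [2, 4, 4], [4, 4, 6], [2, 4, 5], [2, 3, 4], [3, 4, 6], [1, 2, 6], [2, 4, 6], [0, 1], [1, 3], [1, 4], [0, 1, 6], [0, 3, 7], [2, 2, 5], [3, 5, 5], [2, 4, 6, 8], [1, 2, 6, 7], [1, 3, 6, 9], [1, 4, 4, 4, 8, 8], [1, 1, 4, 4, 8, 8], [3, 3, 7, 7, 10, 10], [0, 1, 1, 2, 2, 3, 3], [1, 1, 6, 6, 7, 7], [2, 2, 5, 5, 8, 8], [2, 4, 4, 7, 7, 7], [1, 1, 1, 4, 7, 7, 7], [1, 1, 3, 4, 4, 5]]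
def c5_11_S0 : List ℕ := [29298151, 394026, 4140751, 6250011, 234631, 33131, 783151, 3953131, 78211, 406902, 93931, 9551, 47011, 2131, 1203151, 1955011, 1250011, 315631, 240631, 7031271, 393131, 1956, 797526, 34527]
theorem c5_11_0 : chkRE 5 11 13 12 18 c5_11_J0 c5_11_S0 c5_11_H 0 1 = true := by decide +kernel
def c5_11_J1 : List (List ℕ) := [[1, 4], [3, 3], [3, 7], [5, 5], [2, 4], [3, 6], [0, 4], [1, 6], [4, 6], [3, 4], [2, 6], [1, 3], [2, 5], [0, 3, 7], [2, 3, 3], [0, 5], [1, 3, 3], [3, 5], [2, 3, 6], [1, 1, 6], [0, 3, 6], [3, 6, 6], [2, 2, 2], [2, 5, 8], [1, 4, 7], [0, 2, 4], [1, 5, 7], [0, 0], [0, 1, 3], [4, 4, 6], [1, 1, 4], [0, 4, 7], [2, 6, 6], [1, 2], [1, 5], [0, 1, 6], [2, 2, 3], [0, 4, 6], [4, 6, 6], [1, 2, 4], [2, 3, 4], [1, 3, 7], [1, 3, 6, 9], [1, 2, 6, 7]]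
def c5_11_S1 : List ℕ := [312, 406901, 1955011, 1250011, 531, 393131, 6250011, 93931, 47011, 34527, 19687751, 1203151, 13131, 787551, 63751, 783151, 7031271]
theorem c5_11_1 : chkRE 5 11 13 12 18 c5_11_J1 c5_11_S1 c5_11_H 1 4 = true := by decide +kernel
def c5_11_J2 : List (List ℕ) := [[1, 2], [1, 3], [2, 3], [0, 2], [2, 6], [3, 5], [3, 3], [4, 4], [5, 5], [1, 5], [1, 4], [2, 4], [3, 7], [2, 2], [1, 6], [3, 6]]
def c5_11_S2 : List ℕ := [93781, 627, 1968881, 3151, 19687751, 6876, 393776, 3152, 628, 3953131, 78211, 32, 15632, 312, 235651, 76, 1250011, 78276, 1252, 33131, 7031271, 16876, 136, 16256, 4140751, 235016]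
theorem c5_11_2 : chkRE 5 11 13 12 18 c5_11_J2 c5_11_S2 c5_11_H 5 20 = true := by decide +kernel
theorem c5_11_3 : chkRE 5 11 13 12 18 c5_11_J2 c5_11_S2 c5_11_H 25 20 = true := by decide +kernel
theorem c5_11_4 : chkRE 5 11 13 12 18 c5_11_J2 c5_11_S2 c5_11_H 45 5 = true := by decide +kernel
def c5_11_J3 : List (List ℕ) := [[1, 1], [0, 1], [0, 0], [4, 4], [3, 3], [0, 4], [2, 2], [0, 3], [3], [3, 4], [], [0], [5, 5]]
def c5_11_S3 : List ℕ := [3751, 3127, 15631, 3126, 78251, 3131, 15751, 27, 1252, 131, 6876, 2131, 19687751, 1876, 652]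
theorem c5_11_5 : chkRE 5 11 13 12 18 c5_11_J3 c5_11_S3 c5_11_H 50 22 = true := by decide +kernel
theorem c5_11_6 : chkRE 5 11 13 12 18 c5_11_J3 c5_11_S3 c5_11_H 72 20 = true := by decide +kernel
theorem c5_11_7 : chkRE 5 11 13 12 18 c5_11_J3 c5_11_S3 c5_11_H 92 20 = true := by decide +kernel
theorem c5_11_8 : chkRE 5 11 13 12 18 c5_11_J3 c5_11_S3 c5_11_H 112 24 = true := by decide +kernel
theorem c5_11_9 : chkRE 5 11 13 12 18 c5_11_J3 c5_11_S3 c5_11_H 136 21 = true := by decide +kernel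
theorem c5_11_10 : chkRE 5 11 13 12 18 c5_11_J3 c5_11_S3 c5_11_H 157 21 = true := by decide +kernel
theorem c5_11_11 : chkRE 5 11 13 12 18 c5_11_J3 c5_11_S3 c5_11_H 178 22 = true := by decide +kernel
def c5_11_J4 : List (List ℕ) := [[], [0, 0], [0], [1, 1], [0, 1], [0, 0, 0], [3, 3]]
def c5_11_S4 : List ℕ := [27, 1251, 6251, 627, 1252, 127, 252, 3126, 752, 3151, 93876, 3176, 276, 78376, 15676, 16276]
theorem c5_11_12 : chkRE 5 11 13 12 18 c5_11_J4 c5_11_S4 c5_11_H 200 22 = true := by decide +kernel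
theorem c5_11_13 : chkRE 5 11 13 12 18 c5_11_J4 c5_11_S4 c5_11_H 222 31 = true := by decide +kernel
theorem c5_11_14 : chkRE 5 11 13 12 18 c5_11_J4 c5_11_S4 c5_11_H 253 21 = true := by decide +kernel
theorem c5_11_15 : chkRE 5 11 13 12 18 c5_11_J4 c5_11_S4 c5_11_H 274 22 = true := by decide +kernel
theorem c5_11_16 : chkRE 5 11 13 12 18 c5_11_J4 c5_11_S4 c5_11_H 296 95 = true := by decide +kernel
theorem c5_11_17 : chkRE 5 11 13 12 18 c5_11_J4 c5_11_S4 c5_11_H 391 24 = true := by decide +kernel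
theorem c5_11_18 : chkRE 5 11 13 12 18 c5_11_J4 c5_11_S4 c5_11_H 415 41 = true := by decide +kernel
theorem c5_11_19 : chkRE 5 11 13 12 18 c5_11_J4 c5_11_S4 c5_11_H 456 42 = true := by decide +kernel
theorem c5_11_20 : chkRE 5 11 13 12 18 c5_11_J4 c5_11_S4 c5_11_H 498 26 = true := by decide +kernel
theorem c5_11_21 : chkRE 5 11 13 12 18 c5_11_J4 c5_11_S4 c5_11_H 524 47 = true := by decide +kernel
theorem c5_11_22 : chkRE 5 11 13 12 18 c5_11_J4 c5_11_S4 c5_11_H 571 29 = true := by decide +kernel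
def c5_11_J5 : List (List ℕ) := [[]]
def c5_11_S5 : List ℕ := []
theorem c5_11_23 : chkRE 5 11 13 12 18 c5_11_J5 c5_11_S5 c5_11_H 600 891 = true := by decide +kernel
theorem c5_11_E : Eng 5 11 1 true (2 % (5 - 1)) :=
  Cov.eng (S := 1491) ((((((((((((((((((((((((chkRE_spec c5_11_0).append (chkRE_spec c5_11_1)).append (chkRE_spec c5_11_2)).append (chkRE_spec c5_11_3)).append (chkRE_spec c5_11_4)).append (chkRE_spec c5_11_5)).append (chkRE_spec c5_11_6)).append (chkRE_spec c5_11_7)).append (chkRE_spec c5_11_8)).append (chkRE_spec c5_11_9)).append (chkRE_spec c5_11_10)).append (chkRE_spec c5_11_11)).append (chkRE_spec c5_11_12)).append (chkRE_spec c5_11_13)).append (chkRE_spec c5_11_14)).append (chkRE_spec c5_11_15)).append (chkRE_spec c5_11_16)).append (chkRE_spec c5_11_17)).append (chkRE_spec c5_11_18)).append (chkRE_spec c5_11_19)).append (chkRE_spec c5_11_20)).append (chkRE_spec c5_11_21)).append (chkRE_spec c5_11_22)).append (chkRE_spec c5_11_23)) (by norm_num)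


def c3_13_H : List (List ℕ) := [[13, 0, 0, 1, 2], [13, 0, 0, 4, 9], [13, 0, 0, 1, 12], [13, 0, 0], [13, 0, 0, 2, 11], [13, 0, 0, 6, 6], [13, 0, 2, 5, 7], [13, 0, 0, 5, 8], [13, 0, 0, 6, 7], [13, 0, 0, 3, 10], [13, 0, 0, 3, 9], [13, 0, 0, 1, 8], [13, 0, 0, 2, 2], [13, 0, 0, 1, 1, 4, 4]]
def c3_13_J0 : List (List ℕ) := [[6], [4], [5], [3], [3, 6, 9], [3, 8], [2, 6, 8], [0, 3, 7], [0, 5, 7], [2, 4], [3, 3, 7], [3, 6, 6], [2, 6, 7], [1, 5, 9], [0, 3, 8], [3, 4, 7], [2, 5, 5], [2, 5, 9], [0, 3, 6], [4, 4, 7], [4, 4], [2, 4, 4], [1, 1, 5], [5, 7, 7], [2, 3, 6], [4, 4, 5], [1, 3, 8], [2, 5, 6], [2, 6, 9], [0, 2, 4], [0, 4, 8], [0, 2, 5], [2, 2, 4], [4, 4, 8], [1, 4, 6], [1, 5, 8], [3, 6, 7], [5, 5, 7], [4, 5, 6], [2, 2, 7], [1, 5, 7], [2, 5, 8], [1, 4],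 [3, 3, 4], [0, 2, 7]]
def c3_13_S0 : List ℕ := [2200, 6652, 739, 326, 352, 2278, 66430, 61321, 61489, 121, 20011, 8761, 183982, 24304, 148, 393670, 355186, 197086, 59554, 1068016, 26500, 118840, 20524, 7780, 796, 1228, 39883, 177910, 182254, 13942, 236236, 358924, 76, 4810]
theorem c3_13_0 : chkRE 3 13 13 11 17 c3_13_J0 c3_13_S0 c3_13_H 0 1 = true := by decide +kernel
def c3_13_J1 : List (List ℕ) := [[4], [3], [5], [6], [2], [1], [2, 5], [1, 2, 2], [1, 1, 3], [1, 2], [0, 3], [2, 2, 3], [2, 2], [3, 6, 9], [0, 2, 5], [3, 3, 5], [0, 4], [0, 1, 6], [3, 7], [0, 1, 3], [5, 5, 6], [0], [1, 1, 7], [4, 4, 7], [5, 5], [1, 2, 7], [1, 3], [3, 5], [3, 6, 6], [1, 3, 7], [2, 5, 8], [6, 6], [4, 8, 8], [2, 7], [2, 3, 8], [4, 4, 5], [2, 4, 7], [2, 2, 5], [1, 4, 8], [1, 5, 7]]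
def c3_13_S1 : List ℕ := [8761, 4618, 7, 1000, 86, 2192, 2926, 7318, 16, 2432, 19936, 38, 892, 6590, 64, 760]
theorem c3_13_1 : chkRE 3 13 13 11 17 c3_13_J1 c3_13_S1 c3_13_H 1 4 = true := by decide +kernel
def c3_13_J2 : List (List ℕ) := [[], [1], [2], [4], [5], [3], [6], [0], [0, 2], [0, 1], [0, 3], [0, 5], [5, 5], [1, 1], [1, 3], [4, 5], [1, 5, 9], [1, 5], [4, 4], [3, 6], [2, 6], [3, 7], [3, 6, 7], [5, 5, 6], [5, 7], [0, 6], [3, 4], [3, 6, 6], [2, 7], [2, 2, 6], [2, 4, 4], [4, 5, 7]]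
def c3_13_S2 : List ℕ := [6590, 19954, 19, 7300, 13204, 2206, 2434, 2242, 4402, 13, 254, 136, 6724, 20422, 20440, 98425, 40852, 2350, 55, 8830, 118840, 39379, 248, 326, 1468, 6646, 6832, 6811]
theorem c3_13_2 : chkRE 3 13 13 11 17 c3_13_J2 c3_13_S2 c3_13_H 5 13 = true := by decide +kernel
theorem c3_13_3 : chkRE 3 13 13 11 17 c3_13_J2 c3_13_S2 c3_13_H 18 2 = true := by decide +kernel
def c3_13_J3 : List (List ℕ) := [[], [0]]
def c3_13_S3 : List ℕ := [7, 2192, 31, 37, 1216, 490, 46, 4456, 247, 8, 86, 4402, 20440, 39883]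
theorem c3_13_4 : chkRE 3 13 13 11 17 c3_13_J3 c3_13_S3 c3_13_H 20 29 = true := by decide +kernel
theorem c3_13_5 : chkRE 3 13 13 11 17 c3_13_J3 c3_13_S3 c3_13_H 49 49 = true := by decide +kernel
theorem c3_13_E : Eng 3 13 1 true (2 % (3 - 1)) :=
  Cov.eng (S := 98) ((((((chkRE_spec c3_13_0).append (chkRE_spec c3_13_1)).append (chkRE_spec c3_13_2)).append (chkRE_spec c3_13_3)).append (chkRE_spec c3_13_4)).append (chkRE_spec c3_13_5)) (by norm_num)


def c61_5_H : List (List ℕ) := []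
def c61_5_J0 : List (List ℕ) := [[], [1, 2, 3], [1], [2], [1, 2], [1, 3], [1, 1]]
def c61_5_S0 : List ℕ := [63, 83083771, 84496471, 455732, 27697112, 60172292, 3460592, 3723, 227044, 3427412, 3479197]
theorem c61_5_0 : chkRE 61 5 13 14 20 c61_5_J0 c61_5_S0 c61_5_H 0 40 = true := by decide +kernel
theorem c61_5_1 : chkRE 61 5 13 14 20 c61_5_J0 c61_5_S0 c61_5_H 40 40 = true := by decide +kernel
theorem c61_5_2 : chkRE 61 5 13 14 20 c61_5_J0 c61_5_S0 c61_5_H 80 41 = true := by decide +kernel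
theorem c61_5_3 : chkRE 61 5 13 14 20 c61_5_J0 c61_5_S0 c61_5_H 121 42 = true := by decide +kernel
theorem c61_5_4 : chkRE 61 5 13 14 20 c61_5_J0 c61_5_S0 c61_5_H 163 43 = true := by decide +kernel
theorem c61_5_5 : chkRE 61 5 13 14 20 c61_5_J0 c61_5_S0 c61_5_H 206 43 = true := by decide +kernel
theorem c61_5_6 : chkRE 61 5 13 14 20 c61_5_J0 c61_5_S0 c61_5_H 249 47 = true := by decide +kernel
theorem c61_5_7 : chkRE 61 5 13 14 20 c61_5_J0 c61_5_S0 c61_5_H 296 49 = true := by decide +kernel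
theorem c61_5_8 : chkRE 61 5 13 14 20 c61_5_J0 c61_5_S0 c61_5_H 345 45 = true := by decide +kernel
theorem c61_5_9 : chkRE 61 5 13 14 20 c61_5_J0 c61_5_S0 c61_5_H 390 51 = true := by decide +kernel
theorem c61_5_10 : chkRE 61 5 13 14 20 c61_5_J0 c61_5_S0 c61_5_H 441 54 = true := by decide +kernel
theorem c61_5_11 : chkRE 61 5 13 14 20 c61_5_J0 c61_5_S0 c61_5_H 495 55 = true := by decide +kernel
theorem c61_5_12 : chkRE 61 5 13 14 20 c61_5_J0 c61_5_S0 c61_5_H 550 57 = true := by decide +kernel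
theorem c61_5_13 : chkRE 61 5 13 14 20 c61_5_J0 c61_5_S0 c61_5_H 607 60 = true := by decide +kernel
theorem c61_5_14 : chkRE 61 5 13 14 20 c61_5_J0 c61_5_S0 c61_5_H 667 60 = true := by decide +kernel
theorem c61_5_15 : chkRE 61 5 13 14 20 c61_5_J0 c61_5_S0 c61_5_H 727 75 = true := by decide +kernel
theorem c61_5_16 : chkRE 61 5 13 14 20 c61_5_J0 c61_5_S0 c61_5_H 802 917 = true := by decide +kernel
theorem c61_5_E : Eng 61 5 1 true (2 % (61 - 1)) :=
  Cov.eng (S := 1719) (((((((((((((((((chkRE_spec c61_5_0).append (chkRE_spec c61_5_1)).append (chkRE_spec c61_5_2)).append (chkRE_spec c61_5_3)).append (chkRE_spec c61_5_4)).append (chkRE_spec c61_5_5)).append (chkRE_spec c61_5_6)).append (chkRE_spec c61_5_7)).append (chkRE_spec c61_5_8)).append (chkRE_spec c61_5_9)).append (chkRE_spec c61_5_10)).append (chkRE_spec c61_5_11)).append (chkRE_spec c61_5_12)).append (chkRE_spec c61_5_13)).append (chkRE_spec c61_5_14)).append (chkRE_spec c61_5_15)).append (chkRE_spec c61_5_16))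 (by norm_num)


def c59_5_H : List (List ℕ) := []
def c59_5_J0 : List (List ℕ) := [[], [1, 2, 3], [1], [2], [1, 3], [1, 2], [1, 1]]
def c59_5_S0 : List ℕ := [61, 230240600, 76620292, 231068782, 5555736, 75805741, 27111150, 243168974, 3542, 7022, 205440]
theorem c59_5_0 : chkRE 59 5 13 14 20 c59_5_J0 c59_5_S0 c59_5_H 0 40 = true := by decide +kernel
theorem c59_5_1 : chkRE 59 5 13 14 20 c59_5_J0 c59_5_S0 c59_5_H 40 40 = true := by decide +kernel
theorem c59_5_2 : chkRE 59 5 13 14 20 c59_5_J0 c59_5_S0 c59_5_H 80 40 = true := by decide +kernel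
theorem c59_5_3 : chkRE 59 5 13 14 20 c59_5_J0 c59_5_S0 c59_5_H 120 42 = true := by decide +kernel
theorem c59_5_4 : chkRE 59 5 13 14 20 c59_5_J0 c59_5_S0 c59_5_H 162 42 = true := by decide +kernel
theorem c59_5_5 : chkRE 59 5 13 14 20 c59_5_J0 c59_5_S0 c59_5_H 204 45 = true := by decide +kernel
theorem c59_5_6 : chkRE 59 5 13 14 20 c59_5_J0 c59_5_S0 c59_5_H 249 47 = true := by decide +kernel
theorem c59_5_7 : chkRE 59 5 13 14 20 c59_5_J0 c59_5_S0 c59_5_H 296 49 = true := by decide +kernel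
theorem c59_5_8 : chkRE 59 5 13 14 20 c59_5_J0 c59_5_S0 c59_5_H 345 51 = true := by decide +kernel
theorem c59_5_9 : chkRE 59 5 13 14 20 c59_5_J0 c59_5_S0 c59_5_H 396 53 = true := by decide +kernel
theorem c59_5_10 : chkRE 59 5 13 14 20 c59_5_J0 c59_5_S0 c59_5_H 449 53 = true := by decide +kernel
theorem c59_5_11 : chkRE 59 5 13 14 20 c59_5_J0 c59_5_S0 c59_5_H 502 55 = true := by decide +kernel
theorem c59_5_12 : chkRE 59 5 13 14 20 c59_5_J0 c59_5_S0 c59_5_H 557 66 = true := by decide +kernel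
theorem c59_5_13 : chkRE 59 5 13 14 20 c59_5_J0 c59_5_S0 c59_5_H 623 60 = true := by decide +kernel
theorem c59_5_14 : chkRE 59 5 13 14 20 c59_5_J0 c59_5_S0 c59_5_H 683 74 = true := by decide +kernel
theorem c59_5_15 : chkRE 59 5 13 14 20 c59_5_J0 c59_5_S0 c59_5_H 757 748 = true := by decide +kernel
theorem c59_5_E : Eng 59 5 1 true (2 % (59 - 1)) :=
  Cov.eng (S := 1505) ((((((((((((((((chkRE_spec c59_5_0).append (chkRE_spec c59_5_1)).append (chkRE_spec c59_5_2)).append (chkRE_spec c59_5_3)).append (chkRE_spec c59_5_4)).append (chkRE_spec c59_5_5)).append (chkRE_spec c59_5_6)).append (chkRE_spec c59_5_7)).append (chkRE_spec c59_5_8)).append (chkRE_spec c59_5_9)).append (chkRE_spec c59_5_10)).append (chkRE_spec c59_5_11)).append (chkRE_spec c59_5_12)).append (chkRE_spec c59_5_13)).append (chkRE_spec c59_5_14)).append (chkRE_spec c59_5_15)) (by norm_num)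


def c53_5_H : List (List ℕ) := []
def c53_5_J0 : List (List ℕ) := [[], [1, 2, 3], [2], [1], [1, 2], [1, 3], [1, 1]]
def c53_5_S0 : List ℕ := [55, 50028291, 111376851, 907999, 189380025, 34106879, 346197, 148932, 148984, 2811, 102624060]
theorem c53_5_0 : chkRE 53 5 13 14 20 c53_5_J0 c53_5_S0 c53_5_H 0 40 = true := by decide +kernel
theorem c53_5_1 : chkRE 53 5 13 14 20 c53_5_J0 c53_5_S0 c53_5_H 40 40 = true := by decide +kernel
theorem c53_5_2 : chkRE 53 5 13 14 20 c53_5_J0 c53_5_S0 c53_5_H 80 42 = true := by decide +kernel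
theorem c53_5_3 : chkRE 53 5 13 14 20 c53_5_J0 c53_5_S0 c53_5_H 122 44 = true := by decide +kernel
theorem c53_5_4 : chkRE 53 5 13 14 20 c53_5_J0 c53_5_S0 c53_5_H 166 47 = true := by decide +kernel
theorem c53_5_5 : chkRE 53 5 13 14 20 c53_5_J0 c53_5_S0 c53_5_H 213 51 = true := by decide +kernel
theorem c53_5_6 : chkRE 53 5 13 14 20 c53_5_J0 c53_5_S0 c53_5_H 264 50 = true := by decide +kernel
theorem c53_5_7 : chkRE 53 5 13 14 20 c53_5_J0 c53_5_S0 c53_5_H 314 56 = true := by decide +kernel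
theorem c53_5_8 : chkRE 53 5 13 14 20 c53_5_J0 c53_5_S0 c53_5_H 370 67 = true := by decide +kernel
theorem c53_5_9 : chkRE 53 5 13 14 20 c53_5_J0 c53_5_S0 c53_5_H 437 545 = true := by decide +kernel
theorem c53_5_E : Eng 53 5 1 true (2 % (53 - 1)) :=
  Cov.eng (S := 982) ((((((((((chkRE_spec c53_5_0).append (chkRE_spec c53_5_1)).append (chkRE_spec c53_5_2)).append (chkRE_spec c53_5_3)).append (chkRE_spec c53_5_4)).append (chkRE_spec c53_5_5)).append (chkRE_spec c53_5_6)).append (chkRE_spec c53_5_7)).append (chkRE_spec c53_5_8)).append (chkRE_spec c53_5_9)) (by norm_num)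


def c47_5_H : List (List ℕ) := []
def c47_5_J0 : List (List ℕ) := [[], [1, 2, 3], [2], [1], [1, 2], [1, 3], [1, 1]]
def c47_5_S0 : List ℕ := [49, 25962378, 73206402, 59698273, 2258, 58764336, 4419, 103872, 103918, 4466, 2212]
theorem c47_5_0 : chkRE 47 5 13 14 20 c47_5_J0 c47_5_S0 c47_5_H 0 40 = true := by decide +kernel
theorem c47_5_1 : chkRE 47 5 13 14 20 c47_5_J0 c47_5_S0 c47_5_H 40 42 = true := by decide +kernel
theorem c47_5_2 : chkRE 47 5 13 14 20 c47_5_J0 c47_5_S0 c47_5_H 82 44 = true := by decide +kernel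
theorem c47_5_3 : chkRE 47 5 13 14 20 c47_5_J0 c47_5_S0 c47_5_H 126 48 = true := by decide +kernel
theorem c47_5_4 : chkRE 47 5 13 14 20 c47_5_J0 c47_5_S0 c47_5_H 174 52 = true := by decide +kernel
theorem c47_5_5 : chkRE 47 5 13 14 20 c47_5_J0 c47_5_S0 c47_5_H 226 58 = true := by decide +kernel
theorem c47_5_6 : chkRE 47 5 13 14 20 c47_5_J0 c47_5_S0 c47_5_H 284 325 = true := by decide +kernel
theorem c47_5_E : Eng 47 5 1 true (2 % (47 - 1)) :=
  Cov.eng (S := 609) (((((((chkRE_spec c47_5_0).append (chkRE_spec c47_5_1)).append (chkRE_spec c47_5_2)).append (chkRE_spec c47_5_3)).append (chkRE_spec c47_5_4)).append (chkRE_spec c47_5_5)).append (chkRE_spec c47_5_6)) (by norm_num)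


end PM

namespace PM

theorem cov_prime {p q : ℕ} (hp : p.Prime) (hqp : q < p) (hm : p % q = 0) (hq : q ≠ 1) : False := by
  rcases (Nat.dvd_prime hp).1 (Nat.dvd_of_mod_eq_zero hm) with h | h
  · exact hq h
  · omega

theorem lt_of_pow_bound {p n B : ℕ} (h : p ^ n ≤ 2 ^ 30) (hB : 2 ^ 30 < B ^ n) : p < B :=
  lt_of_pow_lt_pow_left₀ n (Nat.zero_le _) (lt_of_le_of_lt h hB)

theorem two_lt_pow {p n : ℕ} (hp : p.Prime) (hp2 : p ≠ 2) (hn : 2 ≤ n) : 2 < p ^ n - 1 := by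
  have h3 : 3 ≤ p := by have := hp.two_le; omega
  have h1 : 3 ^ 2 ≤ 3 ^ n := Nat.pow_le_pow_right (by norm_num) hn
  have h2 : 3 ^ n ≤ p ^ n := Nat.pow_le_pow_left h3 n
  omega

theorem known1 {F : Type*} [Field F] [Fintype F] {p k : ℕ} [Fact p.Prime] (hp2 : p ≠ 2) (_hb : p ^ 1 ≤ 2 ^ 30)
    (hF : Fintype.card F = p ^ 1) (hpl : Planar F k) : Known p 1 k := Known.one (n1_case hp2 hF hpl)

def tab2_0 : List Ent := [
  (3, 2, [], [], [])]

theorem tab2_0_ok : allL tab2_0 (chkPE 2) = true := by decide +kernel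

theorem cov2 : ∀ p < 4, 3 ≤ p → (∃ q ∈ [2], q < p ∧ p % q = 0) ∨ p ∈ tab2_0.map Prod.fst := by decide +kernel

theorem eng2 {p : ℕ} (hp : p.Prime) (hp2 : p ≠ 2) (hb : p < 4) :
    Eng p 2 1 true (2 % (p - 1)) := by
  have h3 : 3 ≤ p := by have := hp.two_le; omega
  rcases cov2 p hb h3 with ⟨q, hq, hqp, hm⟩ | h
  · exact (cov_prime hp hqp hm (by rintro rfl; revert hq; decide)).elim
  · exact tabP tab2_0_ok h

theorem known2 {F : Type*} [Field F] [Fintype F] {p k : ℕ} [Fact p.Prime] (hp2 : p ≠ 2) (_hb : p ^ 2 ≤ 2 ^ 30)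
    (hF : Fintype.card F = p ^ 2) (hpl : Planar F k) : Known p 2 k := by
  have hp : p.Prime := Fact.out
  by_cases h5 : 5 ≤ p
  · exact n2_case h5 hF hpl
  · have h4 : p ≠ 4 := by rintro rfl; revert hp; norm_num
    exact step_prime hp2 (by norm_num) (two_lt_pow hp hp2 (n := 2) (by norm_num)) hF hpl (eng2 hp hp2 (by omega))

def tab3_0 : List Ent := [
  (3, 4, [], [], [[3, 0, 0], [3, 0, 0, 1, 2]]), (5, 5, [[], [0, 1], [0, 2], [0, 0]], [], [[3, 0, 0, 1, 1]]), (7, 6,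
    [[], [0, 1, 2], [0, 0, 2], [0, 0, 0], [0, 1, 1], [0, 0, 1, 2]], [], []), (11, 8, [[], [1], [0, 1], [0, 2], [0, 0,
    2]], [496, 386], []), (13, 8, [[], [1], [0, 1], [0, 2], [0, 0, 2], [0, 0, 1, 1], [0, 0, 2, 2]], [1028, 703], []),
    (17, 9, [[], [1], [0, 1], [0, 2], [0, 0, 2], [0, 0, 1, 1], [0, 0, 2, 2]], [1769, 2330], []), (19, 9, [[], [1], [0,
    1], [0, 2], [0, 0, 2], [0, 0, 1, 1], [0, 0, 2, 2]], [2908, 2927], []), (23, 10, [[], [1], [0, 1], [0, 2], [0, 0,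
    2], [0, 0, 1, 1], [0, 0, 2, 2]], [5314], []), (29, 10, [[], [1], [0, 1], [0, 2], [0, 0, 2], [0, 0, 1, 1], [0, 0,
    2, 2]], [10151, 11804], []), (31, 10, [[], [1], [0, 1], [0, 2], [0, 0, 2], [0, 0, 1, 1], [0, 0, 2, 2]], [13486,
    13517], []), (37, 11, [[], [1], [0, 1], [0, 2], [0, 0, 2], [0, 0, 1, 1], [0, 0, 2, 2]], [22016], []), (41, 11,
    [[], [1], [0, 1], [0, 2], [0, 0, 2], [0, 0, 1, 1], [0, 0, 2, 2]], [30341, 33662], []), (43, 11, [[], [1], [0, 1],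
    [0, 2], [0, 0, 2], [0, 0, 1, 1], [0, 0, 2, 2]], [37024, 37067], []), (47, 12, [[], [1], [0, 1], [0, 2], [0, 0, 2],
    [0, 0, 1, 1], [0, 0, 2, 2]], [48646, 48693], []), (53, 12, [[], [1], [0, 1], [0, 2], [0, 0, 2], [0, 0, 1, 1], [0,
    0, 2, 2]], [67523], []), (59, 12, [[], [1], [0, 1], [0, 2], [0, 0, 2], [0, 0, 1, 1], [0, 0, 2, 2]], [97528,
    97587], []), (61, 12, [[], [1], [0, 1], [0, 2], [0, 0, 2], [0, 0, 1, 1], [0, 0, 2, 2]], [104311, 111692], []),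
    (67, 13, [[], [1], [0, 1], [0, 2], [0, 0, 2], [0, 0, 1, 1], [0, 0, 2, 2]], [11056], []), (71, 13, [[], [1], [0,
    1], [0, 2], [0, 0, 2], [0, 0, 1, 1], [0, 0, 2, 2]], [171466, 171537], []), (73, 13, [[], [1], [0, 1], [0, 2], [0,
    0, 2], [0, 0, 1, 1], [0, 0, 2, 2]], [181333, 191918], []), (79, 13, [[], [1], [0, 1], [0, 2], [0, 0, 2], [0, 0, 1,
    1], [0, 0, 2, 2]], [237238], []), (83, 13, [[], [1], [0, 1], [0, 2], [0, 0, 2], [0, 0, 1, 1], [0, 0, 2, 2]],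
    [275644, 275727], []), (89, 13, [[], [1], [0, 1], [0, 2], [0, 0, 2], [0, 0, 1, 1], [0, 0, 2, 2]], [332861,
    348614], []), (97, 13, [[], [1], [0, 2], [0, 1], [0, 0, 2], [0, 0, 1, 1], [0, 0, 2, 2]], [433009, 451730], []),
    (101, 13, [[], [1], [0, 1], [0, 2], [0, 0, 2], [0, 0, 1, 1], [0, 0, 2, 2]], [489851, 510152], []), (103, 13, [[],
    [1], [0, 1], [0, 2], [0, 0, 2], [0, 0, 1, 1], [0, 0, 2, 2]], [530554, 530657], []), (107, 13, [[], [1], [0, 1],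
    [0, 2], [0, 0, 2], [0, 0, 1, 1], [0, 0, 2, 2]], [595456], []), (109, 13, [[], [1], [0, 1], [0, 2], [0, 0, 2], [0,
    0, 1, 1], [0, 0, 2, 2]], [618031], []), (113, 13, [[], [1], [0, 1], [0, 2], [0, 0, 2], [0, 0, 1, 1], [0, 0, 2,
    2]], [689753, 715178], []), (127, 13, [[], [1], [0, 2], [0, 1], [0, 0, 2], [0, 0, 2, 2]], [1000126, 1000253], []),
    (131, 13, [[], [1], [0, 2], [0, 1], [0, 0, 2], [0, 0, 1, 1]], [1098436, 570506], []), (137, 13, [[], [1], [0, 2],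
    [0, 1], [0, 0, 2]], [1239029, 642805], []), (139, 13, [[], [1], [0, 2], [0, 1], [0, 0, 2]], [1313968, 680962],
    []), (149, 13, [[], [1], [0, 2], [0, 1], [0, 0, 2], [0, 0, 1, 1]], [1598920, 826951], []), (151, 13, [[], [1], [0,
    2], [0, 1], [0, 0, 2]], [56626, 872026], []), (157, 13, [[], [1], [0, 2], [0, 1], [0, 0, 1, 1], [0, 0, 2, 2]],
    [1873639, 1874110], []), (163, 13, [[], [1], [0, 1], [0, 2]], [2125684, 490], []), (167, 13, [[], [1], [0, 1], [0,
    2]], [2287066, 1178186], []), (173, 13, [[], [1], [0, 1], [0, 2], [0, 0, 2], [0, 0, 1, 1]], [2514383, 2583756],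
    []), (179, 13, [[], [1], [0, 1], [0, 2], [0, 0, 2]], [79656, 1449722], []), (181, 13, [[], [1], [0, 1], [0, 2],
    [0, 0, 1, 1], [0, 0, 2, 2]], [2883331, 2883874], []), (191, 13, [[], [1], [0, 1], [0, 2], [0, 0, 2]], [3429406,
    1760066], []), (193, 13, [[], [1], [0, 1], [0, 2], [0, 0, 2]], [3501793, 1797217], []), (197, 13, [[], [1], [0,
    1], [0, 2], [0, 0, 1, 1]], [3726059, 1911296], []), (199, 13, [[], [1], [0, 1], [0, 2]], [3881098, 1989802], []),
    (211, 13, [[], [1], [0, 1], [0, 2]], [4630396, 2370586], []), (223, 13, [[], [1], [0, 1], [0, 2], [0, 0, 1, 1]],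
    [5470414, 2797090], []), (227, 13, [[], [1], [0, 1], [0, 2]], [5771476, 2949866], []), (229, 13, [[], [1], [0, 1],
    [0, 2]], [5873851, 3002192], []), (233, 13, [[], [1], [0, 1], [0, 2], [0, 0, 1, 1]], [189430, 3162277], []), (239,
    13, [[], [1], [0, 1], [0, 2], [0, 0, 2]], [6740518, 6740757], []), (241, 13, [[], [1], [0, 1], [0, 2]], [6854041,
    3499321], []), (251, 13, [[], [1], [0, 2], [0, 1], [0, 0, 1, 1]], [7812376, 3984626], []), (257, 13, [[], [1], [0,
    1], [0, 2]], [8322689, 4243585], []), (263, 13, [[], [1], [0, 1], [0, 2]], [172266, 4582250], []), (269, 13, [[],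
    [1], [0, 1], [0, 2], [0, 0, 1, 1]], [9552191, 9720316], []), (271, 13, [[], [1], [0, 1], [0, 2], [0, 0, 2, 2]],
    [9841366, 9842721], []), (277, 13, [[], [1], [0, 2], [0, 1], [0, 0, 1, 1]], [10435699, 832], []), (281, 13, [[],
    [1], [0, 1], [0, 2]], [10897181, 5546941], []), (283, 13, [[], [1], [0, 1], [0, 2]], [11212744, 5706130], []),
    (293, 13, [[], [1], [0, 1], [0, 2]], [12362843, 6288368], []), (307, 13, [[], [1], [0, 1], [0, 2]], [14326156,
    7280506], []), (311, 13, [[], [1], [0, 1], [0, 2]], [14895346, 7568186], []), (313, 13, [[], [1], [0, 1], [0, 2]],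
    [15087853, 7665997], []), (317, 13, [[], [1], [0, 1], [0, 2]], [350920, 7963675], []), (331, 13, [[], [1], [0, 2],
    [0, 1]], [17968336, 9120706], []), (337, 13, [[], [1], [0, 2], [0, 1]], [18853129, 9568105], []), (347, 13, [[],
    [1], [0, 2], [0, 1]], [300156, 10505426], []), (349, 13, [[], [1], [0, 2], [0, 1]], [20950471, 10627052], []),
    (353, 13, [[], [1], [0, 2], [0, 1]], [21682673, 21683732], []), (359, 13, [[], [1], [0, 2], [0, 1]], [22941178,
    11631242], []), (367, 13, [[], [1], [0, 1], [0, 2], [0, 0, 2]], [24513766, 12424786], []), (373, 13, [[], [1], [0,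
    2], [0, 1]], [25600856, 12973687], []), (379, 13, [[], [1], [0, 2], [0, 1]], [27004888, 13681522], []), (383, 13,
    [[], [1], [0, 2], [0, 1]], [27871294, 14118530], []), (389, 13, [[], [1], [0, 2], [0, 1]], [29054411, 14715871],
    []), (397, 13, [[], [1], [0, 2], [0, 1], [0, 0, 2, 2]], [30892159, 30893350], []), (401, 13, [[], [1], [0, 1], [0,
    2]], [561802, 16120201], []), (409, 13, [[], [1], [0, 2], [0, 1]], [33791581, 17104381], []), (419, 13, [[], [1],
    [0, 1], [0, 2]], [36517108, 18477482], []), (421, 13, [[], [1], [0, 1], [0, 2]], [36866971, 18654512], []), (431,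
    13, [[], [1], [0, 1], [0, 2]], [463326, 20108306], []), (433, 13, [[], [1], [0, 1], [0, 2]], [40123513, 20295577],
    [])]

theorem tab3_0_ok : allL tab3_0 (chkPE 3) = true := by decide +kernel

def tab3_1 : List Ent := [
  (439, 13, [[], [1], [0, 1], [0, 2]], [42013618, 21247162], []), (443, 13, [[], [1], [0, 1], [0, 2]], [43175224,
    21832370], []), (449, 13, [[], [1], [0, 1], [0, 2]], [44756321, 22629601], []), (457, 13, [[], [1], [0, 1], [0,
    2]], [729830, 23860885], []), (461, 13, [[], [1], [0, 1], [0, 2], [0, 0, 2, 2]], [48455711, 48457094], []), (463,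
    13, [[], [1], [0, 1], [0, 2]], [49305334, 24920050], []), (467, 13, [[], [1], [0, 1], [0, 2]], [50597116,
    50599451], []), (479, 13, [[], [1], [0, 1], [0, 2]], [54607438, 27589922], []), (487, 13, [[], [1], [0, 1], [0,
    2]], [591706, 28993546], []), (491, 13, [[], [1], [0, 1], [0, 2]], [58824256, 29712866], []), (499, 13, [[], [1],
    [0, 1], [0, 2]], [61752748, 31187002], []), (503, 13, [[], [1], [0, 1], [0, 2]], [63252754, 31942010], []), (509,
    13, [[], [1], [0, 1], [0, 2]], [65289431, 32967932], []), (521, 13, [[], [1], [0, 1], [0, 2]], [70032821,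
    35355061], []), (523, 13, [[], [1], [0, 1], [0, 2]], [71118064, 35900290], []), (541, 13, [[], [1], [0, 1], [0,
    2]], [1023032, 39584971], []), (547, 13, [[], [1], [0, 1], [0, 2]], [81385396, 41066026], []), (557, 13, [[], [1],
    [0, 0, 1], [0, 2], [0, 1]], [85629839, 43202035], []), (563, 13, [[], [1], [0, 0, 1], [0, 2], [0, 1]], [88751884,
    44771450], []), (569, 13, [[], [1], [0, 0, 1], [0, 2], [0, 1]], [1131742, 46054861], []), (571, 13, [[], [1], [0,
    0, 1], [0, 2], [0, 1]], [813676, 46704946], []), (577, 13, [[], [1], [0, 0, 1], [0, 2], [0, 1]], [95218849,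
    48024865], []), (587, 13, [[], [1], [0, 1], [0, 2]], [100614736, 50737346], []), (593, 13, [[], [1], [0, 1], [0,
    2]], [103385993, 52131817], []), (599, 13, [[], [1], [0, 1], [0, 2]], [895506, 53909402], []), (601, 13, [[], [1],
    [0, 1], [0, 2]], [107639101, 54270301], []), (607, 13, [[], [1], [0, 1], [0, 2]], [111272206, 56095906], []),
    (613, 13, [[], [1], [0, 2], [0, 1]], [114235003, 57586447], []), (617, 13, [[], [1], [0, 1], [0, 2]], [116492069,
    58721125], []), (619, 13, [[], [1], [0, 1], [0, 2]], [118014208, 118017303], []), (631, 13, [[], [1], [0, 2], [0,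
    1]], [125023186, 63008506], []), (641, 13, [[], [1], [0, 2], [0, 1]], [130661441, 65843521], []), (643, 13, [[],
    [1], [0, 2], [0, 1]], [132304324, 66668170], []), (647, 13, [[], [1], [0, 2], [0, 1]], [134792746, 67918826], []),
    (653, 13, [[], [1], [0, 2], [0, 1]], [1490800, 69611107], []), (659, 13, [[], [1], [0, 2], [0, 1]], [142444828,
    71764442], []), (661, 13, [[], [1], [0, 2], [0, 1]], [143311411, 72201032], []), (673, 13, [[], [1], [0, 2], [0,
    1]], [151279633, 76205137], []), (677, 13, [[], [1], [0, 2], [0, 1]], [153999899, 77572016], []), (683, 13, [[],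
    [1], [0, 2], [0, 1]], [1164516, 79885730], []), (691, 13, [[], [1], [0, 2], [0, 1]], [164254156, 82723066], []),
    (701, 13, [[], [1], [0, 2], [0, 1]], [171008951, 86117852], []), (709, 13, [[], [1], [0, 2], [0, 1]], [1757612,
    89100031], []), (719, 13, [[], [1], [0, 2], [0, 1]], [185072758, 93181682], []), (727, 13, [[], [1], [0, 2], [0,
    1]], [191328226, 96323866], []), (733, 13, [[], [1], [0, 2], [0, 1]], [195574663, 195576862], []), (739, 13, [[],
    [1], [0, 2], [0, 1]], [1363456, 101168362], []), (743, 13, [[], [1], [0, 2], [0, 1]], [204258874, 102818570], []),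
    (751, 13, [[], [1], [0, 2], [0, 1]], [210937126, 106172626], []), (757, 13, [[], [1], [0, 2], [0, 1]], [215467939,
    108449336], []), (761, 13, [[], [1], [0, 2], [0, 1]], [218909261, 110177581], []), (769, 13, [[], [1], [0, 2], [0,
    1]], [225901441, 113688961], []), (773, 13, [[], [1], [0, 2], [0, 1]], [229452683, 115472288], []), (787, 13, [[],
    [1], [0, 2], [0, 1]], [242793436, 122169946], []), (797, 13, [[], [1], [0, 2], [0, 1]], [251544359, 126565196],
    []), (809, 13, [[], [1], [0, 2], [0, 1]], [263102981, 2428], []), (811, 13, [[], [1], [0, 2], [0, 1]], [265720096,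
    133681186], []), (821, 13, [[], [1], [0, 2], [0, 1]], [2357092, 138346711], []), (823, 13, [[], [1], [0, 2], [0,
    1]], [1691266, 139698490], []), (827, 13, [[], [1], [0, 2], [0, 1]], [281779576, 141743666], []), (829, 13, [[],
    [1], [0, 2], [0, 1]], [283144951, 142430492], []), (839, 13, [[], [1], [0, 2], [0, 1]], [294239818, 147998762],
    []), (853, 13, [[], [1], [0, 2], [0, 1]], [308507923, 155162408], []), (857, 13, [[], [1], [0, 2], [0, 1]],
    [312876989, 157355485], []), (859, 13, [[], [1], [0, 2], [0, 1]], [315813928, 158828242], []), (863, 13, [[], [1],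
    [0, 2], [0, 1]], [320251534, 161055650], []), (877, 13, [[], [1], [0, 2], [0, 1]], [2689760, 168631315], []),
    (881, 13, [[], [1], [0, 2], [0, 1]], [339960281, 170949241], []), (883, 13, [[], [1], [0, 2], [0, 1]], [343064044,
    172505530], []), (887, 13, [[], [1], [0, 2], [0, 1]], [347752786, 174858746], []), (907, 13, [[], [1], [0, 2], [0,
    1], [0, 0, 2]], [2054356, 186946306], []), (911, 13, [[], [1], [0, 2], [0, 1]], [376785046, 189428786], []), (919,
    13, [[], [1], [0, 2], [0, 1]], [386809858, 194459482], []), (929, 13, [[], [1], [0, 2], [0, 1]], [398726801,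
    200441041], []), (937, 13, [[], [1], [0, 2], [0, 1]], [409135429, 205664005], []), (941, 13, [[], [1], [0, 2], [0,
    1]], [414406991, 208309172], []), (947, 13, [[], [1], [0, 2], [0, 1]], [423294796, 212767226], []), (953, 13, [[],
    [1], [0, 2], [0, 1]], [430492973, 216380557], []), (967, 13, [[], [1], [0, 2], [0, 1]], [450713866, 226524586],
    []), (971, 13, [[], [1], [0, 2], [0, 1]], [456336016, 229345346], []), (977, 13, [[], [1], [0, 2], [0, 1]],
    [463903049, 233143465], []), (983, 13, [[], [1], [0, 2], [0, 1]], [473482594, 237947930], []), (991, 13, [[], [1],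
    [0, 2], [0, 1]], [2452726, 243800866], [])]

theorem tab3_1_ok : allL tab3_1 (chkPE 3) = true := by decide +kernel

def tab3_2 : List Ent := [
  (997, 13, [[], [1], [0, 2], [0, 1]], [493030459, 247756496], []), (1009, 13, [[], [1], [0, 2], [0, 1]], [511078681,
    256810681], []), (1013, 13, [[], [1], [0, 2], [0, 1]], [517191203, 259877048], []), (1019, 13, [[], [1], [0, 2],
    [0, 1]], [2593356, 265040882], []), (1021, 13, [[], [1], [0, 2], [0, 1]], [529562071, 266082812], [])]

theorem tab3_2_ok : allL tab3_2 (chkPE 3) = true := by decide +kernel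

theorem cov3 : ∀ p < 1025, 3 ≤ p → (∃ q ∈ [2, 3, 5, 7, 11, 13, 17, 19, 23, 29, 31], q < p ∧ p % q = 0) ∨ p ∈ tab3_0.map Prod.fst
    ∨ p ∈ tab3_1.map Prod.fst
    ∨ p ∈ tab3_2.map Prod.fst := by decide +kernel

theorem eng3 {p : ℕ} (hp : p.Prime) (hp2 : p ≠ 2) (hb : p < 1025) :
    Eng p 3 1 true (2 % (p - 1)) := by
  have h3 : 3 ≤ p := by have := hp.two_le; omega
  rcases cov3 p hb h3 with ⟨q, hq, hqp, hm⟩ | h | h | h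
  · exact (cov_prime hp hqp hm (by rintro rfl; revert hq; decide)).elim
  · exact tabP tab3_0_ok h
  · exact tabP tab3_1_ok h
  · exact tabP tab3_2_ok h

theorem known3 {F : Type*} [Field F] [Fintype F] {p k : ℕ} [Fact p.Prime] (hp2 : p ≠ 2) (hb : p ^ 3 ≤ 2 ^ 30)
    (hF : Fintype.card F = p ^ 3) (hpl : Planar F k) : Known p 3 k := by
  have hp : p.Prime := Fact.out
  have hlt : p < 1025 := lt_of_pow_bound hb (by norm_num)
  have hQ2 := two_lt_pow hp hp2 (n := 3) (by norm_num)
  exact step_prime hp2 (by norm_num) hQ2 hF hpl (eng3 hp hp2 hlt)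

def tab4_0 : List Ent := [
  (3, 4, [[]], [], [[4, 0, 0, 1, 1]]), (5, 5, [[], [1], [0, 3], [0, 0, 2, 3]], [], []), (7, 6, [[], [1], [0, 3]],
    [1429], []), (11, 7, [[], [1], [0, 3]], [10781], []), (13, 8, [[], [1], [0, 3]], [22153], []), (17, 9, [[], [1],
    [0, 3]], [69089], []), (19, 9, [[], [1], [0, 3]], [110125], []), (23, 10, [[], [1], [0, 3]], [243893], []), (29,
    10, [[], [1], [0, 3]], [634985], []), (31, 10, [[], [1], [0, 3]], [835141], []), (37, 11, [[], [1], [0, 3]],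
    [1723609], []), (41, 11, [[], [1], [0, 3]], [2620721], []), (43, 11, [[], [1], [0, 3]], [3182173], []), (47, 12,
    [[], [1], [0, 3]], [4570469], []), (53, 12, [[], [1], [0, 3]], [7446713], []), (59, 12, [[], [1], [0, 3]],
    [11504765], []), (61, 12, [[], [1], [0, 3]], [13168681], []), (67, 13, [[], [1], [0, 3]], [19253389], []), (71,
    13, [[], [1], [0, 3]], [24343061], []), (73, 13, [[], [1], [0, 3]], [27236593], []), (79, 13, [[], [1], [0, 3]],
    [37477285], []), (83, 13, [[], [1], [0, 3]], [45749933], []), (89, 13, [[], [1], [0, 3]], [60635345], []), (97,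
    13, [[], [1]], [875329], [])]

theorem tab4_0_ok : allL tab4_0 (chkCE 4 2) = true := by decide +kernel

def tab4_1 : List Ent := [
  (101, 13, [[], [1]], [989801], []), (103, 13, [[], [1], [0, 3]], [109283413], []), (107, 13, [[], [1], [0, 3]],
    [127416029], []), (109, 13, [[], [1]], [1247833], []), (113, 13, [[], [1], [0, 3]], [158731553], []), (127, 13,
    [[], [1], [0, 3]], [254015749], []), (131, 13, [[], [1]], [2179841], []), (137, 13, [[], [1]], [2496689], []),
    (139, 13, [[], [1], [0, 3]], [365263645], []), (149, 13, [[], [1]], [3219593], []), (151, 13, [[], [1]],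
    [3352201], []), (157, 13, [[], [1]], [3771769], []), (163, 13, [[], [1]], [4224961], []), (167, 13, [[], [1]],
    [4546409], []), (173, 13, [[], [1]], [5058521], []), (179, 13, [[], [1]], [5607713], []), (181, 13, [[], [1]],
    [5799241], [])]

theorem tab4_1_ok : allL tab4_1 (chkCE 4 2) = true := by decide +kernel

theorem cov4 : ∀ p < 182, 3 ≤ p → (∃ q ∈ [2, 3, 5, 7, 11, 13], q < p ∧ p % q = 0) ∨ p ∈ tab4_0.map Prod.fst
    ∨ p ∈ tab4_1.map Prod.fst := by decide +kernel

theorem eng4 {p : ℕ} (hp : p.Prime) (hp2 : p ≠ 2) (hb : p < 182) :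
    (∀ i < 2, 2 * i ≤ 2 → Odd (2 / Nat.gcd i 2) → Eng p 4 2 false ((p ^ i + 1) % (p ^ 2 - 1))) ∧
    (p = 3 → ∀ i < 2, 2 ≤ i → Nat.gcd i (2 * 2) = 1 → Eng p 4 2 false (((3 ^ i + 1) / 2) % (3 ^ 2 - 1))) := by
  have h3 : 3 ≤ p := by have := hp.two_le; omega
  rcases cov4 p hb h3 with ⟨q, hq, hqp, hm⟩ | h | h
  · exact (cov_prime hp hqp hm (by rintro rfl; revert hq; decide)).elim
  · exact tabC tab4_0_ok h
  · exact tabC tab4_1_ok h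

theorem known4 {F : Type*} [Field F] [Fintype F] {p k : ℕ} [Fact p.Prime] (hp2 : p ≠ 2) (hb : p ^ 4 ≤ 2 ^ 30)
    (hF : Fintype.card F = p ^ 4) (hpl : Planar F k) : Known p 4 k := by
  have hp : p.Prime := Fact.out
  have hlt : p < 182 := lt_of_pow_bound hb (by norm_num)
  have hQ2 := two_lt_pow hp hp2 (n := 4) (by norm_num)
  obtain ⟨E, _, _, hcE, hplE⟩ := hpl.descend (by norm_num) hF (show 2 ∣ 4 by norm_num) (by norm_num)
  exact step_comp hp2 (by norm_num) hQ2 hF hpl 2 (by norm_num)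
    (known2 hp2 (le_trans (Nat.pow_le_pow_right hp.pos (by norm_num)) hb) hcE hplE) (eng4 hp hp2 hlt).1 (eng4 hp hp2 hlt).2

def tab5_0 : List Ent := [
  (3, 7, [[], [0]], [4, 10], [[5, 0, 0, 1, 4], [5, 0, 0, 1, 2], [5, 0, 0, 2, 2], [5, 0, 0], [5, 0, 0, 2, 3], [5, 0, 0,
    1, 1], [5, 0, 0, 1, 1, 2, 2]]), (5, 10, [[], [0, 4], [0, 2], [0, 1], [0, 3], [1, 3], [0], [0, 0], [2], [1, 2], [0,
    0, 0], [0, 2, 4]], [], [[5, 0, 0, 2, 3], [5, 0, 0, 1, 1]]), (7, 12, [[], [0, 2, 2], [0, 0, 3], [0, 2, 3], [0, 0,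
    2], [0, 1, 3], [1, 2, 3], [0, 1, 2], [0, 1], [0, 0, 1, 3], [0, 1, 1], [0, 0, 3, 4]], [], []), (11, 13, [[], [2],
    [1], [1, 2], [1, 3], [0, 3], [0, 2], [0, 4], [0, 0], [0, 1], [0], [0, 1, 2], [0, 1, 3], [0, 2, 4], [0, 3, 4], [0,
    0, 1, 2], [0, 0, 3], [0, 1, 2, 2], [0, 0, 3, 4], [0, 0, 3, 3], [0, 0, 0, 0], [0, 0, 2, 4], [0, 0, 2, 2], [0, 1, 1,
    3], [0, 0, 4], [0, 0, 1, 4], [0, 1, 1, 4], [0, 2, 3], [0, 0, 0, 4], [0, 0, 1, 1], [0, 0, 1, 3], [0, 1, 1, 2]],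
    [1376, 277, 386, 4126, 5358, 44540], []), (13, 13, [[], [2], [1], [1, 2], [1, 3], [0, 4], [0, 3], [0, 2], [0, 2,
    4], [0, 1, 2], [0, 1, 3], [0, 1], [0, 3, 4], [0, 0, 3, 4], [1, 2, 3], [0, 0, 3], [0, 0, 2], [0, 0, 1, 4], [0, 1,
    2, 2], [0, 0, 0, 3], [0, 0, 2, 2], [0, 1, 1, 3], [0, 0, 2, 4], [0, 0, 3, 3], [0, 0, 1, 2]], [703, 2263, 8815,
    257063, 173603], []), (17, 13, [[], [2], [1], [1, 2], [1, 3], [0, 2], [0, 3], [0, 4], [0, 1, 2], [0, 3, 4], [0, 1,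
    3], [0, 2, 4], [0, 0, 3, 4], [0, 1], [0, 1, 2, 2], [0, 0, 3], [0, 2, 3], [0, 0, 2, 4], [0, 0, 2, 2], [0, 1, 1,
    3]], [501161, 24634, 25434, 938, 418490], []), (19, 13, [[], [2], [1], [1, 2], [1, 3], [0, 2], [0, 3], [0, 0, 3],
    [0, 1, 3], [0, 1, 2], [0, 3, 4], [0, 1], [0, 2, 4], [0, 0, 2, 2], [0, 0, 4], [1, 2, 3], [0, 0, 1, 3], [0, 0, 1,
    4], [0, 0, 2, 4], [0, 0, 3, 4]], [912628, 35740, 41231, 15904, 392788], []), (23, 13, [[], [2], [1], [1, 2], [1,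
    3], [0, 3], [0, 2], [0, 4], [0, 0], [0, 2, 4], [0, 0, 1, 2], [1, 2, 3], [0, 1, 1, 2], [0, 1, 3], [0, 3, 4], [0, 1,
    2]], [1402380, 13410, 15986, 2802160, 137799], []), (29, 13, [[], [2], [1], [1, 2], [1, 3], [0, 2], [0, 3], [0, 1,
    2], [0, 3, 4], [0, 0, 2], [0, 4], [0, 0, 2, 4], [0, 2, 4], [0, 1, 3]], [5251, 294351, 2909020, 1658598, 3543163],
    []), (31, 13, [[], [2], [1, 3], [1], [1, 2], [0, 4], [0, 1], [1, 2, 3], [0, 2, 2, 4], [0, 1, 3], [0, 3, 4], [0,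
    3], [0, 1, 2], [0, 1, 4]], [9326506, 5779457, 238546, 1996246, 330616], []), (37, 13, [[], [2], [1], [1, 2], [1,
    3], [0, 2], [0, 3], [0, 0, 1, 3], [0, 0, 2, 4], [0, 0, 0], [0, 4], [0, 1, 2], [0, 3, 4]], [101899, 461539, 17984,
    17379457, 269731], [])]

theorem tab5_0_ok : allL tab5_0 (chkPE 5) = true := by decide +kernel

def tab5_1 : List Ent := [
  (41, 13, [[], [1, 2, 3], [1], [2], [1, 2], [1, 3], [0, 4], [0, 3], [0, 2, 4], [0, 1, 2], [0, 1, 3], [0, 1]],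
    [31359181, 768341, 11992501, 36740347, 50870464, 435421], [])]

theorem tab5_1_ok : allL tab5_1 (chkPE 5) = true := by decide +kernel

def tab5_2 : List Ent := [
  (43, 13, [[], [2], [1, 3], [1], [1, 2], [0, 4], [0, 1], [0, 1, 1, 2], [0, 0, 1, 2], [0, 1, 3], [0, 3, 4], [0, 3]],
    [264580, 20531512, 47874395, 98428, 502972, 1516224, 20538736], [])]

theorem tab5_2_ok : allL tab5_2 (chkPE 5) = true := by decide +kernel

theorem cov5 : ∀ p < 65, 3 ≤ p → (∃ q ∈ [2, 3, 5, 7], q < p ∧ p % q = 0) ∨ p ∈ tab5_0.map Prod.fst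
    ∨ p ∈ tab5_1.map Prod.fst
    ∨ p ∈ tab5_2.map Prod.fst
    ∨ p = 47
    ∨ p = 53
    ∨ p = 59
    ∨ p = 61 := by decide +kernel

theorem eng5 {p : ℕ} (hp : p.Prime) (hp2 : p ≠ 2) (hb : p < 65) :
    Eng p 5 1 true (2 % (p - 1)) := by
  have h3 : 3 ≤ p := by have := hp.two_le; omega
  rcases cov5 p hb h3 with ⟨q, hq, hqp, hm⟩ | h | h | h | rfl | rfl | rfl | rfl
  · exact (cov_prime hp hqp hm (by rintro rfl; revert hq; decide)).elim
  · exact tabP tab5_0_ok h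
  · exact tabP tab5_1_ok h
  · exact tabP tab5_2_ok h
  · exact c47_5_E
  · exact c53_5_E
  · exact c59_5_E
  · exact c61_5_E

theorem known5 {F : Type*} [Field F] [Fintype F] {p k : ℕ} [Fact p.Prime] (hp2 : p ≠ 2) (hb : p ^ 5 ≤ 2 ^ 30)
    (hF : Fintype.card F = p ^ 5) (hpl : Planar F k) : Known p 5 k := by
  have hp : p.Prime := Fact.out
  have hlt : p < 65 := lt_of_pow_bound hb (by norm_num)
  have hQ2 := two_lt_pow hp hp2 (n := 5) (by norm_num)
  exact step_prime hp2 (by norm_num) hQ2 hF hpl (eng5 hp hp2 hlt)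

def tab6_0 : List Ent := [
  (3, 5, [[]], [10, 19, 163], [[6, 0, 0, 1, 1]]), (5, 7, [[], [2], [2, 4], [0, 4], [0, 0, 1, 3], [0, 0, 3, 5], [0, 4,
    5]], [], []), (7, 9, [[], [2], [2, 4], [0, 4], [0, 4, 5]], [67285, 1135], []), (11, 11, [[], [2], [2, 4], [1], [0,
    4], [0, 4, 5]], [1288541, 9571], []), (13, 12, [[], [2], [2, 4], [1], [0, 4], [0, 4, 5]], [3713113, 20125], []),
    (17, 13, [[], [2], [2, 4], [1], [0, 0, 4, 5]], [19878305, 64465], []), (19, 13, [[], [2], [2, 4], [1], [0, 4]],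
    [39617965, 103627], []), (23, 13, [[], [2], [2, 4], [1], [0, 4]], [232784, 128727413], []), (29, 13, [[], [2], [2,
    4], [0, 4, 5]], [611437, 533290745], []), (31, 13, [[], [2], [2, 4], [1], [0, 4, 5]], [806311, 801617221], [])]

theorem tab6_0_ok : allL tab6_0 (chkCE 6 3) = true := by decide +kernel

theorem cov6 : ∀ p < 33, 3 ≤ p → (∃ q ∈ [2, 3, 5], q < p ∧ p % q = 0) ∨ p ∈ tab6_0.map Prod.fst := by decide +kernel

theorem eng6 {p : ℕ} (hp : p.Prime) (hp2 : p ≠ 2) (hb : p < 33) :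
    (∀ i < 3, 2 * i ≤ 3 → Odd (3 / Nat.gcd i 3) → Eng p 6 3 false ((p ^ i + 1) % (p ^ 3 - 1))) ∧
    (p = 3 → ∀ i < 3, 2 ≤ i → Nat.gcd i (2 * 3) = 1 → Eng p 6 3 false (((3 ^ i + 1) / 2) % (3 ^ 3 - 1))) := by
  have h3 : 3 ≤ p := by have := hp.two_le; omega
  rcases cov6 p hb h3 with ⟨q, hq, hqp, hm⟩ | h
  · exact (cov_prime hp hqp hm (by rintro rfl; revert hq; decide)).elim
  · exact tabC tab6_0_ok h

theorem known6 {F : Type*} [Field F] [Fintype F] {p k : ℕ} [Fact p.Prime] (hp2 : p ≠ 2) (hb : p ^ 6 ≤ 2 ^ 30)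
    (hF : Fintype.card F = p ^ 6) (hpl : Planar F k) : Known p 6 k := by
  have hp : p.Prime := Fact.out
  have hlt : p < 33 := lt_of_pow_bound hb (by norm_num)
  have hQ2 := two_lt_pow hp hp2 (n := 6) (by norm_num)
  obtain ⟨E, _, _, hcE, hplE⟩ := hpl.descend (by norm_num) hF (show 3 ∣ 6 by norm_num) (by norm_num)
  exact step_comp hp2 (by norm_num) hQ2 hF hpl 3 (by norm_num)
    (known3 hp2 (le_trans (Nat.pow_le_pow_right hp.pos (by norm_num)) hb) hcE hplE) (eng6 hp hp2 hlt).1 (eng6 hp hp2 hlt).2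

def tab7_0 : List Ent := [
  (3, 11, [[], [0], [0, 1, 5], [0, 5, 6], [0, 0, 3], [0, 0, 4], [0, 1, 1], [0, 1, 3], [0, 1, 4], [0, 2, 4], [0, 2, 6],
    [1, 2, 4], [1, 2, 5], [0, 1, 2], [0, 1, 6], [0, 2, 3], [0, 2, 5], [0, 3, 5], [0, 3, 6], [0, 0, 0], [0, 2, 2], [0,
    3, 4], [0, 4, 5], [0, 4, 6]], [10, 4, 13, 85, 28, 487, 31, 247, 19, 55, 163], [[7, 0, 0, 2, 5], [7, 0, 0, 1, 2],
    [7, 0, 0, 3, 4], [7, 0, 0, 1, 1], [7, 0, 0, 3, 3], [7, 0, 0, 2, 2], [7, 0, 0], [7, 0, 0, 1, 6], [7, 0, 0, 1, 5],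
    [7, 0, 1, 3, 5], [7, 0, 0, 1, 1, 5, 5], [7, 0, 0, 1, 1, 2, 3], [7, 0, 0, 1, 1, 4, 4], [7, 0, 0, 1, 1, 2, 5], [7,
    0, 0, 1, 1, 3, 3], [7, 0, 0, 1, 1, 3, 4]]), (5, 13, [[], [0, 4], [0, 5], [0, 3], [1, 2], [1, 5], [1, 3], [2, 4],
    [2], [0, 0], [1, 4], [0], [0, 1], [3], [0, 3, 5], [0, 3, 6], [1, 2, 4, 5], [0, 2, 4], [0, 5, 6], [0, 2], [0, 0, 2,
    3], [0, 3, 3, 6]], [47131, 47511, 431], [[7, 0, 0, 2, 5], [7, 0, 0, 1, 1]]), (7, 13, [[], [2], [1], [3], [1, 2,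
    5], [0, 3, 4], [0, 2, 4], [1, 3, 5], [0, 3, 5], [0, 2, 5], [1, 2, 4], [0, 2, 6], [0, 0, 3, 3], [0, 0, 5], [0, 0,
    0], [0, 5, 6], [1, 3, 4], [0, 1, 4], [0, 1, 1, 2], [0, 3, 3, 6]], [235355, 353158, 67390, 28834, 84190], [])]

theorem tab7_0_ok : allL tab7_0 (chkPE 7) = true := by decide +kernel

def tab7_1 : List Ent := [
  (11, 13, [[], [2], [3], [1], [1, 5], [1, 3], [0, 2], [1, 3, 5], [0, 3], [0, 4], [1, 2, 3], [0, 5], [1, 2], [2, 4],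
    [0, 0, 6], [0, 2, 6], [0, 1], [0, 6], [0, 3, 3, 6], [1, 2, 4], [1, 2, 5], [0, 0, 4], [1, 3, 4], [0, 4, 5, 6], [0,
    1, 3, 5], [0, 1, 2, 3], [0, 1, 4, 5], [0, 2, 4, 6], [0, 2, 3, 6]], [58576, 44166, 326096, 7087576, 386, 2697,
    483517, 1090, 29316, 2740, 12078826, 102499, 644447], [])]

theorem tab7_1_ok : allL tab7_1 (chkPE 7) = true := by decide +kernel

theorem cov7 : ∀ p < 20, 3 ≤ p → (∃ q ∈ [2, 3], q < p ∧ p % q = 0) ∨ p ∈ tab7_0.map Prod.fst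
    ∨ p ∈ tab7_1.map Prod.fst
    ∨ p = 13
    ∨ p = 17
    ∨ p = 19 := by decide +kernel

theorem eng7 {p : ℕ} (hp : p.Prime) (hp2 : p ≠ 2) (hb : p < 20) :
    Eng p 7 1 true (2 % (p - 1)) := by
  have h3 : 3 ≤ p := by have := hp.two_le; omega
  rcases cov7 p hb h3 with ⟨q, hq, hqp, hm⟩ | h | h | rfl | rfl | rfl
  · exact (cov_prime hp hqp hm (by rintro rfl; revert hq; decide)).elim
  · exact tabP tab7_0_ok h
  · exact tabP tab7_1_ok h
  · exact c13_7_E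
  · exact c17_7_E
  · exact c19_7_E

theorem known7 {F : Type*} [Field F] [Fintype F] {p k : ℕ} [Fact p.Prime] (hp2 : p ≠ 2) (hb : p ^ 7 ≤ 2 ^ 30)
    (hF : Fintype.card F = p ^ 7) (hpl : Planar F k) : Known p 7 k := by
  have hp : p.Prime := Fact.out
  have hlt : p < 20 := lt_of_pow_bound hb (by norm_num)
  have hQ2 := two_lt_pow hp hp2 (n := 7) (by norm_num)
  exact step_prime hp2 (by norm_num) hQ2 hF hpl (eng7 hp hp2 hlt)

def tab8_0 : List Ent := [
  (3, 7, [[], [1, 3, 5], [0, 2, 3], [0, 2, 7], [0, 3, 6], [0, 6, 7], [1, 2, 6], [0, 0, 3, 5], [0, 0, 0, 0], [0, 0, 0,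
    3], [0, 0, 0, 6], [0, 1, 1, 3], [0, 1, 1, 7], [0, 1, 2, 4], [0, 1, 3, 4], [0, 1, 3, 7], [0, 1, 4, 7], [0, 1, 5,
    6], [0, 1, 5, 7], [0, 2, 3, 4], [0, 2, 3, 7], [0, 2, 4, 5], [0, 2, 4, 7], [0, 3, 4, 5], [0, 3, 4, 6], [0, 3, 4,
    7], [0, 4, 5, 6], [0, 4, 6, 7], [1, 2, 4, 5]], [253, 28, 13, 85, 19, 487], [[8, 0, 0, 4, 4], [8, 0, 0, 1, 4], [8,
    0, 1, 3, 4], [8, 0, 0, 1, 2, 2, 3]]), (5, 10, [[], [3], [2], [1], [0, 0, 3, 4], [0, 0, 2, 3], [0, 2, 3, 5], [1,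
    6], [0, 0, 4, 5]], [47521], []), (7, 12, [[], [3], [2], [1], [1, 3, 6], [0, 5], [0, 6], [1, 3], [0, 2, 5], [1, 6],
    [0, 2, 2, 5], [0, 2, 5, 7]], [12013, 253, 60097], []), (11, 13, [[], [3], [2], [1], [1, 2, 3], [0, 2, 5, 5], [1,
    3], [0, 5], [0, 1, 6]], [131781, 991, 6711, 893281], []), (13, 13, [[], [3], [2], [1, 2, 3], [1], [0, 5], [1, 2]],
    [22309, 314185, 1873, 13261, 2428273, 4394], [])]

theorem tab8_0_ok : allL tab8_0 (chkCE 8 4) = true := by decide +kernel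

theorem cov8 : ∀ p < 14, 3 ≤ p → (∃ q ∈ [2, 3], q < p ∧ p % q = 0) ∨ p ∈ tab8_0.map Prod.fst := by decide +kernel

theorem eng8 {p : ℕ} (hp : p.Prime) (hp2 : p ≠ 2) (hb : p < 14) :
    (∀ i < 4, 2 * i ≤ 4 → Odd (4 / Nat.gcd i 4) → Eng p 8 4 false ((p ^ i + 1) % (p ^ 4 - 1))) ∧
    (p = 3 → ∀ i < 4, 2 ≤ i → Nat.gcd i (2 * 4) = 1 → Eng p 8 4 false (((3 ^ i + 1) / 2) % (3 ^ 4 - 1))) := by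
  have h3 : 3 ≤ p := by have := hp.two_le; omega
  rcases cov8 p hb h3 with ⟨q, hq, hqp, hm⟩ | h
  · exact (cov_prime hp hqp hm (by rintro rfl; revert hq; decide)).elim
  · exact tabC tab8_0_ok h

theorem known8 {F : Type*} [Field F] [Fintype F] {p k : ℕ} [Fact p.Prime] (hp2 : p ≠ 2) (hb : p ^ 8 ≤ 2 ^ 30)
    (hF : Fintype.card F = p ^ 8) (hpl : Planar F k) : Known p 8 k := by
  have hp : p.Prime := Fact.out
  have hlt : p < 14 := lt_of_pow_bound hb (by norm_num)
  have hQ2 := two_lt_pow hp hp2 (n := 8) (by norm_num)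
  obtain ⟨E, _, _, hcE, hplE⟩ := hpl.descend (by norm_num) hF (show 4 ∣ 8 by norm_num) (by norm_num)
  exact step_comp hp2 (by norm_num) hQ2 hF hpl 4 (by norm_num)
    (known4 hp2 (le_trans (Nat.pow_le_pow_right hp.pos (by norm_num)) hb) hcE hplE) (eng8 hp hp2 hlt).1 (eng8 hp hp2 hlt).2

def tab9_0 : List Ent := [
  (3, 10, [[], [0], [1, 4, 5], [0, 0, 4], [0, 4, 8], [1, 2, 4], [0, 1, 5], [1, 2, 5], [1, 2, 6], [0, 1, 6], [0, 5, 6],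
    [0, 4, 7], [2, 4, 6], [0, 5, 7], [1, 2, 7], [0, 4, 5], [0, 7, 8], [0, 0, 5], [1, 2, 3], [1, 3, 5], [1, 3, 6], [1,
    4, 7], [0, 1, 8], [0, 1, 4], [0, 2, 3], [0, 2, 5], [0, 2, 6], [0, 6, 7], [1, 3, 4], [0, 2, 7], [0, 2, 8], [0, 4,
    4], [1, 4, 6], [0, 3, 3, 7], [0, 1, 3], [0, 2, 2], [0, 3, 4], [0, 3, 5], [0, 3, 6], [0, 3, 7]], [13123, 4, 739,
    10, 2209, 436, 2326, 13213], [[9, 0, 0, 3, 4], [9, 0, 0, 4, 5], [9, 0, 0, 1, 1], [9, 0, 0, 2, 2], [9, 0, 0, 1, 6],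
    [9, 0, 0, 1, 1, 4, 4], [9, 0, 0, 2, 2, 4, 4], [9, 0, 0, 1, 1, 5, 5], [9, 0, 0, 1, 1, 2, 4], [9, 0, 0, 1, 1, 2,
    2]])]

theorem tab9_0_ok : allL tab9_0 (chkCE 9 3) = true := by decide +kernel

def tab9_1 : List Ent := [
  (5, 13, [[], [0, 6], [0, 3], [3], [2, 6], [1, 3], [2, 4], [2, 5], [1, 5], [0, 2], [4], [0, 4], [0, 5], [1, 4], [0,
    7], [0, 7, 8], [0, 1, 5], [1, 2, 3], [0, 1, 3, 5], [0, 5, 6, 7], [1, 7], [1, 2, 6], [0, 0], [0, 2, 4, 6], [0, 0,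
    4, 5], [0, 3, 4, 8]], [968751, 37511, 781511, 38751, 783151, 1331, 1562531, 781331, 78631, 65636, 16256, 15911],
    []), (7, 13, [[], [3], [0, 4, 7], [0, 4, 4], [0, 1, 4], [0, 1, 7], [1, 3, 4], [0, 0, 5], [0, 0, 3], [0, 3, 7], [1,
    2, 5], [0, 3, 4, 5], [0, 2, 4, 6], [0, 6, 7], [0, 2, 3], [0, 0, 6, 6]], [11529610, 2504244, 2471316, 3378208,
    2470679, 588268, 7402, 197, 1912, 12202, 50452, 3294418, 379, 4470664, 67264, 226, 706582, 34588835, 67474,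
    353242, 13378, 227, 1086, 118114, 466, 856, 237749, 2796, 598], [])]

theorem tab9_1_ok : allL tab9_1 (chkCE 9 3) = true := by decide +kernel

theorem cov9 : ∀ p < 11, 3 ≤ p → (∃ q ∈ [2, 3], q < p ∧ p % q = 0) ∨ p ∈ tab9_0.map Prod.fst
    ∨ p ∈ tab9_1.map Prod.fst := by decide +kernel

theorem eng9 {p : ℕ} (hp : p.Prime) (hp2 : p ≠ 2) (hb : p < 11) :
    (∀ i < 3, 2 * i ≤ 3 → Odd (3 / Nat.gcd i 3) → Eng p 9 3 false ((p ^ i + 1) % (p ^ 3 - 1))) ∧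
    (p = 3 → ∀ i < 3, 2 ≤ i → Nat.gcd i (2 * 3) = 1 → Eng p 9 3 false (((3 ^ i + 1) / 2) % (3 ^ 3 - 1))) := by
  have h3 : 3 ≤ p := by have := hp.two_le; omega
  rcases cov9 p hb h3 with ⟨q, hq, hqp, hm⟩ | h | h
  · exact (cov_prime hp hqp hm (by rintro rfl; revert hq; decide)).elim
  · exact tabC tab9_0_ok h
  · exact tabC tab9_1_ok h

theorem known9 {F : Type*} [Field F] [Fintype F] {p k : ℕ} [Fact p.Prime] (hp2 : p ≠ 2) (hb : p ^ 9 ≤ 2 ^ 30)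
    (hF : Fintype.card F = p ^ 9) (hpl : Planar F k) : Known p 9 k := by
  have hp : p.Prime := Fact.out
  have hlt : p < 11 := lt_of_pow_bound hb (by norm_num)
  have hQ2 := two_lt_pow hp hp2 (n := 9) (by norm_num)
  obtain ⟨E, _, _, hcE, hplE⟩ := hpl.descend (by norm_num) hF (show 3 ∣ 9 by norm_num) (by norm_num)
  exact step_comp hp2 (by norm_num) hQ2 hF hpl 3 (by norm_num)
    (known3 hp2 (le_trans (Nat.pow_le_pow_right hp.pos (by norm_num)) hb) hcE hplE) (eng9 hp hp2 hlt).1 (eng9 hp hp2 hlt).2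

def tab10_0 : List Ent := [
  (3, 8, [[], [0, 3, 7, 9], [1, 3, 4], [1, 3, 6], [1, 2, 3], [1, 4, 7], [2, 4, 6], [1, 2, 4, 6], [0, 6, 8], [0, 2, 9],
    [0, 3, 9], [1, 3, 7], [1, 5, 8], [2, 4, 7], [0, 4, 6, 8], [0, 3, 7], [0, 0, 0, 7], [0, 0, 4, 7], [1, 2, 5], [0, 0,
    3, 7], [0, 1, 6, 6], [0, 3, 4, 7], [1, 2, 4, 7], [0, 1, 3], [1, 2, 4], [0, 1, 1, 7], [0, 1, 3, 6], [0, 2, 3, 8],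
    [0, 2, 4], [0, 2, 8], [0, 2, 4, 8], [0, 3, 6, 9], [0, 5, 7, 9], [1, 2, 7, 8], [0, 4, 6], [0, 7, 8], [1, 2, 6], [0,
    1, 4, 8], [0, 2, 4, 7], [0, 2, 6]], [4, 13, 985], [[10, 0, 0, 5, 5]]), (5, 12, [[], [4], [3], [2], [2, 4, 6, 8],
    [2, 4], [1, 4], [1], [3, 6], [1, 7], [0, 2, 6, 9], [0, 6, 8, 9], [0, 3, 6, 7], [0, 2, 3, 4], [0, 0, 1, 5], [0, 0,
    2, 4]], [46981], []), (7, 13, [[], [4], [3], [1], [2], [2, 4, 6, 8], [1, 3], [2, 6], [0, 3, 6, 6], [1, 8], [1, 2,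
    8]], [11529799, 28824055, 201768134, 6175, 35059405, 14701, 1135, 826302], [])]

theorem tab10_0_ok : allL tab10_0 (chkCE 10 5) = true := by decide +kernel

theorem cov10 : ∀ p < 9, 3 ≤ p → (∃ q ∈ [2], q < p ∧ p % q = 0) ∨ p ∈ tab10_0.map Prod.fst := by decide +kernel

theorem eng10 {p : ℕ} (hp : p.Prime) (hp2 : p ≠ 2) (hb : p < 9) :
    (∀ i < 5, 2 * i ≤ 5 → Odd (5 / Nat.gcd i 5) → Eng p 10 5 false ((p ^ i + 1) % (p ^ 5 - 1))) ∧
    (p = 3 → ∀ i < 5, 2 ≤ i → Nat.gcd i (2 * 5) = 1 → Eng p 10 5 false (((3 ^ i + 1) / 2) % (3 ^ 5 - 1))) := by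
  have h3 : 3 ≤ p := by have := hp.two_le; omega
  rcases cov10 p hb h3 with ⟨q, hq, hqp, hm⟩ | h
  · exact (cov_prime hp hqp hm (by rintro rfl; revert hq; decide)).elim
  · exact tabC tab10_0_ok h

theorem known10 {F : Type*} [Field F] [Fintype F] {p k : ℕ} [Fact p.Prime] (hp2 : p ≠ 2) (hb : p ^ 10 ≤ 2 ^ 30)
    (hF : Fintype.card F = p ^ 10) (hpl : Planar F k) : Known p 10 k := by
  have hp : p.Prime := Fact.out
  have hlt : p < 9 := lt_of_pow_bound hb (by norm_num)
  have hQ2 := two_lt_pow hp hp2 (n := 10) (by norm_num)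
  obtain ⟨E, _, _, hcE, hplE⟩ := hpl.descend (by norm_num) hF (show 5 ∣ 10 by norm_num) (by norm_num)
  exact step_comp hp2 (by norm_num) hQ2 hF hpl 5 (by norm_num)
    (known5 hp2 (le_trans (Nat.pow_le_pow_right hp.pos (by norm_num)) hb) hcE hplE) (eng10 hp hp2 hlt).1 (eng10 hp hp2 hlt).2

def tab11_0 : List Ent := [
  (3, 13, [[], [0], [0, 3, 3], [0, 5, 6], [0, 0, 5], [0, 7, 8], [0, 1, 8], [0, 2, 2], [1, 2, 8], [0, 2, 7], [1, 7, 9],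
    [1, 2, 4], [0, 1, 5], [0, 2, 8], [0, 5, 10], [0, 3, 6], [1, 2, 6], [0, 1, 10], [0, 5, 9], [0, 0, 4], [0, 2, 6],
    [0, 2, 3], [0, 8, 9], [1, 2, 9], [2, 4, 6], [1, 3, 6], [0, 1, 6], [1, 3, 5], [0, 0, 6], [0, 6, 7], [0, 2, 5], [1,
    6, 9], [1, 4, 6], [1, 6, 8], [0, 3, 8], [2, 4, 7], [1, 4, 7], [0, 2, 9], [2, 5, 8], [0, 1, 2]], [82, 2215, 2242,
    4, 163, 757, 244, 10, 13, 19768, 13123, 55, 6646, 496, 13204, 2200, 39367, 976, 91, 1066, 40852, 40, 20176, 487,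
    1030, 4621, 43096, 2212, 19687, 19984, 1549, 40123, 2308, 6682, 118165, 21964, 7546, 13963, 3892, 19780, 6811],
    [[11, 0, 0, 3, 8], [11, 0, 0, 1, 10], [11, 0, 0], [11, 0, 0, 5, 6], [11, 0, 0, 4, 7], [11, 0, 0, 2, 3], [11, 0, 0,
    2, 2], [11, 0, 0, 2, 9], [11, 0, 0, 1, 7], [11, 0, 0, 5, 5], [11, 0, 0, 3, 3], [11, 0, 0, 1, 2], [11, 0, 0, 1, 1,
    4, 4], [11, 0, 0, 1, 1, 5, 6], [11, 0, 0, 1, 1, 9, 10]])]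

theorem tab11_0_ok : allL tab11_0 (chkPE 11) = true := by decide +kernel

theorem cov11 : ∀ p < 7, 3 ≤ p → (∃ q ∈ [2], q < p ∧ p % q = 0) ∨ p ∈ tab11_0.map Prod.fst
    ∨ p = 5 := by decide +kernel

theorem eng11 {p : ℕ} (hp : p.Prime) (hp2 : p ≠ 2) (hb : p < 7) :
    Eng p 11 1 true (2 % (p - 1)) := by
  have h3 : 3 ≤ p := by have := hp.two_le; omega
  rcases cov11 p hb h3 with ⟨q, hq, hqp, hm⟩ | h | rfl
  · exact (cov_prime hp hqp hm (by rintro rfl; revert hq; decide)).elim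
  · exact tabP tab11_0_ok h
  · exact c5_11_E

theorem known11 {F : Type*} [Field F] [Fintype F] {p k : ℕ} [Fact p.Prime] (hp2 : p ≠ 2) (hb : p ^ 11 ≤ 2 ^ 30)
    (hF : Fintype.card F = p ^ 11) (hpl : Planar F k) : Known p 11 k := by
  have hp : p.Prime := Fact.out
  have hlt : p < 7 := lt_of_pow_bound hb (by norm_num)
  have hQ2 := two_lt_pow hp hp2 (n := 11) (by norm_num)
  exact step_prime hp2 (by norm_num) hQ2 hF hpl (eng11 hp hp2 hlt)

def tab12_0 : List Ent := [
  (3, 10, [[], [0, 0, 5, 9], [0, 4, 6, 8], [2, 5, 8], [2, 4, 9], [2, 5, 9], [0, 4, 9], [0, 2, 9], [1, 4, 9], [1, 3,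
    7], [1, 4, 7], [0, 3, 5], [1, 5, 7], [0, 1, 1, 10], [0, 5, 10], [1, 4, 10], [0, 4, 9, 10], [0, 4, 11], [0, 8, 11],
    [0, 0, 3, 6], [0, 2, 11], [0, 8, 9], [0, 1, 9, 10], [0, 2, 3, 5], [1, 2, 9], [2, 4, 7, 9], [1, 4, 8], [0, 1, 3,
    7], [0, 2, 6, 9], [0, 3, 3, 11], [0, 2, 4], [1, 2, 10], [0, 3, 8, 10], [0, 7, 9, 10], [1, 3, 5], [0, 1, 1, 4], [0,
    0, 0, 8], [0, 1, 8, 11], [0, 3, 4, 4], [0, 4, 4, 9]], [118264, 4375, 13243, 118219, 24313], [[12, 0, 0, 6, 6],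
    [12, 0, 0, 1, 6], [12, 0, 1, 5, 6], [12, 0, 0, 1, 2, 3, 3, 4, 5]]), (5, 13, [[], [5], [3], [4, 8], [4], [1], [1,
    4, 5, 8], [0, 0, 10, 11], [0, 1, 3, 8], [0, 0, 1, 8], [1, 9], [2, 4, 7, 9], [0, 0, 5, 10], [0, 1, 8, 10], [0, 7],
    [0, 0, 2, 4]], [2581, 741, 7812581, 14381, 195314381, 984561], [])]

theorem tab12_0_ok : allL tab12_0 (chkCE 12 6) = true := by decide +kernel

theorem cov12 : ∀ p < 6, 3 ≤ p → (∃ q ∈ [2], q < p ∧ p % q = 0) ∨ p ∈ tab12_0.map Prod.fst := by decide +kernel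

theorem eng12 {p : ℕ} (hp : p.Prime) (hp2 : p ≠ 2) (hb : p < 6) :
    (∀ i < 6, 2 * i ≤ 6 → Odd (6 / Nat.gcd i 6) → Eng p 12 6 false ((p ^ i + 1) % (p ^ 6 - 1))) ∧
    (p = 3 → ∀ i < 6, 2 ≤ i → Nat.gcd i (2 * 6) = 1 → Eng p 12 6 false (((3 ^ i + 1) / 2) % (3 ^ 6 - 1))) := by
  have h3 : 3 ≤ p := by have := hp.two_le; omega
  rcases cov12 p hb h3 with ⟨q, hq, hqp, hm⟩ | h
  · exact (cov_prime hp hqp hm (by rintro rfl; revert hq; decide)).elim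
  · exact tabC tab12_0_ok h

theorem known12 {F : Type*} [Field F] [Fintype F] {p k : ℕ} [Fact p.Prime] (hp2 : p ≠ 2) (hb : p ^ 12 ≤ 2 ^ 30)
    (hF : Fintype.card F = p ^ 12) (hpl : Planar F k) : Known p 12 k := by
  have hp : p.Prime := Fact.out
  have hlt : p < 6 := lt_of_pow_bound hb (by norm_num)
  have hQ2 := two_lt_pow hp hp2 (n := 12) (by norm_num)
  obtain ⟨E, _, _, hcE, hplE⟩ := hpl.descend (by norm_num) hF (show 6 ∣ 12 by norm_num) (by norm_num)
  exact step_comp hp2 (by norm_num) hQ2 hF hpl 6 (by norm_num)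
    (known6 hp2 (le_trans (Nat.pow_le_pow_right hp.pos (by norm_num)) hb) hcE hplE) (eng12 hp hp2 hlt).1 (eng12 hp hp2 hlt).2

theorem cov13 : ∀ p < 5, 3 ≤ p → (∃ q ∈ [2], q < p ∧ p % q = 0) ∨ p = 3 := by decide +kernel

theorem eng13 {p : ℕ} (hp : p.Prime) (hp2 : p ≠ 2) (hb : p < 5) :
    Eng p 13 1 true (2 % (p - 1)) := by
  have h3 : 3 ≤ p := by have := hp.two_le; omega
  rcases cov13 p hb h3 with ⟨q, hq, hqp, hm⟩ | rfl
  · exact (cov_prime hp hqp hm (by rintro rfl; revert hq; decide)).elim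
  · exact c3_13_E

theorem known13 {F : Type*} [Field F] [Fintype F] {p k : ℕ} [Fact p.Prime] (hp2 : p ≠ 2) (hb : p ^ 13 ≤ 2 ^ 30)
    (hF : Fintype.card F = p ^ 13) (hpl : Planar F k) : Known p 13 k := by
  have hp : p.Prime := Fact.out
  have hlt : p < 5 := lt_of_pow_bound hb (by norm_num)
  have hQ2 := two_lt_pow hp hp2 (n := 13) (by norm_num)
  exact step_prime hp2 (by norm_num) hQ2 hF hpl (eng13 hp hp2 hlt)

def tab14_0 : List Ent := [
  (3, 12, [[], [1, 3, 12], [2, 5, 10], [1, 4, 9], [2, 4, 6], [2, 8, 11], [1, 2, 11], [2, 5, 11], [1, 3, 4], [2, 5, 9],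
    [2, 6, 10], [0, 10, 12], [1, 2, 12], [1, 10, 12], [1, 9, 12], [2, 6, 11], [1, 7, 10], [2, 5, 8], [0, 2, 11], [0,
    9, 12], [1, 6, 11], [2, 4, 10], [2, 4, 8], [0, 3, 12], [2, 4, 6, 10], [1, 6, 8, 10], [1, 5, 10], [1, 4, 8], [0, 2,
    4], [0, 1, 11], [1, 2, 6], [1, 3, 6], [1, 5, 9], [0, 2, 11, 11], [0, 1, 4, 12], [0, 9, 11, 13], [1, 4, 6], [0, 2,
    11, 12], [0, 3, 4, 8], [0, 3, 5, 7]], [253, 487, 19765, 91, 31, 10, 121, 60025, 545323, 177187, 1423768, 118345,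
    656113], [[14, 0, 0, 7, 7]])]

theorem tab14_0_ok : allL tab14_0 (chkCE 14 7) = true := by decide +kernel

theorem cov14 : ∀ p < 5, 3 ≤ p → (∃ q ∈ [2], q < p ∧ p % q = 0) ∨ p ∈ tab14_0.map Prod.fst := by decide +kernel

theorem eng14 {p : ℕ} (hp : p.Prime) (hp2 : p ≠ 2) (hb : p < 5) :
    (∀ i < 7, 2 * i ≤ 7 → Odd (7 / Nat.gcd i 7) → Eng p 14 7 false ((p ^ i + 1) % (p ^ 7 - 1))) ∧
    (p = 3 → ∀ i < 7, 2 ≤ i → Nat.gcd i (2 * 7) = 1 → Eng p 14 7 false (((3 ^ i + 1) / 2) % (3 ^ 7 - 1))) := by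
  have h3 : 3 ≤ p := by have := hp.two_le; omega
  rcases cov14 p hb h3 with ⟨q, hq, hqp, hm⟩ | h
  · exact (cov_prime hp hqp hm (by rintro rfl; revert hq; decide)).elim
  · exact tabC tab14_0_ok h

theorem known14 {F : Type*} [Field F] [Fintype F] {p k : ℕ} [Fact p.Prime] (hp2 : p ≠ 2) (hb : p ^ 14 ≤ 2 ^ 30)
    (hF : Fintype.card F = p ^ 14) (hpl : Planar F k) : Known p 14 k := by
  have hp : p.Prime := Fact.out
  have hlt : p < 5 := lt_of_pow_bound hb (by norm_num)
  have hQ2 := two_lt_pow hp hp2 (n := 14) (by norm_num)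
  obtain ⟨E, _, _, hcE, hplE⟩ := hpl.descend (by norm_num) hF (show 7 ∣ 14 by norm_num) (by norm_num)
  exact step_comp hp2 (by norm_num) hQ2 hF hpl 7 (by norm_num)
    (known7 hp2 (le_trans (Nat.pow_le_pow_right hp.pos (by norm_num)) hb) hcE hplE) (eng14 hp hp2 hlt).1 (eng14 hp hp2 hlt).2

def tab15_0 : List Ent := [
  (3, 13, [[], [0], [0, 0, 6], [0, 6, 11], [0, 5, 6], [0, 0, 5], [0, 0, 7], [1, 10, 12], [1, 2, 5], [2, 5, 11], [1, 5,
    11], [2, 8, 12], [0, 2, 6], [0, 2, 5], [1, 2, 10], [0, 4, 13], [1, 3, 13], [1, 2, 9], [0, 13, 14], [1, 3, 7], [0,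
    5, 11], [0, 6, 10], [0, 10, 11], [0, 1, 5], [0, 5, 14], [0, 1, 10], [0, 11, 14], [2, 7, 9], [1, 6, 10], [1, 6,
    13], [3, 6, 11], [0, 8, 12], [1, 3, 10], [1, 10, 13], [1, 11, 13], [2, 9, 12], [3, 6, 10], [3, 6, 9], [1, 4, 11],
    [0, 6, 13]], [46, 20422, 733, 4, 533632, 10, 7402, 531451, 179338, 66430, 179362, 19, 22630, 356536, 551884,
    26986, 1135084, 6592, 39529, 39616, 354376, 2125858, 553342, 6736, 545068, 1062994, 250, 538252, 6898, 374482,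
    39367, 1596676, 354700, 19966, 1417420, 19900, 39400, 1083322, 24064, 3247948, 20584, 1065556, 1124368, 179428,
    13948, 238, 6880, 72274], [[3, 0, 0], [3, 0, 0, 1, 2]])]

theorem tab15_0_ok : allL tab15_0 (chkCE 15 5) = true := by decide +kernel

theorem cov15 : ∀ p < 5, 3 ≤ p → (∃ q ∈ [2], q < p ∧ p % q = 0) ∨ p ∈ tab15_0.map Prod.fst := by decide +kernel

theorem eng15 {p : ℕ} (hp : p.Prime) (hp2 : p ≠ 2) (hb : p < 5) :
    (∀ i < 5, 2 * i ≤ 5 → Odd (5 / Nat.gcd i 5) → Eng p 15 5 false ((p ^ i + 1) % (p ^ 5 - 1))) ∧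
    (p = 3 → ∀ i < 5, 2 ≤ i → Nat.gcd i (2 * 5) = 1 → Eng p 15 5 false (((3 ^ i + 1) / 2) % (3 ^ 5 - 1))) := by
  have h3 : 3 ≤ p := by have := hp.two_le; omega
  rcases cov15 p hb h3 with ⟨q, hq, hqp, hm⟩ | h
  · exact (cov_prime hp hqp hm (by rintro rfl; revert hq; decide)).elim
  · exact tabC tab15_0_ok h

theorem known15 {F : Type*} [Field F] [Fintype F] {p k : ℕ} [Fact p.Prime] (hp2 : p ≠ 2) (hb : p ^ 15 ≤ 2 ^ 30)
    (hF : Fintype.card F = p ^ 15) (hpl : Planar F k) : Known p 15 k := by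
  have hp : p.Prime := Fact.out
  have hlt : p < 5 := lt_of_pow_bound hb (by norm_num)
  have hQ2 := two_lt_pow hp hp2 (n := 15) (by norm_num)
  obtain ⟨E, _, _, hcE, hplE⟩ := hpl.descend (by norm_num) hF (show 5 ∣ 15 by norm_num) (by norm_num)
  exact step_comp hp2 (by norm_num) hQ2 hF hpl 5 (by norm_num)
    (known5 hp2 (le_trans (Nat.pow_le_pow_right hp.pos (by norm_num)) hb) hcE hplE) (eng15 hp hp2 hlt).1 (eng15 hp hp2 hlt).2

def tab16_0 : List Ent := [
  (3, 13, [[], [0, 0, 0, 8], [2, 6, 12], [2, 4, 6], [1, 11, 14], [0, 12, 15], [3, 6, 9], [2, 5, 11], [1, 2, 6], [0,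
    10, 12, 15], [1, 5, 11], [1, 2, 13, 14], [1, 3, 5], [2, 4, 6, 8], [1, 2, 4, 6], [0, 4, 10, 14], [0, 10, 11, 14],
    [1, 3, 11, 12], [1, 4, 14], [0, 2, 3, 7], [3, 6, 12], [2, 7, 12], [3, 6, 10], [0, 1, 9, 9], [1, 2, 5], [2, 7, 13],
    [1, 3, 6], [2, 4, 11], [0, 11, 12, 14], [0, 4, 7], [1, 11, 13], [2, 6, 9, 12], [1, 4, 6, 11], [1, 3, 9, 12], [1,
    6, 9], [1, 7, 12], [1, 9, 11, 14], [1, 3, 13], [1, 7, 9, 11], [0, 10, 11, 13]], [85, 247, 739, 59131, 177883, 253,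
    2197, 118099, 415, 2191, 31, 487, 10628851, 1082569, 532921, 4804870, 2126506, 5316628, 118183, 30469375, 2657245,
    531751], [[16, 0, 1, 7, 8], [16, 0, 0, 8, 8], [16, 0, 0, 1, 8], [16, 0, 0, 1, 2, 3, 4, 4, 5, 6, 7]])]

theorem tab16_0_ok : allL tab16_0 (chkCE 16 8) = true := by decide +kernel

theorem cov16 : ∀ p < 4, 3 ≤ p → (∃ q ∈ [2], q < p ∧ p % q = 0) ∨ p ∈ tab16_0.map Prod.fst := by decide +kernel

theorem eng16 {p : ℕ} (hp : p.Prime) (hp2 : p ≠ 2) (hb : p < 4) :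
    (∀ i < 8, 2 * i ≤ 8 → Odd (8 / Nat.gcd i 8) → Eng p 16 8 false ((p ^ i + 1) % (p ^ 8 - 1))) ∧
    (p = 3 → ∀ i < 8, 2 ≤ i → Nat.gcd i (2 * 8) = 1 → Eng p 16 8 false (((3 ^ i + 1) / 2) % (3 ^ 8 - 1))) := by
  have h3 : 3 ≤ p := by have := hp.two_le; omega
  rcases cov16 p hb h3 with ⟨q, hq, hqp, hm⟩ | h
  · exact (cov_prime hp hqp hm (by rintro rfl; revert hq; decide)).elim
  · exact tabC tab16_0_ok h

theorem known16 {F : Type*} [Field F] [Fintype F] {p k : ℕ} [Fact p.Prime] (hp2 : p ≠ 2) (hb : p ^ 16 ≤ 2 ^ 30)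
    (hF : Fintype.card F = p ^ 16) (hpl : Planar F k) : Known p 16 k := by
  have hp : p.Prime := Fact.out
  have hlt : p < 4 := lt_of_pow_bound hb (by norm_num)
  have hQ2 := two_lt_pow hp hp2 (n := 16) (by norm_num)
  obtain ⟨E, _, _, hcE, hplE⟩ := hpl.descend (by norm_num) hF (show 8 ∣ 16 by norm_num) (by norm_num)
  exact step_comp hp2 (by norm_num) hQ2 hF hpl 8 (by norm_num)
    (known8 hp2 (le_trans (Nat.pow_le_pow_right hp.pos (by norm_num)) hb) hcE hplE) (eng16 hp hp2 hlt).1 (eng16 hp hp2 hlt).2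

theorem cov17 : ∀ p < 4, 3 ≤ p → (∃ q ∈ [2], q < p ∧ p % q = 0) ∨ p = 3 := by decide +kernel

theorem eng17 {p : ℕ} (hp : p.Prime) (hp2 : p ≠ 2) (hb : p < 4) :
    Eng p 17 1 true (2 % (p - 1)) := by
  have h3 : 3 ≤ p := by have := hp.two_le; omega
  rcases cov17 p hb h3 with ⟨q, hq, hqp, hm⟩ | rfl
  · exact (cov_prime hp hqp hm (by rintro rfl; revert hq; decide)).elim
  · exact c3_17_E

theorem known17 {F : Type*} [Field F] [Fintype F] {p k : ℕ} [Fact p.Prime] (hp2 : p ≠ 2) (hb : p ^ 17 ≤ 2 ^ 30)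
    (hF : Fintype.card F = p ^ 17) (hpl : Planar F k) : Known p 17 k := by
  have hp : p.Prime := Fact.out
  have hlt : p < 4 := lt_of_pow_bound hb (by norm_num)
  have hQ2 := two_lt_pow hp hp2 (n := 17) (by norm_num)
  exact step_prime hp2 (by norm_num) hQ2 hF hpl (eng17 hp hp2 hlt)

def tab18_0 : List Ent := [
  (3, 13, [[], [0, 0, 7, 13], [2, 6, 14], [2, 11, 14], [2, 8, 13], [1, 4, 8, 14], [1, 13, 16], [1, 5, 12], [1, 8, 13],
    [2, 4, 15], [1, 2, 7], [1, 11, 14], [1, 2, 14], [0, 5, 7, 12], [0, 5, 16], [3, 7, 14], [1, 3, 4, 7], [1, 3, 5,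
    16], [1, 6, 12, 14], [0, 2, 4], [2, 6, 13], [2, 5, 7], [2, 6, 12], [2, 7, 14], [2, 4, 7], [2, 6, 8, 12], [1, 12,
    15], [3, 7, 11], [2, 12, 15], [1, 3, 15], [1, 4, 16], [2, 5, 13], [2, 5, 8], [1, 2, 13], [3, 7, 13], [1, 3, 7,
    13], [1, 3, 6, 13], [1, 2, 4, 6], [1, 4, 7, 12], [2, 5, 12, 15]], [253, 177229, 91, 757, 4782973, 6565, 86093443,
    177175, 86743873, 531685, 28704385, 9568153, 92470747, 9566059, 14353537, 4791739, 59869, 86094427, 1596577],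
    [[18, 0, 0, 9, 9]])]

theorem tab18_0_ok : allL tab18_0 (chkCE 18 9) = true := by decide +kernel

theorem cov18 : ∀ p < 4, 3 ≤ p → (∃ q ∈ [2], q < p ∧ p % q = 0) ∨ p ∈ tab18_0.map Prod.fst := by decide +kernel

theorem eng18 {p : ℕ} (hp : p.Prime) (hp2 : p ≠ 2) (hb : p < 4) :
    (∀ i < 9, 2 * i ≤ 9 → Odd (9 / Nat.gcd i 9) → Eng p 18 9 false ((p ^ i + 1) % (p ^ 9 - 1))) ∧
    (p = 3 → ∀ i < 9, 2 ≤ i → Nat.gcd i (2 * 9) = 1 → Eng p 18 9 false (((3 ^ i + 1) / 2) % (3 ^ 9 - 1))) := by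
  have h3 : 3 ≤ p := by have := hp.two_le; omega
  rcases cov18 p hb h3 with ⟨q, hq, hqp, hm⟩ | h
  · exact (cov_prime hp hqp hm (by rintro rfl; revert hq; decide)).elim
  · exact tabC tab18_0_ok h

theorem known18 {F : Type*} [Field F] [Fintype F] {p k : ℕ} [Fact p.Prime] (hp2 : p ≠ 2) (hb : p ^ 18 ≤ 2 ^ 30)
    (hF : Fintype.card F = p ^ 18) (hpl : Planar F k) : Known p 18 k := by
  have hp : p.Prime := Fact.out
  have hlt : p < 4 := lt_of_pow_bound hb (by norm_num)
  have hQ2 := two_lt_pow hp hp2 (n := 18) (by norm_num)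
  obtain ⟨E, _, _, hcE, hplE⟩ := hpl.descend (by norm_num) hF (show 9 ∣ 18 by norm_num) (by norm_num)
  exact step_comp hp2 (by norm_num) hQ2 hF hpl 9 (by norm_num)
    (known9 hp2 (le_trans (Nat.pow_le_pow_right hp.pos (by norm_num)) hb) hcE hplE) (eng18 hp hp2 hlt).1 (eng18 hp hp2 hlt).2

end PM

theorem stmt_16 (p n : ℕ) (hp : p.Prime) (hodd : Odd p) (hn : 0 < n)
    (hbound : p ^ n ≤ 2 ^ 30)
    (F : Type*) [Field F] [Fintype F] (hF : Fintype.card F = p ^ n)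
    (k : ℕ) (hk : 0 < k)
    (hplanar : ∀ a : F, a ≠ 0 → Function.Bijective (fun x : F => (x + a) ^ k - x ^ k)) :
    ∃ a < n,
      (∃ i < n, Odd (n / Nat.gcd i n) ∧ k ≡ p ^ a * (p ^ i + 1) [MOD p ^ n - 1]) ∨
        (p = 3 ∧ ∃ i < n, Nat.gcd i (2 * n) = 1 ∧
          k ≡ 3 ^ a * ((3 ^ i + 1) / 2) [MOD 3 ^ n - 1]) := by
  haveI : Fact p.Prime := ⟨hp⟩
  have hp2 : p ≠ 2 := by rintro rfl; revert hodd; decide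
  have h3 : 3 ≤ p := by have := hp.two_le; omega
  have hn18 : n ≤ 18 := by
    by_contra hcon
    have h1 : 3 ^ 19 ≤ 3 ^ n := Nat.pow_le_pow_right (by norm_num) (by omega)
    have h2 : 3 ^ n ≤ p ^ n := Nat.pow_le_pow_left h3 n
    have h4 : (2 : ℕ) ^ 30 < 3 ^ 19 := by norm_num
    omega
  have hpl : PM.Planar F k := hplanar
  change PM.Known p n k
  interval_cases n
  · exact PM.known1 hp2 hbound hF hpl
  · exact PM.known2 hp2 hbound hF hpl
  · exact PM.known3 hp2 hbound hF hpl
  · exact PM.known4 hp2 hbound hF hpl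
  · exact PM.known5 hp2 hbound hF hpl
  · exact PM.known6 hp2 hbound hF hpl
  · exact PM.known7 hp2 hbound hF hpl
  · exact PM.known8 hp2 hbound hF hpl
  · exact PM.known9 hp2 hbound hF hpl
  · exact PM.known10 hp2 hbound hF hpl
  · exact PM.known11 hp2 hbound hF hpl
  · exact PM.known12 hp2 hbound hF hpl
  · exact PM.known13 hp2 hbound hF hpl
  · exact PM.known14 hp2 hbound hF hpl
  · exact PM.known15 hp2 hbound hF hpl
  · exact PM.known16 hp2 hbound hF hpl
  · exact PM.known17 hp2 hbound hF hpl
  · exact PM.known18 hp2 hbound hF hpl
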